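/- Let u ∈ P_∞(0,M) and suppose that either the set {x : u(x) = 0} has nonempty interior or δ_r(u) > 0 for some r > 0. Then u ≥ 0 everywhere on ℝ^N and the complement ℝ^N \ Ω is convex. Moreover, if limsup_{R→∞} δ_R(u) > 0, then u is a half-space solution. -/

import Mathlib

open MeasureTheory Metric Set Filter
open scoped RealInnerProductSpace

noncomputable section

/-- The Laplacian of `φ` at `x`, as the sum of the pure second derivatives. -/
def lap (N : ℕ) (φ : EuclideanSpace ℝ (Fin N) → ℝ) (x : EuclideanSpace ℝ (Fin N)) : ℝ :=
  ∑ i : Fin N,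
    fderiv ℝ (fun y => fderiv ℝ φ y (EuclideanSpace.single i 1)) x (EuclideanSpace.single i 1)

/-- Membership in the class `P_r(z, M)`. -/
def MemP (N : ℕ) (r : ℝ) (z : EuclideanSpace ℝ (Fin N)) (M : ℝ)
    (Ω : Set (EuclideanSpace ℝ (Fin N))) (u : EuclideanSpace ℝ (Fin N) → ℝ) : Prop :=
  IsOpen Ω ∧ ContDiff ℝ 1 u ∧
    (∀ φ : EuclideanSpace ℝ (Fin N) → ℝ, ContDiff ℝ (⊤ : ℕ∞) φ → tsupport φ ⊆ ball z r →
      ∫ x, u x * lap N φ x = ∫ x in Ω, φ x) ∧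
    (∀ x ∈ ball z r \ Ω, u x = 0 ∧ gradient u x = 0) ∧
    (∀ x ∈ ball z r, |u x| ≤ M) ∧
    z ∈ frontier Ω

/-- Membership in the class `P_∞(0, M)` of global solutions with quadratic growth. -/
def MemPinf (N : ℕ) (M : ℝ) (Ω : Set (EuclideanSpace ℝ (Fin N)))
    (u : EuclideanSpace ℝ (Fin N) → ℝ) : Prop :=
  IsOpen Ω ∧ ContDiff ℝ 1 u ∧
    (∀ φ : EuclideanSpace ℝ (Fin N) → ℝ, ContDiff ℝ (⊤ : ℕ∞) φ → HasCompactSupport φ →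
      ∫ x, u x * lap N φ x = ∫ x in Ω, φ x) ∧
    (∀ x ∈ Ωᶜ, u x = 0 ∧ gradient u x = 0) ∧
    (0 : EuclideanSpace ℝ (Fin N)) ∈ frontier Ω ∧
    (∀ x, |u x| ≤ M * (‖x‖ ^ 2 + 1))

/-- The minimum diameter of a set: the smallest width of a slab containing it. -/
def MD (N : ℕ) (D : Set (EuclideanSpace ℝ (Fin N))) : ℝ :=
  ⨅ e : {e : EuclideanSpace ℝ (Fin N) // ‖e‖ = 1},
    ((⨆ x : D, ⟪(x : EuclideanSpace ℝ (Fin N)), (e : EuclideanSpace ℝ (Fin N))⟫) -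
      ⨅ x : D, ⟪(x : EuclideanSpace ℝ (Fin N)), (e : EuclideanSpace ℝ (Fin N))⟫)

/-- The density function `δ_r(u)`. -/
def deltaFn (N : ℕ) (u : EuclideanSpace ℝ (Fin N) → ℝ) (r : ℝ) : ℝ :=
  MD N ({x | u x = 0 ∧ gradient u x = 0} ∩ ball 0 r) / r

/-- Half-space solutions `x ↦ (max(⟪x,e⟫,0))²/2`. -/
def IsHalfSpaceSol (N : ℕ) (u : EuclideanSpace ℝ (Fin N) → ℝ) : Prop :=
  ∃ e : EuclideanSpace ℝ (Fin N), ‖e‖ = 1 ∧ ∀ x, u x = (max ⟪x, e⟫ 0) ^ 2 / 2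

/-- `∂Ω ∩ B` is the graph of a `C¹` function. -/
def IsC1Graph (N : ℕ) (Ω B : Set (EuclideanSpace ℝ (Fin N))) : Prop :=
  ∃ (e : EuclideanSpace ℝ (Fin N)) (f : EuclideanSpace ℝ (Fin N) → ℝ),
    ‖e‖ = 1 ∧ ContDiff ℝ 1 f ∧
    Ω ∩ B = {x ∈ B | f (x - ⟪x, e⟫ • e) < ⟪x, e⟫} ∧
    frontier Ω ∩ B = {x ∈ B | ⟪x, e⟫ = f (x - ⟪x, e⟫ • e)}

/-- `∂Ω ∩ B` is the graph of a real-analytic function. -/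
def IsAnalyticGraph (N : ℕ) (Ω B : Set (EuclideanSpace ℝ (Fin N))) : Prop :=
  ∃ (e : EuclideanSpace ℝ (Fin N)) (f : EuclideanSpace ℝ (Fin N) → ℝ),
    ‖e‖ = 1 ∧ (∀ x, AnalyticAt ℝ f x) ∧
    Ω ∩ B = {x ∈ B | f (x - ⟪x, e⟫ • e) < ⟪x, e⟫} ∧
    frontier Ω ∩ B = {x ∈ B | ⟪x, e⟫ = f (x - ⟪x, e⟫ • e)}

/-- The Alt–Caffarelli–Friedman functional `φ(r, v)` centered at the origin. -/
def acf (N : ℕ) (v : EuclideanSpace ℝ (Fin N) → ℝ) (r : ℝ) : ℝ :=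
  r ^ (-4 : ℤ) *
    (∫ x in ball (0 : EuclideanSpace ℝ (Fin N)) r,
      ‖gradient (fun y => max (v y) 0) x‖ ^ 2 * ‖x‖ ^ ((2 : ℤ) - (N : ℤ))) *
    ∫ x in ball (0 : EuclideanSpace ℝ (Fin N)) r,
      ‖gradient (fun y => max (-v y) 0) x‖ ^ 2 * ‖x‖ ^ ((2 : ℤ) - (N : ℤ))

/-- `S_j(z, u) = sup_{B(z, 2^{-j})} |u|`. -/
def Sj (N : ℕ) (z : EuclideanSpace ℝ (Fin N)) (u : EuclideanSpace ℝ (Fin N) → ℝ) (j : ℕ) : ℝ :=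
  sSup ((fun x => |u x|) '' ball z ((2 : ℝ) ^ (-(j : ℤ))))

namespace GlobalSol

/-- Euclidean space. -/
abbrev EN (N : ℕ) := EuclideanSpace ℝ (Fin N)

/-- Smooth radial profiles all of whose derivatives decay like `(1 + σ) ^ (-m)`. -/
structure Prof (m : ℕ) (g : ℝ → ℝ) : Prop where
  smooth : ContDiffOn ℝ (⊤ : ℕ∞) g (Ioi (-1))
  bound : ∀ i, ∃ C, ∀ σ, 0 ≤ σ → |iteratedDeriv i g σ| ≤ C * ((1 + σ) ^ m)⁻¹

theorem Prof.deriv {m : ℕ} {g : ℝ → ℝ} (h : Prof m g) : Prof m (deriv g) := by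
  refine ⟨?_, fun i => ?_⟩
  · exact h.smooth.deriv_of_isOpen isOpen_Ioi (by simp)
  · obtain ⟨C, hC⟩ := h.bound (i + 1)
    exact ⟨C, fun σ hσ => by simpa [iteratedDeriv_succ'] using hC σ hσ⟩

theorem Prof.const_mul {m : ℕ} {g : ℝ → ℝ} (h : Prof m g) (c : ℝ) :
    Prof m (fun σ => c * g σ) := by
  refine ⟨contDiffOn_const.mul h.smooth, fun i => ?_⟩
  obtain ⟨C, hC⟩ := h.bound i
  refine ⟨|c| * C, fun σ hσ => ?_⟩
  rw [iteratedDeriv_const_mul_field, abs_mul, mul_assoc]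
  exact mul_le_mul_of_nonneg_left (hC σ hσ) (abs_nonneg _)

theorem Prof.hasDerivAt {m : ℕ} {g : ℝ → ℝ} (h : Prof m g) {σ : ℝ} (hσ : 0 ≤ σ) :
    HasDerivAt g (_root_.deriv g σ) σ :=
  ((h.smooth.differentiableOn (by simp)).differentiableAt
    (isOpen_Ioi.mem_nhds (by simp only [mem_Ioi]; linarith))).hasDerivAt

/-- The profile whose values are minus twice the derivative of `g`. -/
def hat (g : ℝ → ℝ) : ℝ → ℝ := fun σ => (-2) * deriv g σ

theorem Prof.hat {m : ℕ} {g : ℝ → ℝ} (h : Prof m g) : Prof m (hat g) := h.deriv.const_mul (-2)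

variable {N : ℕ}

/-- Radial kernel. -/
def kr (g : ℝ → ℝ) (x : EN N) : ℝ := g (‖x‖ ^ 2)
/-- Linear kernel. -/
def kl (g : ℝ → ℝ) (e x : EN N) : ℝ := ⟪x, e⟫ * g (‖x‖ ^ 2)
/-- Quadratic kernel. -/
def kq (g : ℝ → ℝ) (e f x : EN N) : ℝ :=
  -(⟪e, f⟫ * g (‖x‖ ^ 2) + 2 * (⟪x, e⟫ * ⟪x, f⟫ * deriv g (‖x‖ ^ 2)))
/-- The derivative of the quadratic kernel. -/
def kc (g : ℝ → ℝ) (e f v x : EN N) : ℝ :=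
  -(⟪e, f⟫ * (2 * ⟪x, v⟫ * deriv g (‖x‖ ^ 2)) +
    2 * ((⟪v, e⟫ * ⟪x, f⟫ + ⟪x, e⟫ * ⟪v, f⟫) * deriv g (‖x‖ ^ 2) +
      ⟪x, e⟫ * ⟪x, f⟫ * (2 * ⟪x, v⟫ * deriv (deriv g) (‖x‖ ^ 2))))

section derivs
variable {m : ℕ} {g : ℝ → ℝ}

theorem hasFDerivAt_kr (h : Prof m g) (x : EN N) :
    HasFDerivAt (kr g) ((deriv g (‖x‖ ^ 2)) • ((2 : ℝ) • innerSL ℝ x)) x := by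
  have h1 : HasFDerivAt (fun y : EN N => ‖y‖ ^ 2) ((2 : ℝ) • innerSL ℝ x) x := by
    have := (hasStrictFDerivAt_norm_sq x).hasFDerivAt
    rwa [← Nat.cast_smul_eq_nsmul ℝ, Nat.cast_ofNat] at this
  exact (h.hasDerivAt (sq_nonneg _)).comp_hasFDerivAt x h1

theorem hasFDerivAt_inner (e x : EN N) :
    HasFDerivAt (fun y : EN N => ⟪y, e⟫) (innerSL ℝ e) x := by
  have := (innerSL ℝ e).hasFDerivAt (x := x)
  refine this.congr_of_eventuallyEq (Eventually.of_forall fun y => ?_)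
  simp [real_inner_comm]

theorem fderiv_kr (h : Prof m g) (x v : EN N) :
    fderiv ℝ (kr g) x v = 2 * ⟪x, v⟫ * deriv g (‖x‖ ^ 2) := by
  rw [(hasFDerivAt_kr h x).fderiv]; simp; ring

theorem fderiv_kl (h : Prof m g) (e x v : EN N) :
    fderiv ℝ (kl g e) x v = -kq g e v x := by
  have : HasFDerivAt (kl g e) _ x := (hasFDerivAt_inner e x).mul (hasFDerivAt_kr h x)
  rw [this.fderiv]; simp [kq, real_inner_comm]; ring

theorem fderiv_kq (h : Prof m g) (e f x v : EN N) :
    fderiv ℝ (kq g e f) x v = kc g e f v x := by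
  have : HasFDerivAt (kq g e f) _ x := (((hasFDerivAt_kr h x).const_mul ⟪e, f⟫).add
    ((((hasFDerivAt_inner e x).mul (hasFDerivAt_inner f x)).mul
      (hasFDerivAt_kr h.deriv x)).const_mul 2)).neg
  rw [this.fderiv]; simp [kc, kr, real_inner_comm v]; ring

theorem fderiv_kc (h : Prof m g) (e f v x : EN N) :
    fderiv ℝ (kc g e f v) x v =
     -(⟪e, f⟫ * (2 * ⟪v, v⟫ * deriv g (‖x‖ ^ 2) + 4 * ⟪x, v⟫ ^ 2 * deriv (deriv g) (‖x‖ ^ 2)) +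
      2 * ((2 * ⟪v, e⟫ * ⟪v, f⟫) * deriv g (‖x‖ ^ 2) +
        4 * (⟪v, e⟫ * ⟪x, f⟫ + ⟪x, e⟫ * ⟪v, f⟫) * ⟪x, v⟫ * deriv (deriv g) (‖x‖ ^ 2) +
        ⟪x, e⟫ * ⟪x, f⟫ * (2 * ⟪v, v⟫ * deriv (deriv g) (‖x‖ ^ 2) +
          4 * ⟪x, v⟫ ^ 2 * deriv (deriv (deriv g)) (‖x‖ ^ 2)))) := by
  have a1 := hasFDerivAt_inner e x
  have a2 := hasFDerivAt_inner f x
  have a3 := hasFDerivAt_inner v x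
  have b1 := hasFDerivAt_kr h.deriv x
  have b2 := hasFDerivAt_kr h.deriv.deriv x
  have : HasFDerivAt (kc g e f v) _ x := ((((a3.const_mul 2).mul b1).const_mul ⟪e, f⟫).add
    (((((a2.const_mul ⟪v, e⟫).add (a1.mul_const ⟪v, f⟫)).mul b1).add
      ((a1.mul a2).mul ((a3.const_mul 2).mul b2))).const_mul 2)).neg
  rw [this.fderiv]; simp [kr, real_inner_comm v]; ring

theorem contDiff_kr (h : Prof m g) : ContDiff ℝ (⊤ : ℕ∞) (kr g : EN N → ℝ) := by
  have : ContDiff ℝ (⊤ : ℕ∞) (fun y : EN N => ‖y‖ ^ 2) := contDiff_norm_sq ℝ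
  rw [← contDiffOn_univ] at this ⊢
  exact h.smooth.comp this (fun x _ => by simp only [mem_Ioi]; nlinarith [sq_nonneg ‖x‖])

theorem contDiff_inner_right (e : EN N) : ContDiff ℝ (⊤ : ℕ∞) (fun y : EN N => ⟪y, e⟫) :=
  contDiff_id.inner ℝ contDiff_const

theorem contDiff_kl (h : Prof m g) (e : EN N) : ContDiff ℝ (⊤ : ℕ∞) (kl g e) :=
  (contDiff_inner_right e).mul (contDiff_kr h)

theorem contDiff_kq (h : Prof m g) (e f : EN N) : ContDiff ℝ (⊤ : ℕ∞) (kq g e f) :=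
  ((contDiff_const.mul (contDiff_kr h)).add (contDiff_const.mul
    (((contDiff_inner_right e).mul (contDiff_inner_right f)).mul (contDiff_kr h.deriv)))).neg

theorem sum_inner_mul (e f : EN N) :
    ∑ i : Fin N, ⟪e, EuclideanSpace.single i (1 : ℝ)⟫ * ⟪EuclideanSpace.single i (1 : ℝ), f⟫
      = ⟪e, f⟫ := by
  have := (EuclideanSpace.basisFun (Fin N) ℝ).sum_inner_mul_inner e f
  simpa using this

theorem inner_single_self (i : Fin N) :
    ⟪EuclideanSpace.single i (1 : ℝ), EuclideanSpace.single i (1 : ℝ)⟫ = 1 := by simp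

theorem lap_kr (h : Prof m g) (x : EN N) :
    lap N (kr g) x = 2 * N * deriv g (‖x‖ ^ 2) + 4 * ‖x‖ ^ 2 * deriv (deriv g) (‖x‖ ^ 2) := by
  have h1 : ∀ v : EN N, (fun y => fderiv ℝ (kr g) y v) = fun y => kl (fun σ => 2 * deriv g σ) v y := by
    intro v; ext y; rw [fderiv_kr h]; simp [kl]; ring
  have h2 := h.deriv.const_mul 2
  simp only [lap, h1]
  have h3 : ∀ i : Fin N, fderiv ℝ (fun y => kl (fun σ => 2 * deriv g σ)
      (EuclideanSpace.single i (1 : ℝ)) y) x (EuclideanSpace.single i (1 : ℝ))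
      = 2 * deriv g (‖x‖ ^ 2) + 4 * deriv (deriv g) (‖x‖ ^ 2) *
        (⟪x, EuclideanSpace.single i (1 : ℝ)⟫ * ⟪EuclideanSpace.single i (1 : ℝ), x⟫) := by
    intro i
    rw [show (fun y => kl (fun σ => 2 * deriv g σ) (EuclideanSpace.single i (1 : ℝ)) y)
      = kl (fun σ => 2 * deriv g σ) (EuclideanSpace.single i (1 : ℝ)) from rfl, fderiv_kl h2]
    simp only [kq, deriv_const_mul_field, inner_single_self, real_inner_comm x]
    ring
  simp only [h3, Finset.sum_add_distrib, ← Finset.mul_sum, sum_inner_mul,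
    real_inner_self_eq_norm_sq]
  simp; ring

theorem lap_kl (h : Prof m g) (e x : EN N) :
    lap N (kl g e) x =
      ⟪x, e⟫ * ((2 * N + 4) * deriv g (‖x‖ ^ 2) + 4 * ‖x‖ ^ 2 * deriv (deriv g) (‖x‖ ^ 2)) := by
  have h1 : ∀ v : EN N, (fun y => fderiv ℝ (kl g e) y v) = fun y => -kq g e v y := by
    intro v; ext y; rw [fderiv_kl h]
  simp only [lap, h1]
  have h3 : ∀ i : Fin N, fderiv ℝ (fun y => -kq g e (EuclideanSpace.single i (1 : ℝ)) y) x
      (EuclideanSpace.single i (1 : ℝ))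
      = 2 * ⟪x, e⟫ * deriv g (‖x‖ ^ 2) + 4 * deriv g (‖x‖ ^ 2) *
        (⟪x, EuclideanSpace.single i (1 : ℝ)⟫ * ⟪EuclideanSpace.single i (1 : ℝ), e⟫) +
        4 * ⟪x, e⟫ * deriv (deriv g) (‖x‖ ^ 2) *
        (⟪x, EuclideanSpace.single i (1 : ℝ)⟫ * ⟪EuclideanSpace.single i (1 : ℝ), x⟫) := by
    intro i
    rw [fderiv_fun_neg]
    rw [neg_apply, fderiv_kq h, kc, inner_single_self,
      real_inner_comm x (EuclideanSpace.single i (1 : ℝ)),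
      real_inner_comm (EuclideanSpace.single i (1 : ℝ)) e]
    ring
  simp only [h3, Finset.sum_add_distrib, ← Finset.mul_sum, sum_inner_mul,
    real_inner_self_eq_norm_sq]
  simp; ring

theorem lap_kq (h : Prof m g) (e f x : EN N) :
    lap N (kq g e f) x =
      -(⟪e, f⟫ * ((2 * N + 4) * deriv g (‖x‖ ^ 2) + 4 * ‖x‖ ^ 2 * deriv (deriv g) (‖x‖ ^ 2)) +
        ⟪x, e⟫ * ⟪x, f⟫ * ((4 * N + 16) * deriv (deriv g) (‖x‖ ^ 2) +
          8 * ‖x‖ ^ 2 * deriv (deriv (deriv g)) (‖x‖ ^ 2))) := by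
  have h1 : ∀ v : EN N, (fun y => fderiv ℝ (kq g e f) y v) = kc g e f v := by
    intro v; ext y; rw [fderiv_kq h]
  simp only [lap, h1]
  have h3 : ∀ i : Fin N, fderiv ℝ (kc g e f (EuclideanSpace.single i (1 : ℝ))) x
      (EuclideanSpace.single i (1 : ℝ))
      = -(⟪e, f⟫ * 2 * deriv g (‖x‖ ^ 2) + 4 * ⟪x, e⟫ * ⟪x, f⟫ * deriv (deriv g) (‖x‖ ^ 2) +
        4 * deriv g (‖x‖ ^ 2) *
        (⟪e, EuclideanSpace.single i (1 : ℝ)⟫ * ⟪EuclideanSpace.single i (1 : ℝ), f⟫) +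
        (8 * ⟪x, f⟫ * deriv (deriv g) (‖x‖ ^ 2)) *
        (⟪x, EuclideanSpace.single i (1 : ℝ)⟫ * ⟪EuclideanSpace.single i (1 : ℝ), e⟫) +
        (8 * ⟪x, e⟫ * deriv (deriv g) (‖x‖ ^ 2)) *
        (⟪x, EuclideanSpace.single i (1 : ℝ)⟫ * ⟪EuclideanSpace.single i (1 : ℝ), f⟫) +
        (4 * ⟪e, f⟫ * deriv (deriv g) (‖x‖ ^ 2) +
          8 * ⟪x, e⟫ * ⟪x, f⟫ * deriv (deriv (deriv g)) (‖x‖ ^ 2)) *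
        (⟪x, EuclideanSpace.single i (1 : ℝ)⟫ * ⟪EuclideanSpace.single i (1 : ℝ), x⟫)) := by
    intro i
    rw [fderiv_kc h, real_inner_comm x (EuclideanSpace.single i (1 : ℝ)),
      real_inner_comm (EuclideanSpace.single i (1 : ℝ)) e, inner_single_self]
    ring
  simp only [h3, Finset.sum_add_distrib, Finset.sum_neg_distrib, ← Finset.mul_sum, sum_inner_mul,
    real_inner_self_eq_norm_sq]
  simp; ring

theorem deriv_hat : deriv (hat g) = fun σ => -2 * deriv (deriv g) σ := by
  ext σ; exact deriv_const_mul_field _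

theorem euler_kl (h : Prof m g) (e x : EN N) :
    lap N (kl g e) x = -((N : ℝ) + (1 : ℕ)) * kl (hat g) e x - fderiv ℝ (kl (hat g) e) x x := by
  rw [lap_kl h, fderiv_kl h.hat, kq, deriv_hat]
  simp only [kl, hat, real_inner_self_eq_norm_sq, real_inner_comm x]
  push_cast; ring

theorem euler_kq (h : Prof m g) (e f x : EN N) :
    lap N (kq g e f) x =
      -((N : ℝ) + (2 : ℕ)) * kq (hat g) e f x - fderiv ℝ (kq (hat g) e f) x x := by
  rw [lap_kq h, fderiv_kq h.hat, kq, kc, deriv_hat]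
  simp only [hat, real_inner_self_eq_norm_sq, real_inner_comm x]
  rw [deriv_const_mul_field]
  push_cast; ring

theorem sum_kq_hat (h : Prof m g) (x : EN N) :
    ∑ i : Fin N, kq (hat g) (EuclideanSpace.single i (1 : ℝ)) (EuclideanSpace.single i (1 : ℝ)) x
      = lap N (kr g) x := by
  rw [lap_kr h]
  simp only [kq, deriv_hat, hat, inner_single_self]
  have h3 : ∀ i : Fin N, -((1 * (-2 * deriv g (‖x‖ ^ 2))) + 2 * (⟪x, EuclideanSpace.single i (1 : ℝ)⟫
      * ⟪x, EuclideanSpace.single i (1 : ℝ)⟫ * (-2 * deriv (deriv g) (‖x‖ ^ 2)))) =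
      2 * deriv g (‖x‖ ^ 2) + 4 * deriv (deriv g) (‖x‖ ^ 2) *
        (⟪x, EuclideanSpace.single i (1 : ℝ)⟫ * ⟪EuclideanSpace.single i (1 : ℝ), x⟫) := by
    intro i
    rw [real_inner_comm x]; ring
  simp only [h3, Finset.sum_add_distrib, ← Finset.mul_sum, sum_inner_mul,
    real_inner_self_eq_norm_sq]
  simp; ring

end derivs
end GlobalSol

namespace GlobalSol
variable {N : ℕ}

/-- The polynomial weight. -/
def wt (x : EN N) : ℝ := ((1 + ‖x‖ ^ 2) ^ (N + 6))⁻¹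

theorem one_add_pos (x : EN N) : 0 < 1 + ‖x‖ ^ 2 := by positivity

theorem wt_pos (x : EN N) : 0 < wt x := by unfold wt; positivity

theorem continuous_wt : Continuous (wt : EN N → ℝ) := by
  unfold wt
  exact Continuous.inv₀ (by fun_prop) (fun x => (pow_pos (one_add_pos x) _).ne')

theorem integrable_pow_wt : Integrable (fun x : EN N => (1 + ‖x‖ ^ 2) ^ 4 * wt x) := by
  have h := integrable_rpow_neg_one_add_norm_sq (E := EN N) (μ := volume) (r := 2 * (N + 2))
    (by simp; linarith [(Nat.cast_nonneg N : (0 : ℝ) ≤ N)])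
  refine h.congr (Eventually.of_forall fun x => ?_)
  have hp := one_add_pos x
  simp only [wt]
  rw [show -(2 * ((N : ℝ) + 2)) / 2 = -((N + 2 : ℕ) : ℝ) by push_cast; ring,
    Real.rpow_neg hp.le, Real.rpow_natCast, show N + 6 = 4 + (N + 2) by ring, pow_add]
  field_simp
  ring

theorem integrable_of_le_wt {f : EN N → ℝ} (hf : AEStronglyMeasurable f volume) {C : ℝ} {j : ℕ}
    (hj : j ≤ 4) (h : ∀ x, |f x| ≤ C * ((1 + ‖x‖ ^ 2) ^ j * wt x)) : Integrable f := by
  refine (integrable_pow_wt.const_mul |C|).mono' hf (Eventually.of_forall fun x => ?_)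
  rw [Real.norm_eq_abs]
  refine (h x).trans ?_
  have h1 : (1 : ℝ) ≤ 1 + ‖x‖ ^ 2 := by nlinarith [sq_nonneg ‖x‖]
  have h2 := pow_le_pow_right₀ h1 hj
  have h3 := wt_pos x
  have : (1 + ‖x‖ ^ 2) ^ j * wt x ≤ (1 + ‖x‖ ^ 2) ^ 4 * wt x := by gcongr
  exact mul_le_mul (le_abs_self C) this (by positivity) (abs_nonneg _)

theorem integrable_wt : Integrable (wt : EN N → ℝ) :=
  integrable_of_le_wt (C := 1) (j := 0) continuous_wt.aestronglyMeasurable (by norm_num)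
    (fun x => by simp [abs_of_pos (wt_pos x)])

theorem one_add_le_shift {z v : EN N} (hv : ‖v‖ ≤ 2) :
    1 + ‖z‖ ^ 2 ≤ 9 * (1 + ‖z + v‖ ^ 2) := by
  have h : ‖z‖ ≤ ‖z + v‖ + ‖v‖ := by simpa using norm_sub_le (z + v) v
  nlinarith [norm_nonneg z, norm_nonneg v, norm_nonneg (z + v), sq_nonneg (‖z + v‖ - ‖v‖)]

theorem wt_shift {z v : EN N} (hv : ‖v‖ ≤ 2) : wt (z + v) ≤ 9 ^ (N + 6) * wt z := by
  have h := pow_le_pow_left₀ (one_add_pos z).le (one_add_le_shift hv) (N + 6)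
  rw [mul_pow] at h
  unfold wt
  have h1 := pow_pos (one_add_pos z) (N + 6)
  have h2 := pow_pos (one_add_pos (z + v)) (N + 6)
  rw [← div_eq_mul_inv, inv_eq_one_div, div_le_div_iff₀ h2 h1]
  linarith

/-- Smooth kernels with decay. -/
structure Ker (k : EN N → ℝ) (C : ℝ) : Prop where
  smooth : ContDiff ℝ (⊤ : ℕ∞) k
  nonneg : 0 ≤ C
  bound : ∀ x, |k x| ≤ C * wt x
  dbound : ∀ x v, |fderiv ℝ k x v| ≤ C * wt x * ‖v‖
  lbound : ∀ x, |lap N k x| ≤ C * wt x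

theorem Ker.continuous {k : EN N → ℝ} {C : ℝ} (h : Ker k C) : Continuous k := h.smooth.continuous

theorem Ker.differentiable {k : EN N → ℝ} {C : ℝ} (h : Ker k C) : Differentiable ℝ k :=
  h.smooth.differentiable (by simp)

theorem Ker.integrable {k : EN N → ℝ} {C : ℝ} (h : Ker k C) : Integrable k :=
  integrable_of_le_wt (C := C) (j := 0) h.continuous.aestronglyMeasurable (by norm_num)
    (fun x => by simpa using h.bound x)

theorem Ker.continuous_fderiv_apply {k : EN N → ℝ} {C : ℝ} (h : Ker k C) (v : EN N) :
    Continuous (fun x => fderiv ℝ k x v) :=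
  (h.smooth.continuous_fderiv (by simp)).clm_apply continuous_const

theorem contDiff_fderiv_apply {k : EN N → ℝ} (h : ContDiff ℝ (⊤ : ℕ∞) k) (v : EN N) :
    ContDiff ℝ (⊤ : ℕ∞) (fun x => fderiv ℝ k x v) :=
  (h.fderiv_right (m := (⊤ : ℕ∞)) (by simp)).clm_apply contDiff_const

theorem continuous_lap {k : EN N → ℝ} (h : ContDiff ℝ (⊤ : ℕ∞) k) : Continuous (lap N k) := by
  unfold lap
  refine continuous_finsetSum _ fun i _ => ?_
  exact (contDiff_fderiv_apply (contDiff_fderiv_apply h _) _).continuous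

section scaling

theorem fderiv_comp_scale {k : EN N → ℝ} (h : Differentiable ℝ k) (c : ℝ) (y x v : EN N) :
    fderiv ℝ (fun w => k (c • (w - y))) x v = c * fderiv ℝ k (c • (x - y)) v := by
  have h1 : HasFDerivAt (fun w : EN N => c • (w - y)) (c • ContinuousLinearMap.id ℝ (EN N)) x :=
    ((hasFDerivAt_id x).sub_const y).const_smul c
  have h2 := (h (c • (x - y))).hasFDerivAt.comp x h1
  have h3 : fderiv ℝ (fun w => k (c • (w - y))) x = _ := h2.fderiv
  rw [h3]; simp

theorem lap_comp_scale {k : EN N → ℝ} (h : ContDiff ℝ (⊤ : ℕ∞) k) (c : ℝ) (y x : EN N) :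
    lap N (fun w => k (c • (w - y))) x = c ^ 2 * lap N k (c • (x - y)) := by
  unfold lap
  rw [Finset.mul_sum]
  refine Finset.sum_congr rfl fun i _ => ?_
  have hd : Differentiable ℝ (fun x => fderiv ℝ k x (EuclideanSpace.single i 1)) :=
    (contDiff_fderiv_apply h _).differentiable (by simp)
  have h1 : (fun w' => fderiv ℝ (fun w => k (c • (w - y))) w' (EuclideanSpace.single i (1 : ℝ)))
      = fun w' => c * (fun w => (fun x => fderiv ℝ k x (EuclideanSpace.single i 1)) (c • (w - y))) w' := by
    ext w'
    rw [fderiv_comp_scale (h.differentiable (by simp))]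
  rw [h1, fderiv_const_mul]
  · rw [smul_apply, fderiv_comp_scale hd, smul_eq_mul]; ring
  · exact hd.differentiableAt.comp x (by fun_prop)

theorem lap_mul {f g : EN N → ℝ} (hf : ContDiff ℝ (⊤ : ℕ∞) f) (hg : ContDiff ℝ (⊤ : ℕ∞) g)
    (x : EN N) : lap N (fun y => f y * g y) x = f x * lap N g x + g x * lap N f x +
      2 * ∑ i : Fin N, fderiv ℝ f x (EuclideanSpace.single i 1) *
        fderiv ℝ g x (EuclideanSpace.single i 1) := by
  unfold lap
  rw [Finset.mul_sum, Finset.mul_sum, Finset.mul_sum, ← Finset.sum_add_distrib,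
    ← Finset.sum_add_distrib]
  refine Finset.sum_congr rfl fun i _ => ?_
  have df := hf.differentiable (by simp)
  have dg := hg.differentiable (by simp)
  have df' : Differentiable ℝ (fun x => fderiv ℝ f x (EuclideanSpace.single i (1 : ℝ))) :=
    (contDiff_fderiv_apply hf _).differentiable (by simp)
  have dg' : Differentiable ℝ (fun x => fderiv ℝ g x (EuclideanSpace.single i (1 : ℝ))) :=
    (contDiff_fderiv_apply hg _).differentiable (by simp)
  have h1 : (fun y => fderiv ℝ (fun y => f y * g y) y (EuclideanSpace.single i (1 : ℝ)))
      = fun y => f y * fderiv ℝ g y (EuclideanSpace.single i (1 : ℝ)) +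
        g y * fderiv ℝ f y (EuclideanSpace.single i (1 : ℝ)) := by
    ext y; rw [fderiv_fun_mul (df y) (dg y)]; simp
  rw [h1, fderiv_fun_add (DifferentiableAt.fun_mul (df x) (dg' x)) (DifferentiableAt.fun_mul (dg x) (df' x)), fderiv_fun_mul (df x) (dg' x),
    fderiv_fun_mul (dg x) (df' x)]
  simp; ring

end scaling

/-- Global solutions with coincidence set `Λ`. -/
structure GSol (M : ℝ) (Λ : Set (EN N)) (u : EN N → ℝ) : Prop where
  closed : IsClosed Λ
  smooth : ContDiff ℝ 1 u
  weak : ∀ φ : EN N → ℝ, ContDiff ℝ (⊤ : ℕ∞) φ → HasCompactSupport φ →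
      ∫ x, u x * lap N φ x = ∫ x in Λᶜ, φ x
  zero : ∀ x ∈ Λ, u x = 0 ∧ fderiv ℝ u x = 0
  growth : ∀ x, |u x| ≤ M * (1 + ‖x‖ ^ 2)

theorem GSol.continuous {M : ℝ} {Λ : Set (EN N)} {u : EN N → ℝ} (h : GSol M Λ u) :
    Continuous u := h.smooth.continuous

theorem GSol.M_nonneg {M : ℝ} {Λ : Set (EN N)} {u : EN N → ℝ} (h : GSol M Λ u) : 0 ≤ M := by
  have := (abs_nonneg _).trans (h.growth 0)
  simpa using this

theorem exists_cutoff : ∃ χ : EN N → ℝ, ContDiff ℝ (⊤ : ℕ∞) χ ∧ HasCompactSupport χ ∧ χ 0 = 1 ∧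
    ∃ C, 0 ≤ C ∧ (∀ x, |χ x| ≤ C) ∧ (∀ x v, |fderiv ℝ χ x v| ≤ C * ‖v‖) ∧ ∀ x, |lap N χ x| ≤ C := by
  let b : ContDiffBump (0 : EN N) := ⟨1, 2, one_pos, one_lt_two⟩
  have hs : ContDiff ℝ (⊤ : ℕ∞) b := b.contDiff
  have hc : HasCompactSupport b := b.hasCompactSupport
  obtain ⟨C1, h1⟩ := hc.exists_bound_of_continuous hs.continuous
  obtain ⟨C2, h2⟩ := (hc.fderiv ℝ).exists_bound_of_continuous (hs.continuous_fderiv (by simp))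
  have hl : HasCompactSupport (lap N b) := by
    refine HasCompactSupport.intro hc (fun x hx => ?_)
    unfold lap
    refine Finset.sum_eq_zero fun i _ => ?_
    have h3 : (fun y => fderiv ℝ b y (EuclideanSpace.single i (1 : ℝ))) =ᶠ[nhds x] fun _ => 0 := by
      have : (tsupport b)ᶜ ∈ nhds x := (isClosed_tsupport _).isOpen_compl.mem_nhds hx
      filter_upwards [this] with y hy
      have hy0 : (b : EN N → ℝ) =ᶠ[nhds y] fun _ => 0 := notMem_tsupport_iff_eventuallyEq.mp hy
      rw [hy0.fderiv_eq]; simp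
    rw [h3.fderiv_eq]; simp
  obtain ⟨C3, h3⟩ := hl.exists_bound_of_continuous (continuous_lap hs)
  have p1 := (norm_nonneg _).trans (h1 0)
  have p2 := (norm_nonneg _).trans (h2 0)
  have p3 := (norm_nonneg _).trans (h3 0)
  refine ⟨b, hs, hc, b.one_of_mem_closedBall (by simp [b]), C1 + C2 + C3,
    by positivity, fun x => ?_, fun x v => ?_, fun x => ?_⟩
  · have := h1 x; rw [Real.norm_eq_abs] at this; linarith
  · have := (fderiv ℝ b x).le_opNorm v
    rw [Real.norm_eq_abs] at this
    refine this.trans ?_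
    gcongr
    linarith [h2 x]
  · have := h3 x; rw [Real.norm_eq_abs] at this; linarith

theorem GSol.weak_ext {M : ℝ} {Λ : Set (EN N)} {u : EN N → ℝ} (h : GSol M Λ u)
    {η : EN N → ℝ} (hs : ContDiff ℝ (⊤ : ℕ∞) η) (hi : Integrable η)
    {C : ℝ} (hb : ∀ x, |η x| ≤ C * wt x)
    (hd : ∀ x v, |fderiv ℝ η x v| ≤ C * wt x * ‖v‖) (hl : ∀ x, |lap N η x| ≤ C * wt x) :
    ∫ x, u x * lap N η x = ∫ x in Λᶜ, η x := by
  obtain ⟨χ, χs, χc, χ0, D, hD, hχ, hχ', hχl⟩ := exists_cutoff (N := N)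
  let c : ℕ → ℝ := fun n => 1 / ((n : ℝ) + 1)
  have hc : Tendsto c atTop (nhds 0) := tendsto_one_div_add_atTop_nhds_zero_nat
  have hcpos : ∀ n, 0 < c n := fun n => by positivity
  have hc1 : ∀ n, c n ≤ 1 := fun n => by
    simp only [c]; rw [div_le_one (by positivity)]; linarith [(Nat.cast_nonneg n : (0 : ℝ) ≤ n)]
  let X : ℕ → EN N → ℝ := fun n x => χ (c n • (x - 0))
  have hX : ∀ n, ContDiff ℝ (⊤ : ℕ∞) (X n) := fun n => χs.comp (by fun_prop)
  have hXc : ∀ n, HasCompactSupport (X n) := fun n => by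
    have := χc.comp_homeomorph (Homeomorph.smulOfNeZero (c n) (hcpos n).ne' : EN N ≃ₜ EN N)
    convert this using 1
    ext x; simp [X]
  have hw : ∀ n, ∫ x, u x * lap N (fun y => X n y * η y) x = ∫ x in Λᶜ, X n x * η x :=
    fun n => h.weak _ ((hX n).mul hs) ((hXc n).mul_right)
  have hXt : ∀ x, Tendsto (fun n => X n x) atTop (nhds 1) := fun x => by
    have : Tendsto (fun n => χ (c n • (x - 0))) atTop (nhds (χ ((0 : ℝ) • (x - 0)))) :=
      (χs.continuous.tendsto _).comp (hc.smul_const _)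
    simp only [zero_smul, χ0] at this; exact this
  have R : Tendsto (fun n => ∫ x in Λᶜ, X n x * η x) atTop (nhds (∫ x in Λᶜ, η x)) := by
    refine tendsto_integral_of_dominated_convergence (fun x => D * |η x|) (fun n => ?_) ?_
      (fun n => ?_) ?_
    · exact ((hX n).continuous.mul hs.continuous).aestronglyMeasurable
    · exact (hi.abs.const_mul D).integrableOn
    · refine Eventually.of_forall fun x => ?_
      rw [norm_mul, Real.norm_eq_abs, Real.norm_eq_abs]
      exact mul_le_mul_of_nonneg_right (hχ _) (abs_nonneg _)
    · exact Eventually.of_forall fun x => by simpa using (hXt x).mul_const (η x)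
  have hform : ∀ n x, lap N (fun y => X n y * η y) x = χ (c n • (x - 0)) * lap N η x +
      η x * (c n ^ 2 * lap N χ (c n • (x - 0))) +
      2 * ∑ i : Fin N, (c n * fderiv ℝ χ (c n • (x - 0)) (EuclideanSpace.single i 1)) *
        fderiv ℝ η x (EuclideanSpace.single i 1) := fun n x => by
    rw [lap_mul (hX n) hs, lap_comp_scale χs]
    simp only [X, fderiv_comp_scale (χs.differentiable (by simp))]
  have hcw : ∀ x, 0 ≤ C * wt x := fun x => (abs_nonneg _).trans (hb x)
  have L : Tendsto (fun n => ∫ x, u x * lap N (fun y => X n y * η y) x) atTop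
      (nhds (∫ x, u x * lap N η x)) := by
    refine tendsto_integral_of_dominated_convergence
      (fun x => (M * (2 + 2 * N) * D * C) * ((1 + ‖x‖ ^ 2) ^ 1 * wt x)) (fun n => ?_) ?_
      (fun n => ?_) ?_
    · exact (h.continuous.mul (continuous_lap ((hX n).mul hs))).aestronglyMeasurable
    · refine Integrable.const_mul ?_ _
      refine integrable_of_le_wt (C := 1) (j := 1) ?_ (by norm_num) (fun x => ?_)
      · exact (Continuous.mul (by fun_prop) continuous_wt).aestronglyMeasurable
      · rw [abs_of_nonneg (mul_nonneg (by positivity) (wt_pos x).le), one_mul]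
    · refine Eventually.of_forall fun x => ?_
      rw [norm_mul, Real.norm_eq_abs, Real.norm_eq_abs]
      have hsum : |∑ i : Fin N, (c n * fderiv ℝ χ (c n • (x - 0)) (EuclideanSpace.single i 1)) *
        fderiv ℝ η x (EuclideanSpace.single i 1)| ≤ N * (D * (C * wt x)) := by
        refine (Finset.abs_sum_le_sum_abs _ _).trans ?_
        have : ∀ i ∈ (Finset.univ : Finset (Fin N)),
            |(c n * fderiv ℝ χ (c n • (x - 0)) (EuclideanSpace.single i 1)) *
            fderiv ℝ η x (EuclideanSpace.single i 1)| ≤ D * (C * wt x) := by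
          intro i _
          have h1 := hχ' (c n • (x - 0)) (EuclideanSpace.single i 1)
          have h2 := hd x (EuclideanSpace.single i 1)
          simp only [PiLp.norm_single, norm_one, mul_one] at h1 h2
          rw [abs_mul, abs_mul, abs_of_pos (hcpos n)]
          refine mul_le_mul ?_ h2 (abs_nonneg _) hD
          calc _ ≤ 1 * D := mul_le_mul (hc1 n) h1 (abs_nonneg _) zero_le_one
            _ = D := one_mul _
        refine (Finset.sum_le_sum this).trans ?_
        simp
      have hlap : |lap N (fun y => X n y * η y) x| ≤ (2 + 2 * N) * D * (C * wt x) := by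
        rw [hform]
        have a1 : |χ (c n • (x - 0)) * lap N η x| ≤ D * (C * wt x) := by
          rw [abs_mul]; exact mul_le_mul (hχ _) (hl x) (abs_nonneg _) hD
        have a2 : |η x * (c n ^ 2 * lap N χ (c n • (x - 0)))| ≤ (C * wt x) * (1 * D) := by
          rw [abs_mul, abs_mul, abs_of_nonneg (sq_nonneg (c n))]
          refine mul_le_mul (hb x) (mul_le_mul ?_ (hχl _) (abs_nonneg _) zero_le_one)
            (by positivity) (hcw x)
          exact pow_le_one₀ (hcpos n).le (hc1 n)
        refine (abs_add_three _ _ _).trans ?_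
        rw [abs_mul (2 : ℝ), abs_of_pos (zero_lt_two' ℝ)]
        nlinarith [a1, a2, hsum]
      calc |u x| * |lap N (fun y => X n y * η y) x|
          ≤ (M * (1 + ‖x‖ ^ 2)) * ((2 + 2 * N) * D * (C * wt x)) :=
            mul_le_mul (h.growth x) hlap (abs_nonneg _)
              (mul_nonneg h.M_nonneg (one_add_pos x).le)
        _ = _ := by ring
    · refine Eventually.of_forall fun x => ?_
      refine Tendsto.const_mul _ ?_
      simp only [hform]
      have t0 : Tendsto (fun n => c n • (x - 0)) atTop (nhds 0) := by
        simpa using hc.smul_const (x - 0)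
      have t1 := ((hXt x).mul_const (lap N η x))
      have t2 := ((hc.pow 2).mul ((continuous_lap χs).tendsto 0 |>.comp t0)).const_mul (η x)
      have t3 : Tendsto (fun n => ∑ i : Fin N,
          (c n * fderiv ℝ χ (c n • (x - 0)) (EuclideanSpace.single i 1)) *
          fderiv ℝ η x (EuclideanSpace.single i 1)) atTop (nhds (∑ i : Fin N,
          (0 * fderiv ℝ χ 0 (EuclideanSpace.single i 1)) *
          fderiv ℝ η x (EuclideanSpace.single i 1))) := by
        refine tendsto_finsetSum _ fun i _ => ?_
        exact (hc.mul (((contDiff_fderiv_apply χs _).continuous.tendsto 0).comp t0)).mul_const _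
      have := (t1.add t2).add (t3.const_mul 2)
      simpa [X] using this
  exact tendsto_nhds_unique (L.congr hw) R

end GlobalSol

namespace GlobalSol
variable {N : ℕ}

theorem wt_scale {y w : EN N} {s Y S : ℝ} (hy : ‖y‖ ≤ Y) (hs : 0 < s) (hS : s ≤ S) :
    wt (s⁻¹ • (w - y)) ≤ (1 + 2 * Y ^ 2 + 2 * S ^ 2) ^ (N + 6) * wt w := by
  have h0 : ‖w‖ ≤ ‖w - y‖ + ‖y‖ := by simpa using norm_add_le (w - y) y
  have h1 : 1 + ‖w‖ ^ 2 ≤ (1 + 2 * Y ^ 2 + 2 * S ^ 2) * (1 + ‖s⁻¹ • (w - y)‖ ^ 2) := by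
    rw [norm_smul, Real.norm_eq_abs, abs_of_pos (inv_pos.mpr hs)]
    have h2 : ‖w - y‖ = s * (s⁻¹ * ‖w - y‖) := by field_simp
    set t := s⁻¹ * ‖w - y‖
    have ht : 0 ≤ t := by positivity
    have h3 : ‖w‖ ^ 2 ≤ 2 * (s * t) ^ 2 + 2 * ‖y‖ ^ 2 := by
      rw [h2] at h0
      nlinarith [norm_nonneg w, norm_nonneg y, sq_nonneg (s * t - ‖y‖), mul_nonneg hs.le ht]
    have h4 : ‖y‖ ^ 2 ≤ Y ^ 2 := by gcongr
    have h5 : s ^ 2 ≤ S ^ 2 := by gcongr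
    nlinarith [mul_le_mul_of_nonneg_right h5 (sq_nonneg t), sq_nonneg t, sq_nonneg Y, sq_nonneg S,
      mul_nonneg (sq_nonneg Y) (sq_nonneg t)]
  have h := pow_le_pow_left₀ (one_add_pos w).le h1 (N + 6)
  rw [mul_pow] at h
  unfold wt
  have h1 := pow_pos (one_add_pos w) (N + 6)
  have h2 := pow_pos (one_add_pos (s⁻¹ • (w - y))) (N + 6)
  rw [← div_eq_mul_inv, inv_eq_one_div, div_le_div_iff₀ h2 h1]
  linarith

theorem integral_comp_affine (f : EN N → ℝ) (y : EN N) {r : ℝ} (hr : 0 < r) :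
    ∫ z, f (y + r • z) = (r ^ N)⁻¹ * ∫ w, f w := by
  have := Measure.integral_comp_smul (volume : Measure (EN N)) (fun w => f (y + w)) r
  rw [this, integral_add_left_eq_self f y]
  simp [abs_of_pos hr]

theorem integrable_comp_affine {f : EN N → ℝ} (hf : Integrable f) (y : EN N) {r : ℝ} (hr : 0 < r) :
    Integrable (fun z => f (y + r • z)) :=
  ((hf.comp_add_left y).comp_smul hr.ne' :)

/-- The kernel average `∫ u (y + r z) k z dz`. -/
def I (u k : EN N → ℝ) (y : EN N) (r : ℝ) : ℝ := ∫ z, u (y + r • z) * k z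

theorem affine_inv (y z : EN N) {r : ℝ} (hr : 0 < r) : r⁻¹ • (y + r • z - y) = z := by
  simp [smul_smul, hr.ne']

theorem I_eq (u k : EN N → ℝ) (y : EN N) {r : ℝ} (hr : 0 < r) :
    I u k y r = (r ^ N)⁻¹ * ∫ w, u w * k (r⁻¹ • (w - y)) := by
  rw [← integral_comp_affine (fun w => u w * k (r⁻¹ • (w - y))) y hr]
  simp only [I, affine_inv y _ hr]

/-- Quadratic growth. -/
def QG (M : ℝ) (u : EN N → ℝ) : Prop := ∀ x, |u x| ≤ M * (1 + ‖x‖ ^ 2)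

theorem QG.nonneg {M : ℝ} {u : EN N → ℝ} (h : QG M u) : 0 ≤ M := by
  have := (abs_nonneg _).trans (h 0)
  simpa using this

theorem integrable_w {M C : ℝ} {u k : EN N → ℝ} (hu : QG M u) (um : AEStronglyMeasurable u)
    (hk : Continuous k) (hb : ∀ x, |k x| ≤ C * wt x) (y : EN N) {r : ℝ} (hr : 0 < r) :
    Integrable (fun w => u w * k (r⁻¹ • (w - y))) := by
  refine integrable_of_le_wt (C := M * (C * (1 + 2 * ‖y‖ ^ 2 + 2 * r ^ 2) ^ (N + 6)))
    (j := 1) ?_ (by norm_num) (fun w => ?_)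
  · exact um.mul (Continuous.aestronglyMeasurable (by fun_prop))
  · have hC : 0 ≤ C := by
      have := (abs_nonneg _).trans (hb 0)
      exact nonneg_of_mul_nonneg_left this (wt_pos 0)
    rw [abs_mul]
    have h1 := hb (r⁻¹ • (w - y))
    have h2 := wt_scale (y := y) (w := w) le_rfl hr le_rfl
    calc |u w| * |k (r⁻¹ • (w - y))| ≤ (M * (1 + ‖w‖ ^ 2)) *
        (C * ((1 + 2 * ‖y‖ ^ 2 + 2 * r ^ 2) ^ (N + 6) * wt w)) := by
          refine mul_le_mul (hu w) (h1.trans ?_) (abs_nonneg _)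
            (mul_nonneg hu.nonneg (one_add_pos w).le)
          gcongr
      _ = _ := by ring

theorem integrable_z {M C : ℝ} {u k : EN N → ℝ} (hu : QG M u) (um : AEStronglyMeasurable u)
    (hk : Continuous k) (hb : ∀ x, |k x| ≤ C * wt x) (y : EN N) {r : ℝ} (hr : 0 < r) :
    Integrable (fun z => u (y + r • z) * k z) := by
  have := integrable_comp_affine (integrable_w hu um hk hb y hr) y hr
  simpa only [affine_inv y _ hr] using this

/-- Indicator of the complement. -/
def om (Λ : Set (EN N)) : EN N → ℝ := Λᶜ.indicator (fun _ => 1)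
/-- Indicator. -/
def la (Λ : Set (EN N)) : EN N → ℝ := Λ.indicator (fun _ => 1)

theorem om_add_la (Λ : Set (EN N)) (x : EN N) : om Λ x + la Λ x = 1 := by
  by_cases h : x ∈ Λ <;> simp [om, la, h]

theorem om_nonneg (Λ : Set (EN N)) (x : EN N) : 0 ≤ om Λ x := by
  by_cases h : x ∈ Λ <;> simp [om, h]

theorem la_nonneg (Λ : Set (EN N)) (x : EN N) : 0 ≤ la Λ x := by
  by_cases h : x ∈ Λ <;> simp [la, h]

theorem om_le_one (Λ : Set (EN N)) (x : EN N) : om Λ x ≤ 1 := by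
  linarith [om_add_la Λ x, la_nonneg Λ x]

theorem la_le_one (Λ : Set (EN N)) (x : EN N) : la Λ x ≤ 1 := by
  linarith [om_add_la Λ x, om_nonneg Λ x]

theorem la_of_mem {Λ : Set (EN N)} {x : EN N} (h : x ∈ Λ) : la Λ x = 1 := by simp [la, h]
theorem la_of_notMem {Λ : Set (EN N)} {x : EN N} (h : x ∉ Λ) : la Λ x = 0 := by simp [la, h]

theorem QG_of_le_one {v : EN N → ℝ} (h0 : ∀ x, 0 ≤ v x) (h1 : ∀ x, v x ≤ 1) : QG 1 v := fun x => by
  rw [abs_of_nonneg (h0 x)]; nlinarith [h1 x, sq_nonneg ‖x‖]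

theorem QG_om (Λ : Set (EN N)) : QG 1 (om Λ) := QG_of_le_one (om_nonneg Λ) (om_le_one Λ)
theorem QG_la (Λ : Set (EN N)) : QG 1 (la Λ) := QG_of_le_one (la_nonneg Λ) (la_le_one Λ)

theorem aesm_om {Λ : Set (EN N)} (h : IsClosed Λ) : AEStronglyMeasurable (om Λ) :=
  (measurable_const.indicator h.measurableSet.compl).aestronglyMeasurable
theorem aesm_la {Λ : Set (EN N)} (h : IsClosed Λ) : AEStronglyMeasurable (la Λ) :=
  (measurable_const.indicator h.measurableSet).aestronglyMeasurable

variable {M : ℝ} {Λ : Set (EN N)} {u : EN N → ℝ}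

theorem GSol.qg (h : GSol M Λ u) : QG M u := h.growth

theorem GSol.aesm (h : GSol M Λ u) : AEStronglyMeasurable u := h.continuous.aestronglyMeasurable

theorem GSol.weak_scaled (h : GSol M Λ u) {κ : EN N → ℝ} {C : ℝ} (hκ : Ker κ C) (y : EN N)
    {r : ℝ} (hr : 0 < r) : I u (lap N κ) y r = r ^ 2 * I (om Λ) κ y r := by
  have hr' := inv_pos.mpr hr
  set D := (1 + 2 * ‖y‖ ^ 2 + 2 * r ^ 2) ^ (N + 6) with hD
  have hD0 : 0 ≤ D := by positivity
  have hw : ∀ w : EN N, wt (r⁻¹ • (w - y)) ≤ D * wt w := fun w => wt_scale le_rfl hr le_rfl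
  have hC := hκ.nonneg
  set C' := C * D + r⁻¹ * (C * D) + r⁻¹ ^ 2 * (C * D)
  have e1 : ∀ w : EN N, C * wt (r⁻¹ • (w - y)) ≤ (C * D) * wt w := fun w => by
    rw [mul_assoc]; exact mul_le_mul_of_nonneg_left (hw w) hC
  have key := h.weak_ext (η := fun w => κ (r⁻¹ • (w - y))) (C := C')
    (hκ.smooth.comp (by fun_prop)) ?_ (fun w => ?_) (fun w v => ?_) (fun w => ?_)
  · have h1 : ∫ w, u w * lap N κ (r⁻¹ • (w - y)) = r ^ 2 * ∫ w, om Λ w * κ (r⁻¹ • (w - y)) := by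
      have h2 : ∫ w, om Λ w * κ (r⁻¹ • (w - y)) = ∫ w in Λᶜ, κ (r⁻¹ • (w - y)) := by
        rw [← integral_indicator h.closed.measurableSet.compl]
        congr 1; ext w
        by_cases hw : w ∈ Λ <;> simp [om, hw]
      rw [h2, ← key, ← integral_const_mul]
      congr 1; ext w
      rw [lap_comp_scale hκ.smooth]
      field_simp
    rw [I_eq _ _ _ hr, I_eq _ _ _ hr, h1]; ring
  · have := integrable_w (u := fun _ => (1 : ℝ)) (M := 1) (fun x => by
      simp) aestronglyMeasurable_const hκ.continuous hκ.bound y hr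
    simpa using this
  · refine (hκ.bound _).trans ((e1 w).trans ?_)
    refine mul_le_mul_of_nonneg_right ?_ (wt_pos w).le
    have : 0 ≤ r⁻¹ * (C * D) + r⁻¹ ^ 2 * (C * D) := by positivity
    linarith
  · rw [fderiv_comp_scale hκ.differentiable, abs_mul, abs_of_pos hr']
    have := hκ.dbound (r⁻¹ • (w - y)) v
    calc _ ≤ r⁻¹ * ((C * D) * wt w * ‖v‖) := by
          refine mul_le_mul_of_nonneg_left (this.trans ?_) hr'.le
          exact mul_le_mul_of_nonneg_right (e1 w) (norm_nonneg v)
      _ = (r⁻¹ * (C * D)) * (wt w * ‖v‖) := by ring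
      _ ≤ C' * (wt w * ‖v‖) := by
          refine mul_le_mul_of_nonneg_right ?_ (mul_nonneg (wt_pos w).le (norm_nonneg v))
          have : 0 ≤ C * D + r⁻¹ ^ 2 * (C * D) := by positivity
          linarith
      _ = _ := by ring
  · rw [lap_comp_scale hκ.smooth, abs_mul, abs_of_nonneg (sq_nonneg _)]
    calc _ ≤ r⁻¹ ^ 2 * ((C * D) * wt w) :=
          mul_le_mul_of_nonneg_left ((hκ.lbound _).trans (e1 w)) (sq_nonneg _)
      _ = (r⁻¹ ^ 2 * (C * D)) * wt w := by ring
      _ ≤ _ := by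
          refine mul_le_mul_of_nonneg_right ?_ (wt_pos w).le
          have : 0 ≤ C * D + r⁻¹ * (C * D) := by positivity
          linarith

theorem GSol.flow (h : GSol M Λ u) {k κ : EN N → ℝ} {C : ℝ} (hk : Ker k C) (hκ : Ker κ C) (j : ℕ)
    (he : ∀ x, lap N κ x = -((N : ℝ) + j) * k x - fderiv ℝ k x x) (y : EN N) {r : ℝ} (hr : 0 < r) :
    HasDerivAt (fun r => (r ^ j)⁻¹ * I u k y r) (r * (r ^ j)⁻¹ * I (om Λ) κ y r) r := by
  have hC := hk.nonneg
  have hG : ∀ w : EN N, ∀ s, 0 < s → HasDerivAt (fun s => u w * ((s ^ (N + j))⁻¹ * k (s⁻¹ • (w - y))))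
      (u w * ((s ^ (N + j + 1))⁻¹ * lap N κ (s⁻¹ • (w - y)))) s := by
    intro w s hs
    have h1 : HasDerivAt (fun s : ℝ => s⁻¹ • (w - y)) ((-(s ^ 2)⁻¹) • (w - y)) s :=
      (hasDerivAt_inv hs.ne').smul_const _
    have h2 := (hk.differentiable (s⁻¹ • (w - y))).hasFDerivAt.comp_hasDerivAt s h1
    have h3 : HasDerivAt (fun s : ℝ => (s ^ (N + j))⁻¹)
        (-(((N + j : ℕ) : ℝ) * s ^ (N + j - 1)) / (s ^ (N + j)) ^ 2) s :=
      (hasDerivAt_pow _ _).inv (pow_pos hs _).ne'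
    have h4 := (h3.mul h2).const_mul (u w)
    refine h4.congr_deriv ?_
    rw [he]
    have h5 : (-(s ^ 2)⁻¹) • (w - y) = (-s⁻¹) • (s⁻¹ • (w - y)) := by
      rw [smul_smul]; congr 1; rw [pow_two, mul_inv]; ring
    rw [h5, map_smul, smul_eq_mul]
    simp only [Function.comp]
    set K := k (s⁻¹ • (w - y))
    set K' := fderiv ℝ k (s⁻¹ • (w - y)) (s⁻¹ • (w - y))
    have h6 : ((N + j : ℕ) : ℝ) * s ^ (N + j - 1) / (s ^ (N + j)) ^ 2 =
        ((N + j : ℕ) : ℝ) * (s ^ (N + j + 1))⁻¹ := by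
      rcases Nat.eq_zero_or_pos (N + j) with h0 | h0
      · simp [h0]
      · obtain ⟨n, hn⟩ : ∃ n, N + j = n + 1 := ⟨N + j - 1, by omega⟩
        rw [hn]; simp only [Nat.add_sub_cancel]
        field_simp
        ring
    rw [neg_div, h6]
    push_cast
    field_simp
    ring
  obtain ⟨D, hD⟩ : ∃ D, D = (1 + 2 * ‖y‖ ^ 2 + 2 * (2 * r) ^ 2) ^ (N + 6) := ⟨_, rfl⟩
  have hDw : ∀ (s : ℝ) (w : EN N), 0 < s → s ≤ 2 * r → wt (s⁻¹ • (w - y)) ≤ D * wt w :=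
    fun s w h1 h2 => by rw [hD]; exact wt_scale le_rfl h1 h2
  clear hD
  have hkey := hasDerivAt_integral_of_dominated_loc_of_deriv_le (μ := (volume : Measure (EN N)))
    (F := fun s w => u w * ((s ^ (N + j))⁻¹ * k (s⁻¹ • (w - y))))
    (F' := fun s w => u w * ((s ^ (N + j + 1))⁻¹ * lap N κ (s⁻¹ • (w - y)))) (x₀ := r)
    (s := Ioo (r / 2) (2 * r))
    (bound := fun w => (M * ((((r / 2) ^ (N + j + 1))⁻¹) * (C * D))) * ((1 + ‖w‖ ^ 2) ^ 1 * wt w))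
    (Ioo_mem_nhds (by linarith) (by linarith)) ?_ ?_ ?_ ?_ ?_ ?_
  · have h1 : ∀ s, 0 < s → (s ^ j)⁻¹ * I u k y s =
        ∫ w, u w * ((s ^ (N + j))⁻¹ * k (s⁻¹ • (w - y))) := by
      intro s hs
      rw [I_eq _ _ _ hs, ← mul_assoc, ← integral_const_mul]
      congr 1; ext w; rw [pow_add, mul_inv]; ring
    have h2 : HasDerivAt (fun r => (r ^ j)⁻¹ * I u k y r) _ r :=
      hkey.2.congr_of_eventuallyEq (by
        filter_upwards [lt_mem_nhds hr] with s hs using h1 s hs)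
    refine h2.congr_deriv ?_
    have h3 := h.weak_scaled hκ y hr
    rw [I_eq _ _ _ hr] at h3
    have h4 : ∫ w, u w * ((r ^ (N + j + 1))⁻¹ * lap N κ (r⁻¹ • (w - y))) =
        (r ^ (j + 1))⁻¹ * ((r ^ N)⁻¹ * ∫ w, u w * lap N κ (r⁻¹ • (w - y))) := by
      rw [← mul_assoc, ← integral_const_mul]
      congr 1; ext w; rw [show N + j + 1 = (j + 1) + N by ring, pow_add _ (j + 1) N, mul_inv]; ring
    rw [h4, h3, pow_succ]
    field_simp
  · filter_upwards [lt_mem_nhds hr] with s hs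
    exact h.aesm.mul (Continuous.aestronglyMeasurable
      (continuous_const.mul (hk.continuous.comp (by fun_prop))))
  · have := (integrable_w h.qg h.aesm hk.continuous hk.bound y hr).const_mul ((r ^ (N + j))⁻¹)
    refine this.congr (Eventually.of_forall fun w => by simp only; ring)
  · exact h.aesm.mul (Continuous.aestronglyMeasurable
      (continuous_const.mul ((continuous_lap hκ.smooth).comp (by fun_prop))))
  · refine Eventually.of_forall fun w s hs => ?_
    have hs0 : 0 < s := by linarith [hs.1]
    rw [norm_mul, norm_mul, Real.norm_eq_abs, Real.norm_eq_abs, Real.norm_eq_abs,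
      abs_of_pos (inv_pos.mpr (pow_pos hs0 _))]
    have h1 : (s ^ (N + j + 1))⁻¹ ≤ ((r / 2) ^ (N + j + 1))⁻¹ := by
      gcongr; exact hs.1.le
    have h2 : |lap N κ (s⁻¹ • (w - y))| ≤ (C * D) * wt w := by
      refine (hκ.lbound _).trans ?_
      rw [mul_assoc]
      exact mul_le_mul_of_nonneg_left (hDw s w hs0 hs.2.le) hC
    have h3 : |u w| * ((s ^ (N + j + 1))⁻¹ * |lap N κ (s⁻¹ • (w - y))|) ≤
        (M * (1 + ‖w‖ ^ 2)) * (((r / 2) ^ (N + j + 1))⁻¹ * ((C * D) * wt w)) := by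
          refine mul_le_mul (h.growth w) (mul_le_mul h1 h2 (abs_nonneg _) (by positivity))
            (mul_nonneg (by positivity) (abs_nonneg _))
            (mul_nonneg h.M_nonneg (one_add_pos w).le)
    refine h3.trans_eq ?_
    ring
  · refine Integrable.const_mul ?_ _
    refine integrable_of_le_wt (C := 1) (j := 1) ?_ (by norm_num) (fun x => ?_)
    · exact (Continuous.mul (by fun_prop) continuous_wt).aestronglyMeasurable
    · rw [abs_of_nonneg (mul_nonneg (by positivity) (wt_pos x).le), one_mul]
  · exact Eventually.of_forall fun w s hs => hG w s (by linarith [hs.1])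

set_option maxHeartbeats 1000000 in
theorem hasDerivAt_I_translate {u : EN N → ℝ} (hu : QG M u) (um : AEStronglyMeasurable u)
    {k : EN N → ℝ} {C : ℝ} (hk : Ker k C) (y f : EN N) {r : ℝ} (hr : 0 < r) (τ : ℝ) :
    HasDerivAt (fun τ => I u k (y + τ • f) r)
      (-(r⁻¹ * I u (fun x => fderiv ℝ k x f) (y + τ • f) r)) τ := by
  have hC := hk.nonneg
  set Y := ‖y‖ + (|τ| + 1) * ‖f‖
  obtain ⟨D, hD⟩ : ∃ D, D = (1 + 2 * Y ^ 2 + 2 * r ^ 2) ^ (N + 6) := ⟨_, rfl⟩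
  have hDw : ∀ (z w : EN N), ‖z‖ ≤ Y → wt (r⁻¹ • (w - z)) ≤ D * wt w := fun z w hz => by
    rw [hD]; exact wt_scale hz hr le_rfl
  have hkey := hasDerivAt_integral_of_dominated_loc_of_deriv_le (μ := (volume : Measure (EN N)))
    (F := fun (t : ℝ) (w : EN N) => u w * k (r⁻¹ • (w - (y + t • f))))
    (F' := fun (t : ℝ) (w : EN N) => u w * (-(r⁻¹ * fderiv ℝ k (r⁻¹ • (w - (y + t • f))) f))) (x₀ := τ)
    (s := ball τ 1)
    (bound := fun w => (M * (r⁻¹ * (C * D * ‖f‖))) * ((1 + ‖w‖ ^ 2) ^ 1 * wt w))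
    (ball_mem_nhds _ one_pos) ?_ ?_ ?_ ?_ ?_ ?_
  · have h2 := hkey.2.const_mul ((r ^ N)⁻¹)
    have h3 : (fun τ => I u k (y + τ • f) r) =
        fun t : ℝ => (r ^ N)⁻¹ * ∫ w : EN N, u w * k (r⁻¹ • (w - (y + t • f))) := by
      funext t; exact I_eq _ _ _ hr
    rw [h3]
    refine h2.congr_deriv ?_
    have h4 : ∫ w : EN N, u w * (-(r⁻¹ * fderiv ℝ k (r⁻¹ • (w - (y + τ • f))) f)) =
        -(r⁻¹ * ∫ w : EN N, u w * fderiv ℝ k (r⁻¹ • (w - (y + τ • f))) f) := by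
      rw [← integral_const_mul, ← integral_neg]
      congr 1; ext w; ring
    rw [I_eq _ _ _ hr, h4]; ring
  · exact Eventually.of_forall fun t => um.mul (Continuous.aestronglyMeasurable
      (hk.continuous.comp (by fun_prop)))
  · exact integrable_w hu um hk.continuous hk.bound _ hr
  · exact um.mul (Continuous.aestronglyMeasurable
      ((continuous_const.mul ((hk.continuous_fderiv_apply f).comp (by fun_prop))).neg))
  · refine Eventually.of_forall fun w t ht => ?_
    rw [norm_mul, norm_neg, norm_mul, Real.norm_eq_abs, Real.norm_eq_abs, Real.norm_eq_abs,
      abs_of_pos (inv_pos.mpr hr)]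
    have hY : ‖y + t • f‖ ≤ Y := by
      refine (norm_add_le _ _).trans ?_
      rw [norm_smul, Real.norm_eq_abs]
      have : |t| ≤ |τ| + 1 := by
        have h1 : |t - τ| < 1 := by simpa [Real.dist_eq] using ht
        have h2 := abs_add_le (t - τ) τ
        rw [sub_add_cancel] at h2; linarith
      simp only [Y]; gcongr
    have h2 : |fderiv ℝ k (r⁻¹ • (w - (y + t • f))) f| ≤ C * (D * wt w) * ‖f‖ := by
      refine (hk.dbound _ _).trans ?_
      refine mul_le_mul_of_nonneg_right ?_ (norm_nonneg f)
      exact mul_le_mul_of_nonneg_left (hDw _ _ hY) hC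
    have h3 : |u w| * (r⁻¹ * |fderiv ℝ k (r⁻¹ • (w - (y + t • f))) f|) ≤
        (M * (1 + ‖w‖ ^ 2)) * (r⁻¹ * (C * (D * wt w) * ‖f‖)) := by
          refine mul_le_mul (hu w) (mul_le_mul_of_nonneg_left h2 (inv_pos.mpr hr).le)
            (mul_nonneg (inv_pos.mpr hr).le (abs_nonneg _))
            (mul_nonneg hu.nonneg (one_add_pos w).le)
    refine h3.trans_eq ?_
    ring
  · refine Integrable.const_mul ?_ _
    refine integrable_of_le_wt (C := 1) (j := 1) ?_ (by norm_num) (fun x => ?_)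
    · exact (Continuous.mul (by fun_prop) continuous_wt).aestronglyMeasurable
    · rw [abs_of_nonneg (mul_nonneg (by positivity) (wt_pos x).le), one_mul]
  · refine Eventually.of_forall fun w t ht => ?_
    have h1 : HasDerivAt (fun t : ℝ => r⁻¹ • (w - (y + t • f))) (r⁻¹ • (-((1 : ℝ) • f))) t :=
      ((((hasDerivAt_id t).smul_const f).const_add y).const_sub w).const_smul r⁻¹
    have h2 := ((hk.differentiable (r⁻¹ • (w - (y + t • f)))).hasFDerivAt.comp_hasDerivAt t h1).const_mul
      (u w)
    refine h2.congr_deriv ?_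
    simp

end GlobalSol

namespace GlobalSol
variable {N : ℕ}

theorem abs_mul_le_of {a b A B : ℝ} (ha : |a| ≤ A) (hb : |b| ≤ B) : |a * b| ≤ A * B := by
  rw [abs_mul]; exact mul_le_mul ha hb (abs_nonneg _) ((abs_nonneg _).trans ha)

theorem abs_add_le_of {a b A B : ℝ} (ha : |a| ≤ A) (hb : |b| ≤ B) : |a + b| ≤ A + B :=
  (abs_add_le a b).trans (add_le_add ha hb)

theorem Prof.exists_ker {g : ℝ → ℝ} (h : Prof (N + 8) g) : ∃ C, 0 ≤ C ∧ Ker (kr g : EN N → ℝ) C ∧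
    (∀ e : EN N, Ker (kl g e) (C * ‖e‖)) ∧ ∀ e f : EN N, Ker (kq g e f) (C * ‖e‖ * ‖f‖) := by
  obtain ⟨c0, h0⟩ := h.bound 0
  obtain ⟨c1, h1⟩ := h.bound 1
  obtain ⟨c2, h2⟩ := h.bound 2
  obtain ⟨c3, h3⟩ := h.bound 3
  obtain ⟨c, hc, k0, k1, k2, k3⟩ : ∃ c, 0 ≤ c ∧ c0 ≤ c ∧ c1 ≤ c ∧ c2 ≤ c ∧ c3 ≤ c :=
    ⟨|c0| + |c1| + |c2| + |c3|, by positivity,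
      by linarith [le_abs_self c0, abs_nonneg c1, abs_nonneg c2, abs_nonneg c3],
      by linarith [le_abs_self c1, abs_nonneg c0, abs_nonneg c2, abs_nonneg c3],
      by linarith [le_abs_self c2, abs_nonneg c1, abs_nonneg c0, abs_nonneg c3],
      by linarith [le_abs_self c3, abs_nonneg c1, abs_nonneg c2, abs_nonneg c0]⟩
  have D : ∀ x : EN N, ∃ d, 0 ≤ d ∧ (1 + ‖x‖ ^ 2) ^ 2 * d = c * wt x ∧ |g (‖x‖ ^ 2)| ≤ d ∧
      |_root_.deriv g (‖x‖ ^ 2)| ≤ d ∧ |_root_.deriv (_root_.deriv g) (‖x‖ ^ 2)| ≤ d ∧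
      |_root_.deriv (_root_.deriv (_root_.deriv g)) (‖x‖ ^ 2)| ≤ d := by
    intro x
    have hp := one_add_pos x
    have hi : 0 ≤ ((1 + ‖x‖ ^ 2) ^ (N + 8))⁻¹ := by positivity
    refine ⟨c * ((1 + ‖x‖ ^ 2) ^ (N + 8))⁻¹, by positivity, ?_, ?_, ?_, ?_, ?_⟩
    · unfold wt
      rw [show N + 8 = 2 + (N + 6) by ring, pow_add]
      field_simp
    · have := h0 _ (sq_nonneg ‖x‖)
      rw [iteratedDeriv_zero] at this
      exact this.trans (mul_le_mul_of_nonneg_right k0 hi)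
    · have := h1 _ (sq_nonneg ‖x‖)
      rw [iteratedDeriv_one] at this
      exact this.trans (mul_le_mul_of_nonneg_right k1 hi)
    · have := h2 _ (sq_nonneg ‖x‖)
      rw [iteratedDeriv_succ, iteratedDeriv_one] at this
      exact this.trans (mul_le_mul_of_nonneg_right k2 hi)
    · have := h3 _ (sq_nonneg ‖x‖)
      rw [iteratedDeriv_succ, iteratedDeriv_succ, iteratedDeriv_one] at this
      exact this.trans (mul_le_mul_of_nonneg_right k3 hi)
  have hN : (0 : ℝ) ≤ N := Nat.cast_nonneg N
  have P : ∀ (x : EN N) (A d X : ℝ), 0 ≤ A → 0 ≤ d → (1 + ‖x‖ ^ 2) ^ 2 * d = c * wt x →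
      X ≤ (6 * N + 40) * (1 + ‖x‖ ^ 2) ^ 2 → A * (d * X) ≤ ((6 * N + 40) * c * A) * wt x := by
    intro x A d X hA hd hdw hX
    calc A * (d * X) ≤ A * (d * ((6 * N + 40) * (1 + ‖x‖ ^ 2) ^ 2)) := by gcongr
      _ = A * ((6 * N + 40) * ((1 + ‖x‖ ^ 2) ^ 2 * d)) := by ring
      _ = _ := by rw [hdw]; ring
  have two : |(2 : ℝ)| ≤ 2 := by norm_num
  have four : |(4 : ℝ)| ≤ 4 := by norm_num
  have eight : |(8 : ℝ)| ≤ 8 := by norm_num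
  have n1 : |(2 * N + 4 : ℝ)| ≤ 2 * N + 4 := (abs_of_nonneg (by positivity)).le
  have n2 : |(4 * N + 16 : ℝ)| ≤ 4 * N + 16 := (abs_of_nonneg (by positivity)).le
  have n3 : |(2 * N : ℝ)| ≤ 2 * N := (abs_of_nonneg (by positivity)).le
  have I := fun x y : EN N => abs_real_inner_le_norm x y
  have sq : ∀ x : EN N, |‖x‖ ^ 2| ≤ ‖x‖ ^ 2 := fun x => (abs_of_nonneg (sq_nonneg _)).le
  have bl : ∀ e x : EN N, |kl g e x| ≤ ((6 * N + 40) * c * ‖e‖) * wt x := by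
    intro e x
    obtain ⟨d, hd, hdw, d0, d1, d2, d3⟩ := D x
    refine (abs_mul_le_of (I x e) d0).trans ?_
    refine le_of_eq_of_le ?_ (P x ‖e‖ d ‖x‖ (norm_nonneg _) hd hdw ?_)
    · ring
    · nlinarith [sq_nonneg (‖x‖ - 1), norm_nonneg x, sq_nonneg (‖x‖ ^ 2), mul_nonneg hN (sq_nonneg (1 + ‖x‖ ^ 2))]
  have bq : ∀ e f x : EN N, |kq g e f x| ≤ ((6 * N + 40) * c * (‖e‖ * ‖f‖)) * wt x := by
    intro e f x
    obtain ⟨d, hd, hdw, d0, d1, d2, d3⟩ := D x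
    rw [kq, abs_neg]
    refine (abs_add_le_of (abs_mul_le_of (I e f) d0) (abs_mul_le_of two
      (abs_mul_le_of (abs_mul_le_of (I x e) (I x f)) d1))).trans ?_
    refine le_of_eq_of_le ?_ (P x (‖e‖ * ‖f‖) d (1 + 2 * ‖x‖ ^ 2) (by positivity) hd hdw ?_)
    · ring
    · nlinarith [sq_nonneg (‖x‖ ^ 2), sq_nonneg ‖x‖, mul_nonneg hN (sq_nonneg (1 + ‖x‖ ^ 2))]
  refine ⟨(6 * N + 40) * c, by positivity, ⟨contDiff_kr h, by positivity, ?_, ?_, ?_⟩,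
    fun e => ⟨contDiff_kl h e, by positivity, bl e, ?_, ?_⟩,
    fun e f => ⟨contDiff_kq h e f, by positivity, ?_, ?_, ?_⟩⟩
  · intro x
    obtain ⟨d, hd, hdw, d0, d1, d2, d3⟩ := D x
    refine (show |kr g x| ≤ d from d0).trans ?_
    have := P x 1 d 1 zero_le_one hd hdw (by
      nlinarith [sq_nonneg ‖x‖, sq_nonneg (‖x‖ ^ 2), mul_nonneg hN (sq_nonneg (1 + ‖x‖ ^ 2))])
    simpa using this
  · intro x v
    obtain ⟨d, hd, hdw, d0, d1, d2, d3⟩ := D x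
    rw [fderiv_kr h]
    refine (abs_mul_le_of (abs_mul_le_of two (I x v)) d1).trans ?_
    refine le_of_eq_of_le ?_ ((P x ‖v‖ d (2 * ‖x‖) (norm_nonneg _) hd hdw ?_).trans_eq ?_)
    · ring
    · nlinarith [sq_nonneg (‖x‖ - 1), norm_nonneg x, sq_nonneg (‖x‖ ^ 2), mul_nonneg hN (sq_nonneg (1 + ‖x‖ ^ 2))]
    · ring
  · intro x
    obtain ⟨d, hd, hdw, d0, d1, d2, d3⟩ := D x
    rw [lap_kr h]
    refine (abs_add_le_of (abs_mul_le_of n3 d1) (abs_mul_le_of (abs_mul_le_of four (sq x)) d2)).trans ?_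
    have := P x 1 d (2 * N + 4 * ‖x‖ ^ 2) zero_le_one hd hdw (by
      nlinarith [sq_nonneg ‖x‖, sq_nonneg (‖x‖ ^ 2), mul_nonneg hN (sq_nonneg ‖x‖),
        mul_nonneg hN (sq_nonneg (‖x‖ ^ 2))])
    rw [mul_one] at this
    refine le_of_eq_of_le ?_ this
    ring
  · intro x v
    rw [fderiv_kl h, abs_neg]
    refine (bq e v x).trans_eq ?_
    ring
  · intro x
    obtain ⟨d, hd, hdw, d0, d1, d2, d3⟩ := D x
    rw [lap_kl h]
    refine (abs_mul_le_of (I x e) (abs_add_le_of (abs_mul_le_of n1 d1)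
      (abs_mul_le_of (abs_mul_le_of four (sq x)) d2))).trans ?_
    refine le_of_eq_of_le ?_ (P x ‖e‖ d (‖x‖ * (2 * N + 4 + 4 * ‖x‖ ^ 2)) (norm_nonneg _) hd hdw ?_)
    · ring
    · have hx : ‖x‖ ≤ 1 + ‖x‖ ^ 2 := by nlinarith [sq_nonneg (‖x‖ - 1), norm_nonneg x]
      have : ‖x‖ * (2 * N + 4 + 4 * ‖x‖ ^ 2) ≤ (1 + ‖x‖ ^ 2) * ((2 * N + 4) * (1 + ‖x‖ ^ 2)) := by
        gcongr
        nlinarith [mul_nonneg hN (sq_nonneg ‖x‖)]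
      nlinarith [mul_nonneg hN (sq_nonneg (1 + ‖x‖ ^ 2)), sq_nonneg (1 + ‖x‖ ^ 2)]
  · intro x
    refine (bq e f x).trans_eq ?_
    ring
  · intro x v
    obtain ⟨d, hd, hdw, d0, d1, d2, d3⟩ := D x
    rw [fderiv_kq h, kc, abs_neg]
    refine (abs_add_le_of (abs_mul_le_of (I e f) (abs_mul_le_of (abs_mul_le_of two (I x v)) d1))
      (abs_mul_le_of two (abs_add_le_of (abs_mul_le_of (abs_add_le_of (abs_mul_le_of (I v e) (I x f))
        (abs_mul_le_of (I x e) (I v f))) d1) (abs_mul_le_of (abs_mul_le_of (I x e) (I x f))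
          (abs_mul_le_of (abs_mul_le_of two (I x v)) d2))))).trans ?_
    refine le_of_eq_of_le ?_ ((P x (‖e‖ * ‖f‖ * ‖v‖) d (‖x‖ * (6 + 4 * ‖x‖ ^ 2)) (by positivity)
      hd hdw ?_).trans_eq ?_)
    · ring
    · have hx : ‖x‖ ≤ 1 + ‖x‖ ^ 2 := by nlinarith [sq_nonneg (‖x‖ - 1), norm_nonneg x]
      have : ‖x‖ * (6 + 4 * ‖x‖ ^ 2) ≤ (1 + ‖x‖ ^ 2) * (6 * (1 + ‖x‖ ^ 2)) := by
        gcongr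
        nlinarith [sq_nonneg ‖x‖]
      nlinarith [mul_nonneg hN (sq_nonneg (1 + ‖x‖ ^ 2)), sq_nonneg (1 + ‖x‖ ^ 2)]
    · ring
  · intro x
    obtain ⟨d, hd, hdw, d0, d1, d2, d3⟩ := D x
    rw [lap_kq h, abs_neg]
    refine (abs_add_le_of (abs_mul_le_of (I e f) (abs_add_le_of (abs_mul_le_of n1 d1)
      (abs_mul_le_of (abs_mul_le_of four (sq x)) d2))) (abs_mul_le_of (abs_mul_le_of (I x e) (I x f))
      (abs_add_le_of (abs_mul_le_of n2 d2) (abs_mul_le_of (abs_mul_le_of eight (sq x)) d3)))).trans ?_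
    refine le_of_eq_of_le ?_ ((P x (‖e‖ * ‖f‖) d (2 * N + 4 + (4 * N + 20) * ‖x‖ ^ 2 +
      8 * (‖x‖ ^ 2) ^ 2) (by positivity) hd hdw ?_).trans_eq ?_)
    · ring
    · nlinarith [sq_nonneg ‖x‖, sq_nonneg (‖x‖ ^ 2), mul_nonneg hN (sq_nonneg ‖x‖),
        mul_nonneg hN (sq_nonneg (‖x‖ ^ 2))]
    · ring

end GlobalSol

namespace GlobalSol
variable {N : ℕ}

theorem Ker.mono {k : EN N → ℝ} {C C' : ℝ} (h : Ker k C) (hC : C ≤ C') : Ker k C' where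
  smooth := h.smooth
  nonneg := h.nonneg.trans hC
  bound x := (h.bound x).trans (mul_le_mul_of_nonneg_right hC (wt_pos x).le)
  dbound x v := (h.dbound x v).trans (mul_le_mul_of_nonneg_right
    (mul_le_mul_of_nonneg_right hC (wt_pos x).le) (norm_nonneg v))
  lbound x := (h.lbound x).trans (mul_le_mul_of_nonneg_right hC (wt_pos x).le)

/-- The kernels built from the profile `g` and from `hat g` obey a common bound. -/
structure KB (N : ℕ) (g : ℝ → ℝ) (C : ℝ) : Prop where
  prof : Prof (N + 8) g
  nonneg : 0 ≤ C
  kr : Ker (kr g : EN N → ℝ) C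
  kl : ∀ e : EN N, Ker (kl g e) (C * ‖e‖)
  kq : ∀ e f : EN N, Ker (kq g e f) (C * ‖e‖ * ‖f‖)
  klh : ∀ e : EN N, Ker (GlobalSol.kl (hat g) e) (C * ‖e‖)
  kqh : ∀ e f : EN N, Ker (GlobalSol.kq (hat g) e f) (C * ‖e‖ * ‖f‖)

theorem Prof.exists_KB {g : ℝ → ℝ} (h : Prof (N + 8) g) : ∃ C, KB N g C := by
  obtain ⟨C, hC, h1, h2, h3⟩ := h.exists_ker (N := N)
  obtain ⟨C', hC', h1', h2', h3'⟩ := h.hat.exists_ker (N := N)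
  have a : C ≤ C + C' := by linarith
  have b : C' ≤ C + C' := by linarith
  exact ⟨C + C', h, by positivity, h1.mono a, fun e => (h2 e).mono (by gcongr),
    fun e f => (h3 e f).mono (by gcongr), fun e => (h2' e).mono (by gcongr),
    fun e f => (h3' e f).mono (by gcongr)⟩

/-- Integral of the weight with one extra power. -/
def W1 (N : ℕ) : ℝ := ∫ z : EN N, (1 + ‖z‖ ^ 2) * wt z

theorem integrable_W1 : Integrable (fun z : EN N => (1 + ‖z‖ ^ 2) * wt z) :=
  integrable_of_le_wt (C := 1) (j := 1)
    (Continuous.mul (by fun_prop) continuous_wt).aestronglyMeasurable (by norm_num)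
    (fun x => by rw [abs_of_nonneg (mul_nonneg (by positivity) (wt_pos x).le)]; simp)

theorem W1_nonneg (N : ℕ) : 0 ≤ W1 N :=
  integral_nonneg fun z => mul_nonneg (by positivity) (wt_pos z).le

theorem abs_I_le {u k : EN N → ℝ} {y : EN N} {r B C : ℝ} 
    (hu : ∀ z, |u (y + r • z)| ≤ B * (1 + ‖z‖ ^ 2)) (hk : ∀ z, |k z| ≤ C * wt z) :
    |I u k y r| ≤ B * C * W1 N := by
  unfold I W1
  rw [← integral_const_mul, ← Real.norm_eq_abs]
  refine norm_integral_le_of_norm_le (integrable_W1.const_mul _) (Eventually.of_forall fun z => ?_)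
  rw [Real.norm_eq_abs]
  refine (abs_mul_le_of (hu z) (hk z)).trans_eq ?_
  ring

theorem QG.affine {M : ℝ} {u : EN N → ℝ} (h : QG M u) (y z : EN N) (r : ℝ) :
    |u (y + r • z)| ≤ M * (1 + 2 * ‖y‖ ^ 2 + 2 * r ^ 2) * (1 + ‖z‖ ^ 2) := by
  refine (h _).trans ?_
  rw [mul_assoc]
  refine mul_le_mul_of_nonneg_left ?_ h.nonneg
  have h1 := norm_add_le y (r • z)
  rw [norm_smul, Real.norm_eq_abs] at h1
  have h2 : ‖y + r • z‖ ^ 2 ≤ (‖y‖ + |r| * ‖z‖) ^ 2 := by gcongr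
  have h3 : (|r| * ‖z‖) ^ 2 = r ^ 2 * ‖z‖ ^ 2 := by rw [mul_pow, sq_abs]
  nlinarith [sq_nonneg (‖y‖ - |r| * ‖z‖), sq_nonneg (‖y‖ * ‖z‖), sq_nonneg ‖z‖, sq_nonneg r]

theorem I_add_kernel {M C C' : ℝ} {u k k' : EN N → ℝ} (hu : QG M u) (um : AEStronglyMeasurable u)
    (hk : Ker k C) (hk' : Ker k' C') (a b : ℝ) (y : EN N) {r : ℝ} (hr : 0 < r) :
    I u (fun z => a * k z + b * k' z) y r = a * I u k y r + b * I u k' y r := by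
  unfold I
  rw [← integral_const_mul, ← integral_const_mul, ← integral_add]
  · congr 1; ext z; ring
  · exact (integrable_z hu um hk.continuous hk.bound y hr).const_mul a
  · exact (integrable_z hu um hk'.continuous hk'.bound y hr).const_mul b

theorem I_neg_kernel (u k : EN N → ℝ) (y : EN N) (r : ℝ) :
    I u (fun z => -k z) y r = -I u k y r := by
  unfold I
  rw [← integral_neg]
  congr 1; ext z; ring

theorem I_om_add_la {Λ : Set (EN N)} (hΛ : IsClosed Λ) {k : EN N → ℝ} {C : ℝ} (hk : Ker k C)
    (y : EN N) {r : ℝ} (hr : 0 < r) : I (om Λ) k y r + I (la Λ) k y r = ∫ z, k z := by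
  unfold I
  rw [← integral_add (integrable_z (QG_om Λ) (aesm_om hΛ) hk.continuous hk.bound y hr)
    (integrable_z (QG_la Λ) (aesm_la hΛ) hk.continuous hk.bound y hr)]
  congr 1; ext z
  rw [← add_mul, om_add_la, one_mul]

theorem QG_one : QG (N := N) 1 (fun _ => 1) := QG_of_le_one (fun _ => zero_le_one) (fun _ => le_rfl)

theorem integral_fderiv_ker {k : EN N → ℝ} {C : ℝ} (hk : Ker k C) (f : EN N) :
    ∫ z, fderiv ℝ k z f = 0 := by
  have h := hasDerivAt_I_translate QG_one aestronglyMeasurable_const hk 0 f one_pos 0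
  have h' : HasDerivAt (fun τ : ℝ => I (fun _ => 1) k (0 + τ • f) 1) 0 0 := by
    simpa [I] using hasDerivAt_const (0 : ℝ) (∫ z, k z)
  have := h.unique h'
  simpa [I] using this

theorem QG_linear (L : EN N →L[ℝ] ℝ) : QG ‖L‖ L := fun x => by
  refine (L.le_opNorm x).trans ?_
  gcongr
  nlinarith [sq_nonneg (‖x‖ - 1), norm_nonneg x]

theorem integral_linear_mul_fderiv_ker {k : EN N → ℝ} {C : ℝ} (hk : Ker k C) (f : EN N)
    (L : EN N →L[ℝ] ℝ) : ∫ z, L z * fderiv ℝ k z f = -(L f * ∫ z, k z) := by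
  have h := hasDerivAt_I_translate (QG_linear L) L.continuous.aestronglyMeasurable hk 0 f one_pos 0
  have h1 := integrable_z (QG_linear L) L.continuous.aestronglyMeasurable hk.continuous hk.bound 0
    one_pos
  have h2 : (fun τ : ℝ => I L k (0 + τ • f) 1) =
      fun τ => τ * (L f * ∫ z, k z) + ∫ z, L z * k z := by
    ext τ
    unfold I
    rw [← integral_const_mul, ← integral_const_mul, ← integral_add]
    · congr 1; ext z; simp; ring
    · exact (hk.integrable.const_mul _).const_mul _
    · simpa using h1
  rw [h2] at h
  have h' : HasDerivAt (fun τ : ℝ => τ * (L f * ∫ z, k z) + ∫ z, L z * k z) (L f * ∫ z, k z) 0 := by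
    simpa using ((hasDerivAt_id (0 : ℝ)).mul_const (L f * ∫ z, k z)).add_const (∫ z, L z * k z)
  have := h.unique h'
  simp only [I, zero_smul, zero_add, one_smul, inv_one, one_mul] at this
  linarith

variable {g : ℝ → ℝ} {C : ℝ}

theorem KB.integral_kq (h : KB N g C) (e f : EN N) : ∫ z, GlobalSol.kq g e f z = 0 := by
  have := integral_fderiv_ker (h.kl e) f
  simp only [fderiv_kl h.prof, integral_neg] at this
  linarith

theorem klh_eq (h : KB N g C) (e z : EN N) : kl (hat g) e z = -fderiv ℝ (kr g) z e := by
  rw [fderiv_kr h.prof]; simp only [kl, hat]; ring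

/-- Total mass of the radial kernel. -/
def mass (N : ℕ) (g : ℝ → ℝ) : ℝ := ∫ z : EN N, kr g z

/-- Mollified first derivative. -/
def V (u : EN N → ℝ) (g : ℝ → ℝ) (y : EN N) (r : ℝ) (e : EN N) : ℝ :=
  (r ^ 1)⁻¹ * I u (kl (hat g) e) y r

/-- Mollified second derivative. -/
def A (u : EN N → ℝ) (g : ℝ → ℝ) (y : EN N) (r : ℝ) (e f : EN N) : ℝ :=
  (r ^ 2)⁻¹ * I u (kq (hat g) e f) y r

variable {M : ℝ} {Λ : Set (EN N)} {u : EN N → ℝ}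

theorem GSol.hasDerivAt_V (h : GSol M Λ u) (hg : KB N g C) (y e : EN N) {r : ℝ} (hr : 0 < r) :
    HasDerivAt (fun r => V u g y r e) (I (om Λ) (kl g e) y r) r := by
  have := h.flow (hg.klh e) (hg.kl e) 1 (euler_kl hg.prof e) y hr
  refine this.congr_deriv ?_
  field_simp

theorem GSol.hasDerivAt_A (h : GSol M Λ u) (hg : KB N g C) (y e f : EN N) {r : ℝ} (hr : 0 < r) :
    HasDerivAt (fun r => A u g y r e f) (r⁻¹ * I (om Λ) (kq g e f) y r) r := by
  have := h.flow (hg.kqh e f) (hg.kq e f) 2 (euler_kq hg.prof e f) y hr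
  refine this.congr_deriv ?_
  field_simp

theorem GSol.hasDerivAt_A' (h : GSol M Λ u) (hg : KB N g C) (y e f : EN N) {r : ℝ} (hr : 0 < r) :
    HasDerivAt (fun r => A u g y r e f) (-(r⁻¹ * I (la Λ) (kq g e f) y r)) r := by
  refine (h.hasDerivAt_A hg y e f hr).congr_deriv ?_
  have := I_om_add_la h.closed (hg.kq e f) y hr
  rw [hg.integral_kq] at this
  rw [show I (om Λ) (kq g e f) y r = -I (la Λ) (kq g e f) y r by linarith]; ring

theorem GSol.hasDerivAt_V_translate (h : GSol M Λ u) (hg : KB N g C) (y e f : EN N) {r : ℝ}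
    (hr : 0 < r) (τ : ℝ) :
    HasDerivAt (fun τ => V u g (y + τ • f) r e) (A u g (y + τ • f) r e f) τ := by
  have := (hasDerivAt_I_translate h.qg h.aesm (hg.klh e) y f hr τ).const_mul ((r ^ 1)⁻¹)
  refine this.congr_deriv ?_
  simp only [fderiv_kl hg.prof.hat, I_neg_kernel, A]
  field_simp

theorem GSol.V_sub (h : GSol M Λ u) (hg : KB N g C) (y z e : EN N) {r : ℝ} (hr : 0 < r) :
    ∃ t ∈ Ioo (0 : ℝ) 1, V u g z r e - V u g y r e = A u g (y + t • (z - y)) r e (z - y) := by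
  obtain ⟨t, ht, h1⟩ := exists_hasDerivAt_eq_slope (fun τ => V u g (y + τ • (z - y)) r e)
    (fun τ => A u g (y + τ • (z - y)) r e (z - y)) zero_lt_one
    (fun τ _ => (h.hasDerivAt_V_translate hg y e (z - y) hr τ).continuousAt.continuousWithinAt)
    (fun τ _ => h.hasDerivAt_V_translate hg y e (z - y) hr τ)
  refine ⟨t, ht, ?_⟩
  rw [h1]; simp

theorem A_symm (u : EN N → ℝ) (g : ℝ → ℝ) (y : EN N) (r : ℝ) (e f : EN N) :
    A u g y r e f = A u g y r f e := by
  unfold A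
  congr 2; ext z; simp only [kq]; rw [real_inner_comm]; ring

theorem GSol.A_left (h : GSol M Λ u) (hg : KB N g C) (y : EN N) {r : ℝ} (hr : 0 < r)
    (a b : ℝ) (e e' f : EN N) :
    A u g y r (a • e + b • e') f = a * A u g y r e f + b * A u g y r e' f := by
  unfold A
  have : kq (hat g) (a • e + b • e') f = fun z => a * kq (hat g) e f z + b * kq (hat g) e' f z := by
    ext z; simp only [kq, inner_add_left, inner_add_right, inner_smul_left, inner_smul_right]
    simp; ring
  rw [this, I_add_kernel h.qg h.aesm (hg.kqh e f) (hg.kqh e' f) a b y hr]; ring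

theorem GSol.A_right (h : GSol M Λ u) (hg : KB N g C) (y : EN N) {r : ℝ} (hr : 0 < r)
    (a b : ℝ) (e e' f : EN N) :
    A u g y r f (a • e + b • e') = a * A u g y r f e + b * A u g y r f e' := by
  rw [A_symm, h.A_left hg y hr, A_symm, A_symm _ _ _ _ e']

theorem GSol.sum_A (h : GSol M Λ u) (hg : KB N g C) (y : EN N) {r : ℝ} (hr : 0 < r) :
    ∑ i : Fin N, A u g y r (EuclideanSpace.single i 1) (EuclideanSpace.single i 1) =
      I (om Λ) (kr g) y r := by
  unfold A
  rw [← Finset.mul_sum]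
  have h1 : ∑ i : Fin N, I u (kq (hat g) (EuclideanSpace.single i 1) (EuclideanSpace.single i 1)) y r
      = I u (lap N (kr g)) y r := by
    unfold I
    rw [← integral_finsetSum]
    · congr 1; ext z; rw [← Finset.mul_sum, sum_kq_hat hg.prof]
    · intro i _
      exact integrable_z h.qg h.aesm (hg.kqh _ _).continuous (hg.kqh _ _).bound y hr
  rw [h1, h.weak_scaled hg.kr y hr]
  field_simp

theorem GSol.abs_A_le (h : GSol M Λ u) (hg : KB N g C) (y e f : EN N) {r r1 : ℝ} (h1 : 0 < r1)
    (hr : r1 ≤ r) :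
    |A u g y r e f| ≤ (M * ((1 + 2 * ‖y‖ ^ 2) * (r1 ^ 2)⁻¹ + 2) * C * W1 N) * (‖e‖ * ‖f‖) := by
  have hr0 : 0 < r := h1.trans_le hr
  unfold A
  rw [abs_mul, abs_of_pos (by positivity)]
  have h2 := abs_I_le (r := r) (fun z => h.qg.affine y z r) (hg.kqh e f).bound
  have h3 : (r ^ 2)⁻¹ ≤ (r1 ^ 2)⁻¹ := by gcongr
  have hC := hg.nonneg
  have hM := h.M_nonneg
  have hW := W1_nonneg N
  calc _ ≤ (r ^ 2)⁻¹ * (M * (1 + 2 * ‖y‖ ^ 2 + 2 * r ^ 2) * (C * ‖e‖ * ‖f‖) * W1 N) := by gcongr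
    _ = (M * ((1 + 2 * ‖y‖ ^ 2) * (r ^ 2)⁻¹ + 2) * C * W1 N) * (‖e‖ * ‖f‖) := by
      field_simp
    _ ≤ _ := by gcongr

theorem Ker.abs_sub_le {k : EN N → ℝ} {C : ℝ} (hk : Ker k C) {z v : EN N} (hv : ‖v‖ ≤ 2) :
    |k z - k (z + v)| ≤ C * ‖v‖ * 9 ^ (N + 6) * wt z := by
  have hd : ∀ t : ℝ, HasDerivAt (fun t : ℝ => k (z + t • v)) (fderiv ℝ k (z + t • v) v) t := by
    intro t
    have h1 : HasDerivAt (fun t : ℝ => z + t • v) v t := by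
      simpa using ((hasDerivAt_id t).smul_const v).const_add z
    exact (hk.differentiable _).hasFDerivAt.comp_hasDerivAt t h1
  obtain ⟨t, ht, h1⟩ := exists_hasDerivAt_eq_slope (fun t : ℝ => k (z + t • v)) _ zero_lt_one
    (fun τ _ => (hd τ).continuousAt.continuousWithinAt) (fun τ _ => hd τ)
  simp only [one_smul, zero_smul, add_zero, sub_zero, div_one] at h1
  rw [abs_sub_comm, ← h1]
  refine (hk.dbound _ _).trans ?_
  have h2 : wt (z + t • v) ≤ 9 ^ (N + 6) * wt z := wt_shift (by
    rw [norm_smul, Real.norm_eq_abs, abs_of_pos ht.1]; nlinarith [norm_nonneg v, ht.2, ht.1])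
  have := hk.nonneg
  calc _ ≤ C * (9 ^ (N + 6) * wt z) * ‖v‖ := by gcongr
    _ = _ := by ring

theorem abs_I_sub_le {M C B : ℝ} {w k : EN N → ℝ} (hw : QG M w) (wm : AEStronglyMeasurable w)
    (hk : Ker k C) {x y : EN N} {s : ℝ} (hs : 0 < s) (hxy : ‖x - y‖ ≤ 2 * s)
    (hB : ∀ z, |w (x + s • z)| ≤ B * (1 + ‖z‖ ^ 2)) :
    |I w k x s - I w k y s| ≤ B * (C * (‖x - y‖ / s) * 9 ^ (N + 6)) * W1 N := by
  set v := s⁻¹ • (x - y)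
  have hv : ‖v‖ = ‖x - y‖ / s := by
    rw [norm_smul, norm_inv, Real.norm_eq_abs, abs_of_pos hs]; field_simp
  have h1 : I w k y s = ∫ z, w (x + s • z) * k (z + v) := by
    unfold I
    rw [← integral_add_right_eq_self (fun z => w (y + s • z) * k z) v]
    congr 1; ext z
    congr 2
    simp only [v, smul_add, smul_smul, mul_inv_cancel₀ hs.ne', one_smul]; abel
  have i1 := integrable_z hw wm hk.continuous hk.bound x hs
  have i2 : Integrable (fun z => w (x + s • z) * k (z + v)) := by
    have := (integrable_z hw wm hk.continuous hk.bound y hs).comp_add_right v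
    refine this.congr (Eventually.of_forall fun z => ?_)
    simp only
    congr 2
    simp only [v, smul_add, smul_smul, mul_inv_cancel₀ hs.ne', one_smul]; abel
  have h2 : I w k x s - I w k y s = I w (fun z => k z - k (z + v)) x s := by
    rw [h1]; unfold I
    rw [← integral_sub i1 i2]
    congr 1; ext z; ring
  rw [h2, ← hv]
  exact abs_I_le hB (fun z => hk.abs_sub_le (by rw [hv, div_le_iff₀ hs]; exact hxy))

theorem GSol.tendsto_A_sub (h : GSol M Λ u) (hg : KB N g C) (x y e f : EN N) :
    Tendsto (fun R => A u g x R e f - A u g y R e f) atTop (nhds 0) := by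
  set K := M * (3 + 2 * ‖x‖ ^ 2) * (C * ‖e‖ * ‖f‖ * ‖x - y‖ * 9 ^ (N + 6)) * W1 N with hK
  have t : Tendsto (fun R : ℝ => K / R) atTop (nhds 0) := tendsto_const_nhds.div_atTop tendsto_id
  refine squeeze_zero_norm' ?_ t
  filter_upwards [eventually_ge_atTop (1 : ℝ), eventually_ge_atTop ‖x - y‖] with R h1 h2
  have hR : 0 < R := by linarith
  have h3 := abs_I_sub_le h.qg h.aesm (hg.kqh e f) hR (by linarith) (fun z => h.qg.affine x z R)
    (y := y)
  rw [Real.norm_eq_abs, A, A, ← mul_sub, abs_mul, abs_of_pos (by positivity)]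
  have hC := hg.nonneg
  have hM := h.M_nonneg
  have hW := W1_nonneg N
  have h4 : 1 + 2 * ‖x‖ ^ 2 + 2 * R ^ 2 ≤ (3 + 2 * ‖x‖ ^ 2) * R ^ 2 := by
    have : 1 ≤ R ^ 2 := by nlinarith
    nlinarith [sq_nonneg ‖x‖]
  calc _ ≤ (R ^ 2)⁻¹ * (M * (1 + 2 * ‖x‖ ^ 2 + 2 * R ^ 2) *
        (C * ‖e‖ * ‖f‖ * (‖x - y‖ / R) * 9 ^ (N + 6)) * W1 N) := by gcongr
    _ ≤ (R ^ 2)⁻¹ * (M * ((3 + 2 * ‖x‖ ^ 2) * R ^ 2) *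
        (C * ‖e‖ * ‖f‖ * (‖x - y‖ / R) * 9 ^ (N + 6)) * W1 N) := by gcongr
    _ = K / R := by rw [hK]; field_simp

theorem abs_sub_le_of_deriv_le {F F' : ℝ → ℝ} {r R K : ℝ} (hr : 0 < r) (hR : r ≤ R) (hK : 0 ≤ K)
    (hF : ∀ s, 0 < s → HasDerivAt F (F' s) s) (hb : ∀ s, r ≤ s → |F' s| ≤ K / s ^ 2) :
    |F R - F r| ≤ K / r := by
  have hd : ∀ s, 0 < s → HasDerivAt (fun s => -(K / s)) (K / s ^ 2) s := fun s hs => by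
    have := ((hasDerivAt_inv hs.ne').const_mul K).neg
    have h2 : (fun s => -(K / s)) = -fun y => K * y⁻¹ := by ext t; simp [div_eq_mul_inv]
    rw [h2]
    exact this.congr_deriv (by rw [div_eq_mul_inv]; ring)
  have h1 := image_norm_le_of_norm_deriv_right_le_deriv_boundary' (a := r) (b := R)
    (f := fun s => F s - F r) (f' := F') (B := fun s => K / r - K / s) (B' := fun s => K / s ^ 2)
    (fun s hs => ((hF s (by linarith [hs.1])).sub_const _).continuousAt.continuousWithinAt)
    (fun s hs => ((hF s (by linarith [hs.1])).sub_const _).hasDerivWithinAt) (by simp)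
    (fun s hs => by
      have := (hd s (by linarith [hs.1])).const_add (K / r)
      exact this.continuousAt.continuousWithinAt.congr (fun _ _ => by ring) (by ring))
    (fun s hs => by
      have := (hd s (by linarith [hs.1])).const_add (K / r)
      exact (this.congr_of_eventuallyEq (Eventually.of_forall fun _ => by ring)).hasDerivWithinAt)
    (fun s hs => by rw [Real.norm_eq_abs]; exact hb s hs.1) (right_mem_Icc.mpr hR)
  rw [Real.norm_eq_abs] at h1
  have : 0 ≤ K / R := div_nonneg hK (by linarith)
  linarith

theorem GSol.abs_A_sub_le (h : GSol M Λ u) (hg : KB N g C) {x y : EN N} (e f : EN N) {r : ℝ}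
    (hr : 0 < r) (hxy : ‖x - y‖ ≤ 2 * r) :
    |A u g x r e f - A u g y r e f| ≤ (2 * C * 9 ^ (N + 6) * W1 N) * (‖e‖ * ‖f‖) := by
  set K := C * ‖e‖ * ‖f‖ * (2 * r) * 9 ^ (N + 6) * W1 N with hK
  have hC := hg.nonneg
  have hW := W1_nonneg N
  have hK0 : 0 ≤ K := by positivity
  set F := fun s => A u g x s e f - A u g y s e f with hF
  have hd : ∀ s, 0 < s → HasDerivAt F (s⁻¹ * (I (om Λ) (kq g e f) x s - I (om Λ) (kq g e f) y s)) s :=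
    fun s hs => ((h.hasDerivAt_A hg x e f hs).sub (h.hasDerivAt_A hg y e f hs)).congr_deriv (by ring)
  have hb : ∀ R, r ≤ R → |F R - F r| ≤ K / r := fun R hR => by
    refine abs_sub_le_of_deriv_le hr hR hK0 hd (fun s hs => ?_)
    have hs0 : 0 < s := by linarith
    have h3 := abs_I_sub_le (QG_om Λ) (aesm_om h.closed) (hg.kq e f) hs0 (x := x) (y := y)
      (by linarith) (B := 1)
      (fun z => by
        rw [abs_of_nonneg (om_nonneg _ _)]
        nlinarith [om_le_one Λ (x + s • z), sq_nonneg ‖z‖])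
    rw [abs_mul, abs_of_pos (inv_pos.mpr hs0)]
    calc _ ≤ s⁻¹ * (1 * (C * ‖e‖ * ‖f‖ * (‖x - y‖ / s) * 9 ^ (N + 6)) * W1 N) := by gcongr
      _ ≤ s⁻¹ * (1 * (C * ‖e‖ * ‖f‖ * ((2 * r) / s) * 9 ^ (N + 6)) * W1 N) := by gcongr
      _ = K / s ^ 2 := by rw [hK]; field_simp
  have t := h.tendsto_A_sub hg x y e f
  have t2 : Tendsto (fun R => |F R - F r|) atTop (nhds |0 - F r|) := (t.sub_const _).abs
  have := le_of_tendsto t2 (by filter_upwards [eventually_ge_atTop r] with R hR using hb R hR)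
  rw [zero_sub, abs_neg] at this
  refine this.trans_eq ?_
  rw [hK]; field_simp

theorem GSol.tendsto_V (h : GSol M Λ u) (hg : KB N g C) (y e : EN N) :
    Tendsto (fun r => V u g y r e) (nhdsWithin 0 (Ioi 0)) (nhds (mass N g * fderiv ℝ u y e)) := by
  have hdiff : DifferentiableAt ℝ u y := h.smooth.differentiable (by simp) y
  set L := fderiv ℝ u y
  have hkl : ∀ z, kl (hat g) e z = -fderiv ℝ (kr g) z e := klh_eq hg e
  have h0 : ∫ z, kl (hat g) e z = 0 := by
    simp only [hkl, integral_neg, integral_fderiv_ker hg.kr, neg_zero]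
  have h1 : ∫ z, L z * kl (hat g) e z = mass N g * L e := by
    simp only [hkl, mul_neg, integral_neg, integral_linear_mul_fderiv_ker hg.kr, mass]; ring
  have hV : ∀ r, 0 < r → V u g y r e = ∫ z, (r⁻¹ * (u (y + r • z) - u y)) * kl (hat g) e z := by
    intro r hr
    have i1 := integrable_z h.qg h.aesm (hg.klh e).continuous (hg.klh e).bound y hr
    have : ∫ z, (r⁻¹ * (u (y + r • z) - u y)) * kl (hat g) e z =
        r⁻¹ * ((∫ z, u (y + r • z) * kl (hat g) e z) - u y * ∫ z, kl (hat g) e z) := by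
      rw [← integral_const_mul (u y), ← integral_sub i1 ((hg.klh e).integrable.const_mul _),
        ← integral_const_mul]
      congr 1; ext z; ring
    rw [this, h0, V, I]; simp
  obtain ⟨c, hc⟩ := (hdiff.isBigO_sub).bound
  obtain ⟨ρ, hρ, hρc⟩ := Metric.eventually_nhds_iff.mp hc
  set B := |c| + M * (2 + 3 * ‖y‖ ^ 2) * ((ρ ^ 2)⁻¹ + 2) with hB
  have hM := h.M_nonneg
  have hbound : ∀ r, 0 < r → r ≤ 1 → ∀ z : EN N,
      |r⁻¹ * (u (y + r • z) - u y)| ≤ B * (1 + ‖z‖ ^ 2) := by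
    intro r hr hr1 z
    have hz1 : ‖z‖ ≤ 1 + ‖z‖ ^ 2 := by nlinarith [sq_nonneg (‖z‖ - 1), norm_nonneg z]
    rw [abs_mul, abs_of_pos (inv_pos.mpr hr), inv_mul_le_iff₀ hr]
    have hn : ‖r • z‖ = r * ‖z‖ := by rw [norm_smul, Real.norm_eq_abs, abs_of_pos hr]
    rcases lt_or_ge (r * ‖z‖) ρ with h2 | h2
    · have h3 := @hρc (y + r • z) (by rw [dist_eq_norm, add_sub_cancel_left, hn]; exact h2)
      rw [Real.norm_eq_abs, add_sub_cancel_left, hn] at h3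
      refine h3.trans ?_
      have h4 : c ≤ B := (le_abs_self c).trans (by rw [hB]; linarith [show 0 ≤ M * (2 + 3 * ‖y‖ ^ 2) * ((ρ ^ 2)⁻¹ + 2) by positivity])
      have hB0 : 0 ≤ B := by positivity
      calc c * (r * ‖z‖) ≤ B * (r * (1 + ‖z‖ ^ 2)) := by gcongr
        _ = _ := by ring
    · have h3 := h.growth (y + r • z)
      have h4 := h.growth y
      have h5 : ‖y + r • z‖ ≤ ‖y‖ + r * ‖z‖ := hn ▸ norm_add_le y (r • z)
      have h6 : ‖y + r • z‖ ^ 2 ≤ 2 * ‖y‖ ^ 2 + 2 * (r * ‖z‖) ^ 2 := by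
        nlinarith [norm_nonneg (y + r • z), sq_nonneg (‖y‖ - r * ‖z‖), norm_nonneg y]
      have h7 : 1 ≤ (ρ ^ 2)⁻¹ * (r * ‖z‖) ^ 2 := by
        rw [← div_eq_inv_mul, one_le_div (by positivity)]; gcongr
      have h8 : |u (y + r • z) - u y| ≤ M * (2 + 3 * ‖y‖ ^ 2 + 2 * (r * ‖z‖) ^ 2) := by
        refine (abs_sub _ _).trans ?_
        nlinarith
      have h9 : 2 + 3 * ‖y‖ ^ 2 + 2 * (r * ‖z‖) ^ 2 ≤
          (2 + 3 * ‖y‖ ^ 2) * (((ρ ^ 2)⁻¹ + 2) * (r * ‖z‖) ^ 2) := by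
        nlinarith [sq_nonneg ‖y‖, mul_nonneg (sq_nonneg ‖y‖) (sq_nonneg (r * ‖z‖)), sq_nonneg (r * ‖z‖)]
      have h10 : (r * ‖z‖) ^ 2 ≤ r * (1 + ‖z‖ ^ 2) := by
        nlinarith [mul_nonneg hr.le (sq_nonneg ‖z‖), sq_nonneg ‖z‖, mul_nonneg (mul_nonneg hr.le (sub_nonneg.mpr hr1)) (sq_nonneg ‖z‖)]
      calc _ ≤ M * ((2 + 3 * ‖y‖ ^ 2) * (((ρ ^ 2)⁻¹ + 2) * (r * ‖z‖) ^ 2)) :=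
            h8.trans (mul_le_mul_of_nonneg_left h9 hM)
        _ ≤ M * ((2 + 3 * ‖y‖ ^ 2) * (((ρ ^ 2)⁻¹ + 2) * (r * (1 + ‖z‖ ^ 2)))) := by gcongr
        _ = r * ((M * (2 + 3 * ‖y‖ ^ 2) * ((ρ ^ 2)⁻¹ + 2)) * (1 + ‖z‖ ^ 2)) := by ring
        _ ≤ _ := by
          have : M * (2 + 3 * ‖y‖ ^ 2) * ((ρ ^ 2)⁻¹ + 2) ≤ B := by rw [hB]; linarith [abs_nonneg c]
          gcongr
  rw [← h1]
  have hT : Tendsto (fun r => ∫ z, (r⁻¹ * (u (y + r • z) - u y)) * kl (hat g) e z)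
      (nhdsWithin 0 (Ioi 0)) (nhds (∫ z, L z * kl (hat g) e z)) := by
    refine tendsto_integral_filter_of_dominated_convergence
      (fun z => (B * (C * ‖e‖)) * ((1 + ‖z‖ ^ 2) * wt z)) ?_ ?_ (integrable_W1.const_mul _) ?_
    · refine Eventually.of_forall fun r => Continuous.aestronglyMeasurable ?_
      have := h.continuous
      exact (continuous_const.mul ((this.comp (by fun_prop)).sub continuous_const)).mul
        (hg.klh e).continuous
    · filter_upwards [Ioo_mem_nhdsGT (zero_lt_one' ℝ)] with r hr
      refine Eventually.of_forall fun z => ?_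
      rw [Real.norm_eq_abs]
      refine (abs_mul_le_of (hbound r hr.1 hr.2.le z) ((hg.klh e).bound z)).trans_eq ?_
      ring
    · refine Eventually.of_forall fun z => Tendsto.mul_const _ ?_
      have h2 : HasDerivAt (fun r : ℝ => u (y + r • z)) (L z) 0 := by
        have h1 : HasDerivAt (fun t : ℝ => y + t • z) z 0 := by
          simpa using ((hasDerivAt_id (0 : ℝ)).smul_const z).const_add y
        have h3 : HasFDerivAt u L (y + (0 : ℝ) • z) := by simpa using hdiff.hasFDerivAt
        exact h3.comp_hasDerivAt 0 h1
      have h3 := h2.tendsto_slope_zero_right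
      simpa using h3
  refine hT.congr' ?_
  filter_upwards [self_mem_nhdsWithin] with r hr using (hV r hr).symm

theorem GSol.abs_V_sub_le (h : GSol M Λ u) (hg : KB N g C) (y e : EN N) {r : ℝ} (hr : 0 < r) :
    |V u g y r e - mass N g * fderiv ℝ u y e| ≤ (C * W1 N) * (r * ‖e‖) := by
  have hb : ∀ s, 0 < s → |I (om Λ) (kl g e) y s| ≤ C * ‖e‖ * W1 N := fun s hs => by
    have := abs_I_le (u := om Λ) (y := y) (r := s) (B := 1) (fun z => by
        rw [abs_of_nonneg (om_nonneg _ _)]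
        nlinarith [om_le_one Λ (y + s • z), sq_nonneg ‖z‖]) (hg.kl e).bound
    simpa using this
  have hC := hg.nonneg
  have hW := W1_nonneg N
  have h1 : ∀ s, 0 < s → s < r → |V u g y r e - V u g y s e| ≤ (C * W1 N) * (r * ‖e‖) := by
    intro s hs hsr
    have := (convex_Ioi (0 : ℝ)).norm_image_sub_le_of_norm_hasDerivWithin_le
      (f := fun r => V u g y r e) (C := C * ‖e‖ * W1 N) 
      (fun t ht => (h.hasDerivAt_V hg y e ht).hasDerivWithinAt)
      (fun t ht => by rw [Real.norm_eq_abs]; exact hb t ht) (x := s) (y := r) hs hr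
    rw [Real.norm_eq_abs, Real.norm_eq_abs, abs_of_pos (a := r - s) (by linarith)] at this
    refine this.trans ?_
    calc C * ‖e‖ * W1 N * (r - s) ≤ C * ‖e‖ * W1 N * r := by gcongr; linarith
      _ = _ := by ring
  have t : Tendsto (fun s => |V u g y r e - V u g y s e|) (nhdsWithin 0 (Ioi 0))
      (nhds |V u g y r e - mass N g * fderiv ℝ u y e|) :=
    ((h.tendsto_V hg y e).const_sub _).abs
  refine le_of_tendsto t ?_
  filter_upwards [Ioo_mem_nhdsGT hr] with s hs using h1 s hs.1 hs.2

end GlobalSol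

namespace GlobalSol
variable {N : ℕ}

/-- The polynomially decaying profile. -/
def phi (N : ℕ) (σ : ℝ) : ℝ := ((1 + σ) ^ (N + 8))⁻¹

theorem prof_phi (N : ℕ) : Prof (N + 8) (phi N) := by
  refine ⟨?_, fun i => ?_⟩
  · refine ContDiffOn.inv (ContDiff.contDiffOn (by fun_prop)) fun σ hσ => ?_
    have : 0 < 1 + σ := by have := mem_Ioi.1 hσ; linarith
    positivity
  · have e : phi N = fun σ => (fun s : ℝ => s ^ (-((N + 8 : ℕ) : ℤ))) (1 + σ) := by
      funext σ; simp only [phi, zpow_neg, zpow_natCast]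
    refine ⟨|∏ j ∈ Finset.range i, (((-((N + 8 : ℕ) : ℤ) : ℤ) : ℝ) - j)|, fun σ hσ => ?_⟩
    rw [e, congr_fun (iteratedDeriv_comp_const_add i (fun s : ℝ => s ^ (-((N + 8 : ℕ) : ℤ))) 1) σ, iteratedDeriv_eq_iterate]
    simp only [iter_deriv_zpow]
    rw [abs_mul]
    refine mul_le_mul_of_nonneg_left ?_ (abs_nonneg _)
    have h1 : (1 : ℝ) ≤ 1 + σ := by linarith
    rw [abs_of_nonneg (by positivity), ← zpow_natCast, ← zpow_neg]
    exact zpow_le_zpow_right₀ h1 (by omega)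

theorem deriv_phi (N : ℕ) {σ : ℝ} (hσ : 0 ≤ σ) :
    deriv (phi N) σ = -((N + 8 : ℝ) * phi N σ / (1 + σ)) := by
  have h1 : (1 : ℝ) + σ ≠ 0 := by linarith
  have h2 : HasDerivAt (fun σ : ℝ => 1 + σ) 1 σ := (hasDerivAt_id σ).const_add 1
  have := (h2.pow (N + 8)).inv (pow_ne_zero _ h1)
  have e : phi N = (((fun σ : ℝ => 1 + σ) ^ (N + 8) : ℝ → ℝ))⁻¹ := by
    funext σ; simp [phi]
  rw [e, this.deriv]
  simp only [Pi.pow_apply, Pi.inv_apply]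
  have : N + 8 - 1 = N + 7 := by omega
  rw [this]
  field_simp
  push_cast
  ring

theorem phi_pos (N : ℕ) {σ : ℝ} (hσ : 0 ≤ σ) : 0 < phi N σ := by
  unfold phi; positivity

/-- The compactly supported profile. -/
def bet (σ : ℝ) : ℝ := Real.smoothTransition (1 - σ)

theorem contDiff_bet : ContDiff ℝ (⊤ : ℕ∞) bet :=
  Real.smoothTransition.contDiff.comp (contDiff_const.sub contDiff_id)

theorem bet_nonneg (σ : ℝ) : 0 ≤ bet σ := Real.smoothTransition.nonneg _
theorem bet_le_one (σ : ℝ) : bet σ ≤ 1 := Real.smoothTransition.le_one _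
theorem bet_eq_zero {σ : ℝ} (h : 1 ≤ σ) : bet σ = 0 :=
  Real.smoothTransition.zero_of_nonpos (by linarith)
theorem bet_pos {σ : ℝ} (h : σ < 1) : 0 < bet σ :=
  Real.smoothTransition.pos_of_pos (by linarith)
theorem bet_antitone : Antitone bet := fun a b h =>
  Real.smoothTransition.monotone (by linarith)

theorem deriv_bet_nonpos (σ : ℝ) : deriv bet σ ≤ 0 := bet_antitone.deriv_nonpos

theorem prof_bet (N : ℕ) : Prof (N + 8) bet := by
  refine ⟨contDiff_bet.contDiffOn, fun i => ?_⟩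
  have hc : Continuous (iteratedDeriv i bet) :=
    contDiff_bet.continuous_iteratedDeriv i (by exact_mod_cast le_top)
  obtain ⟨C, hC⟩ := (isCompact_Icc (a := (0 : ℝ)) (b := 1)).exists_bound_of_continuousOn
    hc.continuousOn
  have hC0 : 0 ≤ C := (norm_nonneg _).trans (hC 0 (by simp))
  refine ⟨C * 2 ^ (N + 8), fun σ hσ => ?_⟩
  rcases le_or_gt σ 1 with h | h
  · have h1 : (1 : ℝ) ≤ 2 ^ (N + 8) * ((1 + σ) ^ (N + 8))⁻¹ := by
      rw [← div_eq_mul_inv, one_le_div (by positivity)]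
      gcongr; linarith
    have := hC σ ⟨hσ, h⟩
    rw [Real.norm_eq_abs] at this
    rw [mul_assoc]
    exact this.trans (le_mul_of_one_le_right hC0 h1)
  · have : bet =ᶠ[nhds σ] fun _ => 0 := by
      filter_upwards [lt_mem_nhds h] with x hx using bet_eq_zero (le_of_lt hx)
    rw [this.iteratedDeriv_eq]
    simp only [iteratedDeriv_const]
    split_ifs <;> simp <;> positivity

theorem Prof.mass_pos {g : ℝ → ℝ} {C : ℝ} (h : KB N g C) (h0 : ∀ σ, 0 ≤ σ → 0 ≤ g σ)
    (h1 : 0 < g 0) : 0 < mass N g := by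
  refine (integral_pos_iff_support_of_nonneg (fun z => h0 _ (sq_nonneg _)) h.kr.integrable).2 ?_
  refine (h.kr.continuous.isOpen_support).measure_pos _ ⟨0, ?_⟩
  simp [kr, h1.ne']

/-- A fixed kernel bound for `phi`. -/
def Cφ (N : ℕ) : ℝ := (prof_phi N).exists_KB.choose
/-- A fixed kernel bound for `bet`. -/
def Cβ (N : ℕ) : ℝ := (prof_bet N).exists_KB.choose
theorem KBφ (N : ℕ) : KB N (phi N) (Cφ N) := (prof_phi N).exists_KB.choose_spec
theorem KBβ (N : ℕ) : KB N bet (Cβ N) := (prof_bet N).exists_KB.choose_spec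

/-- The mass of the profile `phi`. -/
abbrev c0 (N : ℕ) : ℝ := mass N (phi N)

theorem c0_pos (N : ℕ) : 0 < c0 N :=
  Prof.mass_pos (KBφ N) (fun _ h => (phi_pos N h).le) (phi_pos N le_rfl)

theorem massβ_pos (N : ℕ) : 0 < mass N bet :=
  Prof.mass_pos (KBβ N) (fun σ _ => bet_nonneg σ) (bet_pos zero_lt_one)

end GlobalSol

namespace GlobalSol
variable {N : ℕ}

/-- Positive semidefinite symmetric bilinear forms. -/
structure PSD (B : EN N → EN N → ℝ) : Prop where
  left : ∀ (a b : ℝ) (e e' f : EN N), B (a • e + b • e') f = a * B e f + b * B e' f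
  symm : ∀ e f, B e f = B f e
  nonneg : ∀ e, 0 ≤ B e e

theorem PSD.right {B : EN N → EN N → ℝ} (h : PSD B) (a b : ℝ) (e e' f : EN N) :
    B f (a • e + b • e') = a * B f e + b * B f e' := by
  rw [h.symm, h.left, h.symm e, h.symm e']

theorem PSD.cauchy {B : EN N → EN N → ℝ} (h : PSD B) (e f : EN N) :
    B e f ^ 2 ≤ B e e * B f f := by
  have key : ∀ t : ℝ, 0 ≤ B f f * (t * t) + 2 * B e f * t + B e e := fun t => by
    have := h.nonneg ((1 : ℝ) • e + t • f)
    rw [h.left, h.right, h.right, h.symm f e] at this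
    linarith
  have := discrim_le_zero key
  unfold discrim at this
  nlinarith

theorem PSD.sum_right {B : EN N → EN N → ℝ} (h : PSD B) (f g : EN N) :
    B f g = ∑ i, g i * B f (EuclideanSpace.single i 1) := by
  let L : EN N →ₗ[ℝ] ℝ :=
    { toFun := B f
      map_add' := fun a b => by simpa using h.right 1 1 a b f
      map_smul' := fun c a => by simpa using h.right c 0 a 0 f }
  have hg : g = ∑ i, g i • EuclideanSpace.single i (1 : ℝ) := by
    simpa using ((EuclideanSpace.basisFun (Fin N) ℝ).sum_repr g).symm
  calc B f g = L g := rfl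
    _ = L (∑ i, g i • EuclideanSpace.single i (1 : ℝ)) := by rw [← hg]
    _ = ∑ i, g i * B f (EuclideanSpace.single i 1) := by rw [map_sum]; simp [L]

theorem PSD.le_trace {B : EN N → EN N → ℝ} (h : PSD B) (f : EN N) :
    B f f ≤ (∑ i, B (EuclideanSpace.single i 1) (EuclideanSpace.single i 1)) * ‖f‖ ^ 2 := by
  have h1 : B f f ^ 2 ≤ ‖f‖ ^ 2 * ∑ i, B f (EuclideanSpace.single i 1) ^ 2 := by
    rw [h.sum_right f f, EuclideanSpace.norm_sq_eq]
    simpa using Finset.sum_mul_sq_le_sq_mul_sq Finset.univ (fun i => f i)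
      (fun i => B f (EuclideanSpace.single i 1))
  have h2 : ∑ i, B f (EuclideanSpace.single i 1) ^ 2 ≤
      B f f * ∑ i, B (EuclideanSpace.single i 1) (EuclideanSpace.single i 1) := by
    rw [Finset.mul_sum]
    exact Finset.sum_le_sum fun i _ => h.cauchy _ _
  have h3 : 0 ≤ ∑ i, B (EuclideanSpace.single i 1) (EuclideanSpace.single i 1) :=
    Finset.sum_nonneg fun i _ => h.nonneg _
  rcases (h.nonneg f).eq_or_lt with h0 | h0
  · rw [← h0]; positivity
  · have : B f f * B f f ≤ B f f *
        ((∑ i, B (EuclideanSpace.single i 1) (EuclideanSpace.single i 1)) * ‖f‖ ^ 2) := by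
      nlinarith [mul_le_mul_of_nonneg_left h2 (sq_nonneg ‖f‖)]
    exact le_of_mul_le_mul_left this h0

variable {M : ℝ} {Λ : Set (EN N)} {u : EN N → ℝ} {g : ℝ → ℝ} {C : ℝ}

theorem GSol.trace_bounds (hΛ : IsClosed Λ) (hg : KB N g C)
    (g0 : ∀ σ, 0 ≤ σ → 0 ≤ g σ) (y : EN N) {r : ℝ} (hr : 0 < r) :
    0 ≤ I (om Λ) (kr g) y r ∧ I (om Λ) (kr g) y r ≤ mass N g := by
  have hk : ∀ z : EN N, 0 ≤ kr g z := fun z => g0 _ (sq_nonneg _)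
  refine ⟨integral_nonneg fun z => mul_nonneg (om_nonneg _ _) (hk z), ?_⟩
  refine integral_mono (integrable_z (QG_om Λ) (aesm_om hΛ) hg.kr.continuous hg.kr.bound y hr)
    hg.kr.integrable fun z => ?_
  exact mul_le_of_le_one_left (hk z) (om_le_one _ _)

theorem GSol.A_smul (h : GSol M Λ u) (hg : KB N g C) (y : EN N) {r : ℝ} (hr : 0 < r)
    (a b : ℝ) (e f : EN N) : A u g y r (a • e) (b • f) = a * b * A u g y r e f := by
  have h1 := h.A_left hg y hr a 0 e 0 (b • f)
  have h2 := h.A_right hg y hr b 0 f 0 e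
  simp only [zero_smul, add_zero, zero_mul] at h1 h2
  rw [h1, h2]; ring

theorem exists_unit (e : EN N) (he : e ≠ 0) : ∃ v : EN N, ‖v‖ = 1 ∧ e = ‖e‖ • v := by
  refine ⟨‖e‖⁻¹ • e, ?_, ?_⟩
  · rw [norm_smul, norm_inv, norm_norm, inv_mul_cancel₀ (norm_ne_zero_iff.2 he)]
  · rw [smul_smul, mul_inv_cancel₀ (norm_ne_zero_iff.2 he), one_smul]

theorem GSol.psd (h : GSol M Λ u) (hg : KB N g C) (y : EN N) {r : ℝ} (hr : 0 < r) {l : ℝ}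
    (hl : ∀ v, ‖v‖ = 1 → -l ≤ A u g y r v v) :
    PSD (fun e f => A u g y r e f + l * ⟪e, f⟫) where
  left a b e e' f := by
    rw [h.A_left hg y hr, inner_add_left, real_inner_smul_left, real_inner_smul_left]; ring
  symm e f := by rw [A_symm, real_inner_comm]
  nonneg e := by
    rcases eq_or_ne e 0 with rfl | he
    · have := h.A_smul hg y hr 0 0 (0 : EN N) 0
      simp only [smul_zero, zero_mul] at this
      simp [this]
    · obtain ⟨v, hv, hev⟩ := exists_unit e he
      rw [hev, h.A_smul hg y hr, real_inner_smul_left, real_inner_smul_right,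
        real_inner_self_eq_norm_sq, hv]
      nlinarith [hl v hv, mul_self_nonneg ‖e‖]

theorem GSol.psd_trace (h : GSol M Λ u) (hg : KB N g C) (g0 : ∀ σ, 0 ≤ σ → 0 ≤ g σ)
    (y : EN N) {r : ℝ} (hr : 0 < r) {l : ℝ} (hl : ∀ v, ‖v‖ = 1 → -l ≤ A u g y r v v) (f : EN N) :
    A u g y r f f + l * ⟪f, f⟫ ≤ (mass N g + N * l) * ‖f‖ ^ 2 := by
  refine ((h.psd hg y hr hl).le_trace f).trans
    (mul_le_mul_of_nonneg_right ?_ (sq_nonneg _))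
  rw [Finset.sum_add_distrib, h.sum_A hg y hr]
  have := (GSol.trace_bounds h.closed hg g0 y hr).2
  simp
  linarith

/-- The slab half-width. -/
def dz (N : ℕ) : ℝ := 1 / (2 * (N + 8))

theorem dz_pos (N : ℕ) : 0 < dz N := by unfold dz; positivity
theorem dz_le (N : ℕ) : dz N ≤ 1 / 16 := by
  unfold dz
  refine one_div_le_one_div_of_le (by norm_num) ?_
  have : (0 : ℝ) ≤ N := N.cast_nonneg
  linarith
theorem dz_sq (N : ℕ) : 2 * (N + 8) * dz N ^ 2 ≤ 1 := by
  have h : 2 * ((N : ℝ) + 8) * dz N = 1 := by unfold dz; field_simp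
  have := dz_le N
  nlinarith [dz_pos N]

/-- `Λ` lies in a thin slab around `y` at scale `r`. -/
def Thin (Λ : Set (EN N)) (y : EN N) (r : ℝ) (e : EN N) : Prop :=
  ∀ z ∈ Λ, ‖z - y‖ ≤ r → |⟪z - y, e⟫| ≤ dz N * r

/-- `Λ` is asymptotically dense at `y`. -/
def Dp (Λ : Set (EN N)) (y : EN N) : Prop :=
  ∀ ε > 0, ∃ h0 > 0, ∀ h, 0 < h → h < h0 → ∀ p, ‖p - y‖ ≤ h → ∃ z ∈ Λ, ‖z - p‖ < ε * h

theorem Dp.not_thin {y : EN N} (h : Dp Λ y) :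
    ∃ h0 > 0, ∀ r, 0 < r → r < h0 → ∀ e : EN N, ‖e‖ = 1 → ¬ Thin Λ y r e := by
  obtain ⟨h0, h0p, hh⟩ := h (1 / 4) (by norm_num)
  refine ⟨h0, h0p, fun r hr hr0 e he ht => ?_⟩
  obtain ⟨z, hz, hzp⟩ := hh (r / 2) (by linarith) (by linarith) (y + (r / 2) • e)
    (by simp [norm_smul, he, abs_of_pos hr])
  have e1 : z - y = (r / 2) • e + (z - (y + (r / 2) • e)) := by abel
  have n1 : ‖(r / 2) • e‖ = r / 2 := by simp [norm_smul, he, abs_of_pos hr]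
  have n2 : ‖z - y‖ ≤ r := by
    rw [e1]; refine (norm_add_le _ _).trans ?_; rw [n1]; linarith
  have n3 := ht z hz n2
  have n4 : ⟪z - y, e⟫ = r / 2 + ⟪z - (y + (r / 2) • e), e⟫ := by
    rw [e1, inner_add_left, real_inner_smul_left, real_inner_self_eq_norm_sq, he]; ring
  have n5 := abs_real_inner_le_norm (z - (y + (r / 2) • e)) e
  rw [he, mul_one] at n5
  have := dz_le N
  have := (abs_le.1 n5).1
  have := (abs_le.1 n3).2
  nlinarith

/-- The loss constant in the persistence lemma. -/
def Cω (N : ℕ) : ℝ := Cφ N * W1 N / 2 + 1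

theorem Cω_pos (N : ℕ) : 0 < Cω N := by
  have := mul_nonneg (KBφ N).nonneg (W1_nonneg N)
  unfold Cω; linarith

theorem neg_kq_phi_nonneg {e z : EN N} (he : ‖e‖ = 1)
    (hz : ⟪z, e⟫ ^ 2 ≤ dz N ^ 2 * (1 + ‖z‖ ^ 2)) : 0 ≤ -kq (phi N) e e z := by
  have hp := phi_pos N (sq_nonneg ‖z‖)
  have h1 := one_add_pos z
  unfold kq
  rw [deriv_phi N (sq_nonneg _), real_inner_self_eq_norm_sq, he, neg_neg]
  have e1 : (1 : ℝ) ^ 2 * phi N (‖z‖ ^ 2) + 2 * (⟪z, e⟫ * ⟪z, e⟫ *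
      -((N + 8 : ℝ) * phi N (‖z‖ ^ 2) / (1 + ‖z‖ ^ 2))) =
      phi N (‖z‖ ^ 2) / (1 + ‖z‖ ^ 2) * (1 + ‖z‖ ^ 2 - 2 * (N + 8) * ⟪z, e⟫ ^ 2) := by
    field_simp
    ring
  rw [e1]
  refine mul_nonneg (by positivity) ?_
  have h2 : 2 * ((N : ℝ) + 8) * ⟪z, e⟫ ^ 2 ≤ 2 * (N + 8) * (dz N ^ 2 * (1 + ‖z‖ ^ 2)) :=
    mul_le_mul_of_nonneg_left hz (by positivity)
  nlinarith [dz_sq N]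

theorem GSol.deriv_lower {y e : EN N} (he : ‖e‖ = 1) {r r0 : ℝ}
    (hr : 0 < r) (hr0 : 0 < r0) (ht : ∀ ρ, r ≤ ρ → ρ ≤ r0 → Thin Λ y ρ e) (hrr : r ≤ r0) :
    -(Cφ N * W1 N * (r / r0) ^ 2) ≤ -I (la Λ) (kq (phi N) e e) y r := by
  have hK := (KBφ N).kq e e
  rw [he, mul_one, mul_one] at hK
  have hC := hK.nonneg
  rw [← I_neg_kernel]
  have hb : ∀ z : EN N, -(Cφ N * (r / r0) ^ 2 * ((1 + ‖z‖ ^ 2) * wt z)) ≤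
      la Λ (y + r • z) * -kq (phi N) e e z := fun z => by
    have hn : -(Cφ N * (r / r0) ^ 2 * ((1 + ‖z‖ ^ 2) * wt z)) ≤ 0 := by
      have := wt_pos z
      have := one_add_pos z
      rw [neg_nonpos]; positivity
    by_cases hz : y + r • z ∈ Λ
    · rw [la_of_mem hz, one_mul]
      rcases le_or_gt ‖r • z‖ r0 with h1 | h1
      · refine hn.trans (neg_kq_phi_nonneg he ?_)
        have h2 := ht (max ‖r • z‖ r) (le_max_right _ _) (max_le h1 hrr) _ hz
          (by simp)
        rw [add_sub_cancel_left, real_inner_smul_left, norm_smul, Real.norm_eq_abs,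
          abs_of_pos hr, abs_mul, abs_of_pos hr] at h2
        have h3 : max (r * ‖z‖) r = r * max ‖z‖ 1 := by
          rw [mul_max_of_nonneg _ _ hr.le, mul_one]
        rw [h3] at h2
        have h4 : |⟪z, e⟫| ≤ dz N * max ‖z‖ 1 := by
          refine le_of_mul_le_mul_left ?_ hr
          linarith
        have h5 : max ‖z‖ 1 ^ 2 ≤ 1 + ‖z‖ ^ 2 := by
          rcases le_total ‖z‖ 1 with h | h
          · rw [max_eq_right h]; nlinarith [sq_nonneg ‖z‖]
          · rw [max_eq_left h]; linarith
        rw [← sq_abs]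
        calc |⟪z, e⟫| ^ 2 ≤ (dz N * max ‖z‖ 1) ^ 2 := by gcongr
          _ = dz N ^ 2 * max ‖z‖ 1 ^ 2 := by ring
          _ ≤ _ := by gcongr
      · rw [norm_smul, Real.norm_eq_abs, abs_of_pos hr] at h1
        have h2 : 1 ≤ (r / r0) ^ 2 * (1 + ‖z‖ ^ 2) := by
          have h3 : 1 ≤ r / r0 * ‖z‖ := by
            rw [div_mul_eq_mul_div, one_le_div hr0]; exact h1.le
          nlinarith [sq_nonneg (r / r0)]
        have h3 := (abs_le.1 (hK.bound z)).2
        have h4 : Cφ N * wt z ≤ Cφ N * wt z * ((r / r0) ^ 2 * (1 + ‖z‖ ^ 2)) :=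
          le_mul_of_one_le_right (mul_nonneg hC (wt_pos z).le) h2
        linarith
    · rw [la_of_notMem hz, zero_mul]; exact hn
  have hbi : Integrable (fun z : EN N => -(Cφ N * (r / r0) ^ 2 * ((1 + ‖z‖ ^ 2) * wt z))) :=
    (integrable_W1.const_mul _).neg
  by_cases hi : Integrable (fun z => la Λ (y + r • z) * -kq (phi N) e e z)
  · have := integral_mono hbi hi hb
    rw [integral_neg, integral_const_mul] at this
    have e1 : Cφ N * W1 N * (r / r0) ^ 2 = Cφ N * (r / r0) ^ 2 * W1 N := by ring
    rw [e1]; exact this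
  · have : I (la Λ) (fun z => -kq (phi N) e e z) y r = 0 := integral_undef hi
    rw [this, neg_nonpos]
    exact mul_nonneg (mul_nonneg hC (W1_nonneg N)) (sq_nonneg _)

theorem GSol.persist (h : GSol M Λ u) {y e : EN N} (he : ‖e‖ = 1) {l r0 t0 : ℝ} (ht0 : 0 < t0)
    (ht : t0 ≤ r0)
    (hthin : ∀ r, 0 < r → r ≤ r0 → A u (phi N) y r e e ≤ l → Thin Λ y r e)
    (hA : ∀ r, t0 ≤ r → r ≤ r0 → A u (phi N) y r e e ≤ l)
    (hAt : A u (phi N) y t0 e e ≤ l - Cω N * (t0 / r0) ^ 2) :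
    ∀ r, 0 < r → r ≤ t0 → A u (phi N) y r e e ≤ l := by
  intro r1 hr1 hr1t
  by_contra hcon
  push Not at hcon
  have hr0 : 0 < r0 := ht0.trans_le ht
  have hcont : ∀ r, 0 < r → ContinuousAt (fun r => A u (phi N) y r e e) r := fun r hr =>
    (h.hasDerivAt_A' (KBφ N) y e e hr).continuousAt
  have hS : IsCompact (Icc r1 t0 ∩ {s | l ≤ A u (phi N) y s e e}) := by
    have : IsClosed (Icc r1 t0 ∩ {s | l ≤ A u (phi N) y s e e}) := by
      have hco : ContinuousOn (fun r => A u (phi N) y r e e) (Icc r1 t0) := fun s hs =>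
        (hcont s (hr1.trans_le hs.1)).continuousWithinAt
      exact hco.preimage_isClosed_of_isClosed isClosed_Icc isClosed_Ici
    exact isCompact_Icc.of_isClosed_subset this inter_subset_left
  obtain ⟨s, ⟨⟨hs1, hs2⟩, hs3⟩, hsmax⟩ := hS.exists_isGreatest ⟨r1, ⟨le_rfl, hr1t⟩, hcon.le⟩
  have hs0 : 0 < s := hr1.trans_le hs1
  have hless : ∀ r, s < r → r ≤ r0 → A u (phi N) y r e e ≤ l := fun r hsr hrr => by
    rcases le_total r t0 with h1 | h1
    · by_contra h2
      push Not at h2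
      exact absurd (hsmax ⟨⟨hs1.trans hsr.le, h1⟩, h2.le⟩) (not_le.2 hsr)
    · exact hA r h1 hrr
  obtain ⟨K, hK⟩ : ∃ K, K = Cφ N * W1 N := ⟨_, rfl⟩
  have hmono : MonotoneOn (fun r => A u (phi N) y r e e + K / (2 * r0 ^ 2) * r ^ 2) (Icc s t0) := by
    refine monotoneOn_of_deriv_nonneg (convex_Icc _ _) ?_ ?_ ?_
    · exact fun r hr => ((hcont r (hs0.trans_le hr.1)).add (by fun_prop)).continuousWithinAt
    · rw [interior_Icc]
      intro r hr
      refine ((h.hasDerivAt_A' (KBφ N) y e e (hs0.trans hr.1)).differentiableAt.add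
        (by fun_prop)).differentiableWithinAt
    · rw [interior_Icc]
      intro r hr
      have hrp := hs0.trans hr.1
      have hd : HasDerivAt (fun r => A u (phi N) y r e e + K / (2 * r0 ^ 2) * r ^ 2) _ r :=
        (h.hasDerivAt_A' (KBφ N) y e e hrp).add
          (((hasDerivAt_pow 2 r)).const_mul (K / (2 * r0 ^ 2)))
      rw [hd.deriv]
      have hl := GSol.deriv_lower (Λ := Λ) (y := y) he hrp hr0 (fun ρ h1 h2 =>
        hthin ρ (hrp.trans_le h1) h2 (hless ρ (hr.1.trans_le h1) h2)) (hr.2.le.trans ht)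
      rw [← hK] at hl
      have h2 := mul_le_mul_of_nonneg_left hl (inv_nonneg.2 hrp.le)
      have e1 : r⁻¹ * -(K * (r / r0) ^ 2) = -(K / (2 * r0 ^ 2) * (2 * r)) := by
        field_simp
      rw [e1] at h2
      have e2 : K / (2 * r0 ^ 2) * (((2 : ℕ) : ℝ) * r ^ (2 - 1)) = K / (2 * r0 ^ 2) * (2 * r) := by
        norm_num
      rw [e2]
      linarith
  have := hmono ⟨le_rfl, hs2⟩ ⟨hs2, le_rfl⟩ hs2
  simp only at this
  have hK0 : 0 ≤ K := hK ▸ mul_nonneg (KBφ N).nonneg (W1_nonneg N)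
  have e1 : Cω N * (t0 / r0) ^ 2 = K / (2 * r0 ^ 2) * t0 ^ 2 + (t0 / r0) ^ 2 := by
    rw [Cω, ← hK]; field_simp
  have e2 : 0 < (t0 / r0) ^ 2 := by positivity
  have e3 : 0 ≤ K / (2 * r0 ^ 2) * s ^ 2 := by positivity
  have hs3' : l ≤ A u (phi N) y s e e := hs3
  linarith

end GlobalSol

namespace GlobalSol
variable {N : ℕ}
variable {M : ℝ} {Λ : Set (EN N)} {u : EN N → ℝ} {g : ℝ → ℝ} {C : ℝ}

theorem GSol.abs_A_contact (h : GSol M Λ u) (hg : KB N g C) {y z e : EN N} (hy : y ∈ Λ)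
    (hz : z ∈ Λ) (he : ‖e‖ = 1) {s : ℝ} (hs : 0 < s) :
    ∃ t ∈ Ioo (0 : ℝ) 1, |A u g (y + t • (z - y)) s e (z - y)| ≤ 2 * (C * W1 N) * s := by
  obtain ⟨t, ht, hV⟩ := h.V_sub hg y z e hs
  refine ⟨t, ht, ?_⟩
  rw [← hV]
  have h1 := h.abs_V_sub_le hg y e hs
  have h2 := h.abs_V_sub_le hg z e hs
  rw [(h.zero y hy).2] at h1
  rw [(h.zero z hz).2] at h2
  simp only [zero_apply, mul_zero, sub_zero, he, mul_one] at h1 h2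
  have := abs_sub (V u g z s e) (V u g y s e)
  linarith

/-- Constant for the contact estimate. -/
def C7 (N : ℕ) : ℝ := 2 * (Cφ N * W1 N) + 2 * Cφ N * 9 ^ (N + 6) * W1 N

theorem GSol.abs_A_contact' (h : GSol M Λ u) {y z e : EN N} (hy : y ∈ Λ)
    (hz : z ∈ Λ) (he : ‖e‖ = 1) {r : ℝ} (hr : 0 < r) (hzr : ‖z - y‖ ≤ r) :
    |A u (phi N) y r e (z - y)| ≤ C7 N * r := by
  obtain ⟨t, ht, hA⟩ := h.abs_A_contact (KBφ N) hy hz he hr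
  have hd : ‖y + t • (z - y) - y‖ ≤ 2 * r := by
    rw [add_sub_cancel_left, norm_smul, Real.norm_eq_abs, abs_of_pos ht.1]
    nlinarith [norm_nonneg (z - y), ht.1, ht.2]
  have h1 := h.abs_A_sub_le (KBφ N) e (z - y) hr hd
  rw [he, one_mul] at h1
  have hc : 0 ≤ 2 * Cφ N * 9 ^ (N + 6) * W1 N := by
    have := (KBφ N).nonneg
    have := W1_nonneg N
    positivity
  have h2 := mul_le_mul_of_nonneg_left hzr hc
  have h3 := abs_sub_abs_le_abs_sub (A u (phi N) y r e (z - y))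
    (A u (phi N) (y + t • (z - y)) r e (z - y))
  rw [abs_sub_comm] at h3
  unfold C7
  linarith

/-- Threshold constant for the lower bound at dense contact points. -/
def KK (N : ℕ) : ℝ := max 1 (max (2 * C7 N / dz N) (4 * (1 + Cω N) * (c0 N + N) / dz N ^ 2))

theorem GSol.thin_of_le (h : GSol M Λ u) {y e : EN N} (hy : y ∈ Λ) (he : ‖e‖ = 1) {r l : ℝ}
    (hr : 0 < r) (hlK : KK N ≤ l) (hl : ∀ v, ‖v‖ = 1 → -l ≤ A u (phi N) y r v v)
    (hAe : A u (phi N) y r e e ≤ -l + (1 + Cω N)) : Thin Λ y r e := by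
  intro z hz hzr
  have hd := dz_pos N
  have l1 : 1 ≤ l := (le_max_left _ _).trans hlK
  have l2 : 2 * C7 N ≤ l * dz N := by
    rw [← div_le_iff₀ hd]
    exact ((le_max_left _ _).trans (le_max_right _ _)).trans hlK
  have l3 : 4 * (1 + Cω N) * (c0 N + N) ≤ l * dz N ^ 2 := by
    rw [← div_le_iff₀ (by positivity)]
    exact ((le_max_right _ _).trans (le_max_right _ _)).trans hlK
  have hc := (h.psd (KBφ N) y hr hl).cauchy e (z - y)
  have hB1 : A u (phi N) y r e e + l * ⟪e, e⟫ ≤ 1 + Cω N := by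
    rw [real_inner_self_eq_norm_sq, he]; linarith
  have hB2 := h.psd_trace (KBφ N) (fun σ hσ => (phi_pos N hσ).le) y hr hl (z - y)
  have hB0 := (h.psd (KBφ N) y hr hl).nonneg e
  have hB3 := (h.psd (KBφ N) y hr hl).nonneg (z - y)
  have hA := h.abs_A_contact' hy hz he hr hzr
  have hω := Cω_pos N
  have hc0 := c0_pos N
  have hN : (0 : ℝ) ≤ N := N.cast_nonneg
  obtain ⟨a, ha⟩ : ∃ a, a = A u (phi N) y r e (z - y) := ⟨_, rfl⟩
  obtain ⟨b, hb⟩ : ∃ b, b = ⟪e, z - y⟫ := ⟨_, rfl⟩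
  rw [← ha] at hA hc
  rw [← hb] at hc
  have h1 : (a + l * b) ^ 2 ≤ (l * dz N / 2 * r) ^ 2 := by
    have hT : mass N (phi N) + N * l ≤ l * (c0 N + N) := by
      have : c0 N ≤ l * c0 N := le_mul_of_one_le_left hc0.le l1
      show c0 N + N * l ≤ _
      linarith
    have hr2 : ‖z - y‖ ^ 2 ≤ r ^ 2 := by gcongr
    calc (a + l * b) ^ 2 ≤ _ := hc
      _ ≤ (1 + Cω N) * (l * (c0 N + N) * r ^ 2) := by
          refine mul_le_mul hB1 (hB2.trans ?_) hB3 (by linarith)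
          exact mul_le_mul hT hr2 (sq_nonneg _) (by positivity)
      _ = (4 * (1 + Cω N) * (c0 N + N)) * (l * r ^ 2 / 4) := by ring
      _ ≤ (l * dz N ^ 2) * (l * r ^ 2 / 4) := by gcongr
      _ = _ := by ring
  have h2 := abs_le_of_sq_le_sq h1 (by positivity)
  rw [real_inner_comm, ← hb]
  have h3 : |l * b| ≤ l * (dz N * r) := by
    have h4 := abs_sub (a + l * b) a
    rw [add_sub_cancel_left] at h4
    have h5 : C7 N * r ≤ l * dz N / 2 * r := by gcongr; linarith
    linarith
  rw [abs_mul, abs_of_pos (by linarith : 0 < l)] at h3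
  exact le_of_mul_le_mul_left h3 (by linarith)

theorem exists_near_inf {ι : Type*} {F : ι → ℝ} {B : ℝ} (hB : ∀ i, -B ≤ F i) (i0 : ι) {K : ℝ}
    (h0 : F i0 < -K) : ∃ l, K ≤ l ∧ (∀ i, -l ≤ F i) ∧ ∃ i, F i ≤ -l + 1 := by
  have hbdd : BddBelow (range F) := ⟨-B, forall_mem_range.2 hB⟩
  refine ⟨-sInf (range F), ?_, fun i => ?_, ?_⟩
  · have := csInf_le hbdd (mem_range_self i0); linarith
  · rw [neg_neg]; exact csInf_le hbdd (mem_range_self i)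
  · obtain ⟨_, ⟨i, rfl⟩, hi⟩ := exists_lt_of_csInf_lt ⟨F i0, mem_range_self i0⟩
      (lt_add_one (sInf (range F)))
    exact ⟨i, by linarith⟩

theorem GSol.A_lower_dense (h : GSol M Λ u) {y : EN N} (hy : y ∈ Λ) (hD : Dp Λ y) {r : ℝ}
    (hr : 0 < r) {e : EN N} (he : ‖e‖ = 1) : -KK N ≤ A u (phi N) y r e e := by
  obtain ⟨h0, h0p, hthin⟩ := hD.not_thin
  have hω := Cω_pos N
  have small : ∀ r, 0 < r → r < h0 → ∀ e : EN N, ‖e‖ = 1 → -KK N ≤ A u (phi N) y r e e := by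
    intro r hr hr0 e he
    by_contra hcon
    push Not at hcon
    obtain ⟨l, hlK, hl, ⟨v, hv⟩, hvl⟩ := exists_near_inf
      (F := fun v : {v : EN N // ‖v‖ = 1} => A u (phi N) y r v v)
      (B := M * ((1 + 2 * ‖y‖ ^ 2) * (r ^ 2)⁻¹ + 2) * Cφ N * W1 N) (fun v => by
        have := (abs_le.1 (h.abs_A_le (KBφ N) y v v hr le_rfl)).1
        rwa [v.2, mul_one, mul_one] at this) ⟨e, he⟩ hcon
    exact hthin r hr hr0 v hv (h.thin_of_le hy hv hr hlK (fun v hv => hl ⟨v, hv⟩)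
      (by simp only at hvl; linarith))
  by_contra hcon
  push Not at hcon
  obtain ⟨l, hlK, hl, ⟨⟨s, v⟩, hs, hv⟩, hvl⟩ := exists_near_inf
    (F := fun p : {p : ℝ × EN N // 0 < p.1 ∧ ‖p.2‖ = 1} => A u (phi N) y p.1.1 p.1.2 p.1.2)
    (B := max (KK N) (M * ((1 + 2 * ‖y‖ ^ 2) * (h0 ^ 2)⁻¹ + 2) * Cφ N * W1 N)) (fun p => by
      obtain ⟨⟨s, v⟩, hs, hv⟩ := p
      simp only at hs hv ⊢
      rcases lt_or_ge s h0 with h1 | h1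
      · exact (neg_le_neg (le_max_left _ _)).trans (small s hs h1 v hv)
      · have := (abs_le.1 (h.abs_A_le (KBφ N) y v v h0p h1)).1
        rw [hv, mul_one, mul_one] at this
        exact (neg_le_neg (le_max_right _ _)).trans this) ⟨(r, e), hr, he⟩ hcon
  simp only at hs hv hvl
  have hp := h.persist hv (l := -l + (1 + Cω N)) hs le_rfl
    (fun r hr _ hA => h.thin_of_le hy hv hr hlK (fun w hw => hl ⟨(r, w), hr, hw⟩) hA)
    (fun r h1 h2 => by rw [le_antisymm h2 h1]; linarith)
    (by rw [div_self hs.ne']; linarith)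
  obtain ⟨ρ, hρ⟩ : ∃ ρ, ρ = min s (h0 / 2) := ⟨_, rfl⟩
  have hρ0 : 0 < ρ := hρ ▸ lt_min hs (by linarith)
  have hρs : ρ ≤ s := hρ ▸ min_le_left _ _
  have hρh : ρ ≤ h0 / 2 := hρ ▸ min_le_right _ _
  exact hthin ρ hρ0 (by linarith) v hv (h.thin_of_le hy hv hρ0 hlK
    (fun w hw => hl ⟨(ρ, w), hρ0, hw⟩) (hp ρ hρ0 hρs))

end GlobalSol

namespace GlobalSol
variable {N : ℕ}
variable {M : ℝ} {Λ : Set (EN N)} {u : EN N → ℝ} {g : ℝ → ℝ} {C : ℝ}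

theorem ae_Dp (Λ : Set (EN N)) : ∀ᵐ y ∂(volume.restrict Λ), Dp Λ y := by
  have h := fun m : ℕ => IsUnifLocDoublingMeasure.ae_tendsto_measure_inter_div
    (volume : Measure (EN N)) Λ (2 * (m + 1 : ℝ))
  filter_upwards [ae_all_iff.2 h] with y hy
  intro ε hε
  by_contra hcon
  push Not at hcon
  obtain ⟨m, hm⟩ := exists_nat_one_div_lt hε
  have hmp : (0 : ℝ) < 1 / (m + 1) := by positivity
  choose t ht0 ht1 p hp hz using fun n : ℕ => hcon (1 / ((n : ℝ) + 1)) (by positivity)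
  obtain ⟨q, hq⟩ : ∃ q : ℝ, q = 1 / (m + 1) := ⟨_, rfl⟩
  have hq0 : 0 < q := hq ▸ hmp
  have hlim : Tendsto t atTop (nhds 0) :=
    squeeze_zero (fun n => (ht0 n).le) (fun n => (ht1 n).le) tendsto_one_div_add_atTop_nhds_zero_nat
  have key := hy m p (fun n => q / 2 * t n) (l := atTop) (by
    refine tendsto_nhdsWithin_iff.2 ⟨?_, Eventually.of_forall fun n => ?_⟩
    · simpa using hlim.const_mul (q / 2)
    · have := ht0 n
      exact mem_Ioi.2 (by positivity)) (Eventually.of_forall fun n => by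
      rw [mem_closedBall, dist_comm, dist_eq_norm]
      have : 2 * ((m : ℝ) + 1) * (q / 2 * t n) = t n := by rw [hq]; field_simp
      rw [this]; exact hp n)
  have h0 : ∀ n, volume (Λ ∩ closedBall (p n) (q / 2 * t n)) /
      volume (closedBall (p n) (q / 2 * t n)) = 0 := fun n => by
    have : Λ ∩ closedBall (p n) (q / 2 * t n) = ∅ := by
      rw [eq_empty_iff_forall_notMem]
      rintro z ⟨hz1, hz2⟩
      have h3 := hz n z hz1
      rw [mem_closedBall, dist_eq_norm] at hz2
      have := ht0 n
      have : q * t n < ε * t n := by gcongr; rwa [hq]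
      nlinarith
    rw [this]; simp
  simp only [h0] at key
  exact zero_ne_one (tendsto_nhds_unique tendsto_const_nhds key)

/-- A solution whose contact set is nonempty and has positive measure near each of its points. -/
structure FSol (M : ℝ) (Λ : Set (EN N)) (u : EN N → ℝ) : Prop extends GSol M Λ u where
  ne : Λ.Nonempty
  dense : ∀ y ∈ Λ, ∀ ε > 0, ∃ y' ∈ Λ, Dp Λ y' ∧ ‖y' - y‖ < ε

theorem GSol.exists_full (h : GSol M Λ u) (hv : volume Λ ≠ 0) :
    ∃ S ⊆ Λ, FSol M S u ∧ volume (Λ \ S) = 0 := by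
  obtain ⟨S, hS⟩ : ∃ S, S = (volume.restrict Λ).support := ⟨_, rfl⟩
  have hcl : IsClosed S := hS ▸ Measure.isClosed_support
  have hsub : S ⊆ Λ := by
    have := Measure.support_restrict_subset (μ := (volume : Measure (EN N))) (s := Λ)
    rw [h.closed.closure_eq] at this
    exact hS ▸ this.trans inter_subset_left
  have hnull : volume (Λ \ S) = 0 := by
    have := Measure.measure_compl_support (μ := volume.restrict Λ)
    rw [← hS, Measure.restrict_apply hcl.measurableSet.compl, inter_comm] at this
    exact this
  have hpos : ∀ y ∈ S, ∀ ε > 0, 0 < volume (S ∩ ball y ε) := fun y hy ε hε => by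
    have h1 : 0 < (volume.restrict Λ) (ball y ε) :=
      (Measure.mem_support_iff_forall y).1 (hS ▸ hy) _ (ball_mem_nhds y hε)
    rw [Measure.restrict_apply measurableSet_ball] at h1
    refine h1.trans_le ?_
    have h2 : ball y ε ∩ Λ ⊆ (S ∩ ball y ε) ∪ (Λ \ S) := fun z hz => by
      by_cases h3 : z ∈ S
      · exact Or.inl ⟨h3, hz.1⟩
      · exact Or.inr ⟨hz.2, h3⟩
    refine (measure_mono h2).trans ((measure_union_le _ _).trans ?_)
    rw [hnull, add_zero]
  refine ⟨S, hsub, ⟨⟨hcl, h.smooth, fun φ h1 h2 => ?_, fun x hx => h.zero x (hsub hx), h.growth⟩,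
    ?_, fun y hy ε hε => ?_⟩, hnull⟩
  · rw [h.weak φ h1 h2]
    refine setIntegral_congr_set ?_
    have h3 : (Sᶜ : Set (EN N)) =ᵐ[volume] (Λᶜ : Set (EN N)) := by
      refine ae_eq_set.2 ⟨?_, ?_⟩
      · have : Sᶜ \ Λᶜ = Λ \ S := by ext; simp [and_comm]
        rw [this, hnull]
      · have : (Λᶜ : Set (EN N)) \ Sᶜ = ∅ := by
          ext z; simp only [Set.mem_sdiff, mem_compl_iff, not_not, mem_empty_iff_false, iff_false]
          exact fun hz => hz.1 (hsub hz.2)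
        rw [this, measure_empty]
    exact h3.symm
  · by_contra hne
    rw [not_nonempty_iff_eq_empty] at hne
    rw [hne, sdiff_empty] at hnull
    exact hv hnull
  · have h1 := ae_restrict_iff' hcl.measurableSet |>.1 (ae_Dp S)
    by_contra hcon
    push Not at hcon
    have h2 : volume (S ∩ ball y ε) = 0 := by
      refine measure_mono_null (fun z hz => ?_) (ae_iff.1 h1)
      intro h3
      have h4 := hcon z hz.1 (h3 hz.1)
      rw [← dist_eq_norm] at h4
      exact absurd (mem_ball.1 hz.2) (not_lt.2 h4)
    exact (hpos y hy ε hε).ne' h2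

theorem GSol.zero_set_subset_hyperplane (h : GSol M Λ u) (h0 : (0 : EN N) ∈ Λ)
    (hv : volume Λ = 0) : ∃ w : EN N, w ≠ 0 ∧ ∀ z, fderiv ℝ u z = 0 → ⟪z, w⟫ = 0 := by
  have hg := KBφ N
  have hla : ∀ (k : EN N → ℝ) y r, 0 < r → I (la Λ) k y r = 0 := fun k y r hr => by
    rw [I_eq _ _ _ hr]
    have : (fun w => la Λ w * k (r⁻¹ • (w - y))) =ᵐ[volume] fun _ => 0 := by
      have : ∀ᵐ w, w ∉ Λ := measure_eq_zero_iff_ae_notMem.1 hv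
      filter_upwards [this] with w hw
      rw [la_of_notMem hw, zero_mul]
    rw [integral_congr_ae this]; simp
  have hconst : ∀ y e f r, 0 < r → A u (phi N) y r e f = A u (phi N) y 1 e f := by
    intro y e f r hr
    have hd : ∀ s ∈ Ioi (0 : ℝ), HasDerivWithinAt (fun r => A u (phi N) y r e f) 0 (Ioi 0) s :=
      fun s hs => by
        have := h.hasDerivAt_A' hg y e f hs
        rw [hla _ _ _ hs, mul_zero, neg_zero] at this
        exact this.hasDerivWithinAt
    have := (convex_Ioi (0 : ℝ)).norm_image_sub_le_of_norm_hasDerivWithin_le (C := 0) hd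
      (fun s _ => by simp) (mem_Ioi.2 one_pos) (mem_Ioi.2 hr)
    rw [zero_mul, norm_le_zero_iff, sub_eq_zero] at this
    exact this
  have hconst' : ∀ y e f r, 0 < r → A u (phi N) y r e f = A u (phi N) 0 1 e f := by
    intro y e f r hr
    rw [hconst y e f r hr]
    have h1 := h.tendsto_A_sub hg y 0 e f
    have h2 : (fun R => A u (phi N) y R e f - A u (phi N) 0 R e f) =ᶠ[atTop]
        fun _ => A u (phi N) y 1 e f - A u (phi N) 0 1 e f := by
      filter_upwards [eventually_gt_atTop 0] with R hR
      rw [hconst y e f R hR, hconst 0 e f R hR]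
    have := tendsto_nhds_unique (h1.congr' h2) tendsto_const_nhds
    linarith
  have hDu : ∀ z e, c0 N * fderiv ℝ u z e = A u (phi N) 0 1 e z := by
    intro z e
    have h1 := (h.tendsto_V hg z e).sub (h.tendsto_V hg 0 e)
    have h2 : (fun r => V u (phi N) z r e - V u (phi N) 0 r e) =ᶠ[nhdsWithin 0 (Ioi 0)]
        fun _ => A u (phi N) 0 1 e z := by
      filter_upwards [self_mem_nhdsWithin] with r hr
      obtain ⟨t, -, ht⟩ := h.V_sub hg 0 z e hr
      rw [ht, hconst' _ _ _ r hr, sub_zero]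
    have := tendsto_nhds_unique (h1.congr' h2) tendsto_const_nhds
    rw [(h.zero 0 h0).2] at this
    simpa using this
  have htr : ∑ i : Fin N, A u (phi N) 0 1 (EuclideanSpace.single i 1) (EuclideanSpace.single i 1) =
      c0 N := by
    have h1 := I_om_add_la h.closed hg.kr 0 one_pos
    rw [hla _ _ _ one_pos, add_zero] at h1
    rw [h.sum_A hg 0 one_pos, h1]; rfl
  obtain ⟨i, hi⟩ : ∃ i : Fin N,
      A u (phi N) 0 1 (EuclideanSpace.single i 1) (EuclideanSpace.single i 1) ≠ 0 := by
    by_contra hcon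
    push Not at hcon
    rw [Finset.sum_eq_zero fun i _ => hcon i] at htr
    exact (c0_pos N).ne htr
  let L : EN N →ₗ[ℝ] ℝ :=
    { toFun := fun z => A u (phi N) 0 1 (EuclideanSpace.single i 1) z
      map_add' := fun a b => by
        simpa using h.A_right hg 0 one_pos 1 1 a b (EuclideanSpace.single i 1)
      map_smul' := fun c a => by
        simpa using h.A_right hg 0 one_pos c 0 a 0 (EuclideanSpace.single i 1) }
  refine ⟨(InnerProductSpace.toDual ℝ (EN N)).symm L.toContinuousLinearMap, fun hw => hi ?_,
    fun z hz => ?_⟩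
  · have : L (EuclideanSpace.single i 1) = 0 := by
      rw [LinearIsometryEquiv.map_eq_zero_iff] at hw
      have := congrArg (fun T : EN N →L[ℝ] ℝ => T (EuclideanSpace.single i 1)) hw
      simpa using this
    exact this
  · rw [real_inner_comm, InnerProductSpace.toDual_symm_apply]
    show A u (phi N) 0 1 (EuclideanSpace.single i 1) z = 0
    rw [← hDu, hz]; simp

/-- The gradient is monotone up to an error `μ`. -/
def Mono (u : EN N → ℝ) (μ : ℝ) : Prop :=
  ∀ y z, -(μ * ‖z - y‖ ^ 2) ≤ fderiv ℝ u z (z - y) - fderiv ℝ u y (z - y)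

theorem GSol.mono_of_lower (h : GSol M Λ u) {K : ℝ}
    (hK : ∀ x r, 0 < r → ∀ e : EN N, ‖e‖ = 1 → -K ≤ A u (phi N) x r e e) : Mono u (K / c0 N) := by
  intro y z
  have hc := c0_pos N
  have h1 := (h.tendsto_V (KBφ N) z (z - y)).sub (h.tendsto_V (KBφ N) y (z - y))
  have h2 : ∀ᶠ r in nhdsWithin (0 : ℝ) (Ioi 0), -(K * ‖z - y‖ ^ 2) ≤
      V u (phi N) z r (z - y) - V u (phi N) y r (z - y) := by
    filter_upwards [self_mem_nhdsWithin] with r hr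
    obtain ⟨t, -, ht⟩ := h.V_sub (KBφ N) y z (z - y) hr
    rw [ht]
    have := (h.psd (KBφ N) (y + t • (z - y)) hr (hK _ r hr)).nonneg (z - y)
    rw [real_inner_self_eq_norm_sq] at this
    linarith
  have h3 := ge_of_tendsto h1 h2
  have h4 : K * ‖z - y‖ ^ 2 = c0 N * (K / c0 N * ‖z - y‖ ^ 2) := by field_simp
  rw [h4, ← mul_sub, ← mul_neg] at h3
  exact le_of_mul_le_mul_left h3 hc

theorem GSol.lipschitz_of_lower (h : GSol M Λ u) {K : ℝ} (K0 : 0 ≤ K)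
    (hK : ∀ x r, 0 < r → ∀ e : EN N, ‖e‖ = 1 → -K ≤ A u (phi N) x r e e) :
    ∃ L, 0 ≤ L ∧ ∀ y z e, |fderiv ℝ u z e - fderiv ℝ u y e| ≤ L * ‖z - y‖ * ‖e‖ := by
  have hc := c0_pos N
  obtain ⟨T, hT⟩ : ∃ T, T = c0 N + N * K := ⟨_, rfl⟩
  have hT0 : 0 ≤ T := by rw [hT]; positivity
  refine ⟨(T + K) / c0 N, by positivity, fun y z e => ?_⟩
  have h1 := ((h.tendsto_V (KBφ N) z e).sub (h.tendsto_V (KBφ N) y e)).abs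
  have h2 : ∀ᶠ r in nhdsWithin (0 : ℝ) (Ioi 0), 
      |V u (phi N) z r e - V u (phi N) y r e| ≤ (T + K) * ‖z - y‖ * ‖e‖ := by
    filter_upwards [self_mem_nhdsWithin] with r hr
    obtain ⟨t, -, ht⟩ := h.V_sub (KBφ N) y z e hr
    rw [ht]
    have hP := h.psd (KBφ N) (y + t • (z - y)) hr (hK _ r hr)
    have hcs := hP.cauchy e (z - y)
    have g0 : ∀ σ : ℝ, 0 ≤ σ → 0 ≤ phi N σ := fun σ hσ => (phi_pos N hσ).le
    have t1 := h.psd_trace (KBφ N) g0 (y + t • (z - y)) hr (hK _ r hr) e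
    have t2 := h.psd_trace (KBφ N) g0 (y + t • (z - y)) hr (hK _ r hr) (z - y)
    rw [show mass N (phi N) = c0 N from rfl, ← hT] at t1 t2
    obtain ⟨a, ha⟩ : ∃ a, a = A u (phi N) (y + t • (z - y)) r e (z - y) := ⟨_, rfl⟩
    rw [← ha] at hcs ⊢
    have h3 : (a + K * ⟪e, z - y⟫) ^ 2 ≤ (T * (‖z - y‖ * ‖e‖)) ^ 2 :=
      hcs.trans ((mul_le_mul t1 t2 (hP.nonneg _) (by positivity)).trans_eq (by ring))
    have h4 := abs_le_of_sq_le_sq h3 (by positivity)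
    have h5 := abs_sub (a + K * ⟪e, z - y⟫) (K * ⟪e, z - y⟫)
    rw [add_sub_cancel_right, abs_mul K, abs_of_nonneg K0] at h5
    have h6 := mul_le_mul_of_nonneg_left (abs_real_inner_le_norm e (z - y)) K0
    nlinarith
  have h3 := le_of_tendsto h1 h2
  rw [← mul_sub, abs_mul, abs_of_pos hc] at h3
  have h4 : (T + K) * ‖z - y‖ * ‖e‖ = c0 N * ((T + K) / c0 N * ‖z - y‖ * ‖e‖) := by field_simp
  rw [h4] at h3
  exact le_of_mul_le_mul_left h3 hc

theorem GSol.abs_A_sub_interior (h : GSol M Λ u) (hg : KB N g C) {x e : EN N} (he : ‖e‖ = 1)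
    {d r : ℝ} (hr : 0 < r) (hrd : r ≤ d) (hd : ∀ y ∈ Λ, d ≤ ‖y - x‖) :
    |A u g x d e e - A u g x r e e| ≤ C * W1 N := by
  have hd0 := hr.trans_le hrd
  have hK := hg.kq e e
  rw [he, mul_one, mul_one] at hK
  have hC := hK.nonneg
  have hbound : ∀ s ∈ Icc r d, ‖-(s⁻¹ * I (la Λ) (kq g e e) x s)‖ ≤ C * W1 N / d := by
    intro s hs
    have hs0 := hr.trans_le hs.1
    rw [norm_neg, Real.norm_eq_abs, abs_mul, abs_of_pos (inv_pos.2 hs0)]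
    have h1 : |I (la Λ) (kq g e e) x s| ≤ (s / d) ^ 2 * C * W1 N := by
      refine abs_I_le (fun z => ?_) hK.bound
      rw [abs_of_nonneg (la_nonneg _ _)]
      by_cases hz : x + s • z ∈ Λ
      · have h2 := hd _ hz
        rw [add_sub_cancel_left, norm_smul, Real.norm_eq_abs, abs_of_pos hs0] at h2
        rw [la_of_mem hz]
        have h3 : 1 ≤ s / d * ‖z‖ := by
          rw [div_mul_eq_mul_div, one_le_div hd0]; exact h2
        nlinarith [sq_nonneg (s / d)]
      · rw [la_of_notMem hz]; positivity
    calc s⁻¹ * |I (la Λ) (kq g e e) x s| ≤ s⁻¹ * ((s / d) ^ 2 * C * W1 N) := by gcongr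
      _ = C * W1 N / d * (s / d) := by field_simp
      _ ≤ C * W1 N / d * 1 := by
          have := W1_nonneg N
          have : s / d ≤ 1 := by rw [div_le_one hd0]; exact hs.2
          gcongr
      _ = _ := mul_one _
  have := (convex_Icc r d).norm_image_sub_le_of_norm_hasDerivWithin_le
    (fun s hs => (h.hasDerivAt_A' hg x e e (hr.trans_le hs.1)).hasDerivWithinAt) hbound
    ⟨le_rfl, hrd⟩ ⟨hrd, le_rfl⟩
  rw [Real.norm_eq_abs, Real.norm_eq_abs, abs_of_nonneg (by linarith : 0 ≤ d - r)] at this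
  refine this.trans ?_
  have h2 : 0 ≤ C * W1 N / d := by have := W1_nonneg N; positivity
  calc C * W1 N / d * (d - r) ≤ C * W1 N / d * d := by gcongr; linarith
    _ = _ := by field_simp

theorem FSol.exists_near (h : FSol M Λ u) {x : EN N} {d : ℝ} (hd : infDist x Λ < d) :
    ∃ y ∈ Λ, Dp Λ y ∧ ‖x - y‖ < d := by
  obtain ⟨y, hy, hxy⟩ := (infDist_lt_iff h.ne).1 hd
  obtain ⟨y', hy', hD, hyy⟩ := h.dense y hy (d - dist x y) (by linarith)
  refine ⟨y', hy', hD, ?_⟩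
  rw [← dist_eq_norm] at hyy ⊢
  have := dist_triangle x y y'
  rw [dist_comm y y'] at this
  linarith

theorem infDist_le_norm {x : EN N} : ∀ y ∈ Λ, infDist x Λ ≤ ‖y - x‖ := fun y hy => by
  rw [← dist_eq_norm, dist_comm]; exact infDist_le_dist_of_mem hy

theorem FSol.A_lower (h : FSol M Λ u) : ∃ K, 0 ≤ K ∧
    ∀ x r, 0 < r → ∀ e : EN N, ‖e‖ = 1 → -K ≤ A u (phi N) x r e e := by
  have hC := (KBφ N).nonneg
  have hW := W1_nonneg N
  have hK1 : 1 ≤ KK N := le_max_left _ _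
  have near : ∀ x r, 0 < r → infDist x Λ < 2 * r → ∀ e : EN N, ‖e‖ = 1 →
      -(KK N + 2 * Cφ N * 9 ^ (N + 6) * W1 N) ≤ A u (phi N) x r e e := by
    intro x r hr hd e he
    obtain ⟨y, hy, hD, hxy⟩ := h.exists_near hd
    have h1 := h.A_lower_dense hy hD hr he
    have h2 := h.abs_A_sub_le (KBφ N) e e hr hxy.le
    rw [he, mul_one, mul_one] at h2
    linarith [(abs_le.1 h2).1]
  refine ⟨KK N + 2 * Cφ N * 9 ^ (N + 6) * W1 N + Cφ N * W1 N, by positivity,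
    fun x r hr e he => ?_⟩
  rcases lt_or_ge (infDist x Λ) (2 * r) with hd | hd
  · have := near x r hr hd e he
    have : 0 ≤ Cφ N * W1 N := by positivity
    linarith
  · have hd0 : 0 < infDist x Λ := by linarith
    have h1 := near x (infDist x Λ) hd0 (by linarith) e he
    have h2 := h.abs_A_sub_interior (KBφ N) he hr (by linarith : r ≤ infDist x Λ) infDist_le_norm
    linarith [(abs_le.1 h2).2]

end GlobalSol

namespace GlobalSol
variable {N : ℕ}

/-- A solution with Lipschitz gradient which is monotone up to the error `μ`. -/
structure MSol (M L μ : ℝ) (Λ : Set (EN N)) (u : EN N → ℝ) : Prop extends FSol M Λ u where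
  L_nonneg : 0 ≤ L
  pos : 0 < μ
  lip : ∀ y z e : EN N, |fderiv ℝ u z e - fderiv ℝ u y e| ≤ L * ‖z - y‖ * ‖e‖
  mono : Mono u μ

variable {M L μ : ℝ} {Λ : Set (EN N)} {u : EN N → ℝ} {g : ℝ → ℝ} {C : ℝ}

theorem continuous_fderiv_of_contDiff (h : ContDiff ℝ 1 u) (e : EN N) :
    Continuous (fun w => fderiv ℝ u w e) :=
  (h.continuous_fderiv one_ne_zero).clm_apply continuous_const

theorem MSol.QG_fderiv (h : MSol M L μ Λ u) (e : EN N) :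
    QG (|fderiv ℝ u 0 e| + L * ‖e‖) (fun w => fderiv ℝ u w e) := fun x => by
  have h1 := h.lip 0 x e
  rw [sub_zero] at h1
  have h2 := abs_sub_abs_le_abs_sub (fderiv ℝ u x e) (fderiv ℝ u 0 e)
  have h3 : ‖x‖ ≤ 1 + ‖x‖ ^ 2 := by nlinarith [sq_nonneg (‖x‖ - 1), norm_nonneg x]
  have h4 : L * ‖x‖ * ‖e‖ ≤ L * (1 + ‖x‖ ^ 2) * ‖e‖ := by
    have := h.L_nonneg; gcongr
  have h5 : |fderiv ℝ u 0 e| ≤ |fderiv ℝ u 0 e| * (1 + ‖x‖ ^ 2) :=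
    le_mul_of_one_le_right (abs_nonneg _) (by nlinarith [sq_nonneg ‖x‖])
  linarith

theorem MSol.V_eq (h : MSol M L μ Λ u) (hg : KB N g C) (y e : EN N) {r : ℝ} (hr : 0 < r) :
    V u g y r e = I (fun w => fderiv ℝ u w e) (kr g) y r := by
  have hd : ∀ z, HasFDerivAt (fun z => u (y + r • z))
      ((fderiv ℝ u (y + r • z)).comp (r • ContinuousLinearMap.id ℝ (EN N))) z := fun z => by
    have h1 : HasFDerivAt (fun z : EN N => y + r • z) (r • ContinuousLinearMap.id ℝ (EN N)) z :=
      ((hasFDerivAt_id z).const_smul r).const_add y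
    exact ((h.smooth.differentiable one_ne_zero _).hasFDerivAt).comp z h1
  have hf : ∀ z, fderiv ℝ (fun z => u (y + r • z)) z e = r * fderiv ℝ u (y + r • z) e := fun z => by
    rw [(hd z).fderiv]; simp
  have i1 := integrable_z (h.QG_fderiv e) (continuous_fderiv_of_contDiff h.smooth e).aestronglyMeasurable
    hg.kr.continuous hg.kr.bound y hr
  have hkb : ∀ x, |fderiv ℝ (kr g) x e| ≤ C * ‖e‖ * wt x := fun x =>
    (hg.kr.dbound x e).trans_eq (by ring)
  have key := integral_mul_fderiv_eq_neg_fderiv_mul_of_integrable (μ := (volume : Measure (EN N)))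
    (f := fun z => u (y + r • z)) (g := kr g) (v := e)
    (by simp only [hf, mul_assoc]; exact i1.const_mul r)
    (integrable_z h.qg h.aesm (hg.kr.continuous_fderiv_apply e) hkb y hr)
    (integrable_z h.qg h.aesm hg.kr.continuous hg.kr.bound y hr)
    (fun z _ => (hd z).differentiableAt) (fun z _ => hg.kr.differentiable z)
  simp only [hf, mul_assoc] at key
  rw [integral_const_mul] at key
  have e1 : kl (hat g) e = fun z => -fderiv ℝ (kr g) z e := funext fun z => klh_eq hg e z
  rw [V, e1, I_neg_kernel]
  unfold I
  rw [key]
  field_simp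

/-- Corrected difference quotient of the gradient. -/
def Qh (u : EN N → ℝ) (μ : ℝ) (e : EN N) (h : ℝ) (w : EN N) : ℝ :=
  h⁻¹ * (fderiv ℝ u (w + h • e) e - fderiv ℝ u w e) + μ

/-- Corrected mollified second derivative. -/
def Bf (u : EN N → ℝ) (μ : ℝ) (g : ℝ → ℝ) (x : EN N) (r : ℝ) (e : EN N) : ℝ :=
  A u g x r e e + μ * mass N g

theorem MSol.Qh_nonneg (h : MSol M L μ Λ u) {e : EN N} (he : ‖e‖ = 1) {t : ℝ} (ht : 0 < t)
    (w : EN N) : 0 ≤ Qh u μ e t w := by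
  have h1 := h.mono w (w + t • e)
  rw [add_sub_cancel_left, map_smul, map_smul, norm_smul, he, Real.norm_eq_abs, abs_of_pos ht,
    smul_eq_mul, smul_eq_mul, mul_one, ← mul_sub] at h1
  have h2 : -(μ * t) ≤ fderiv ℝ u (w + t • e) e - fderiv ℝ u w e := by
    refine le_of_mul_le_mul_left ?_ ht
    linarith
  have h3 := mul_le_mul_of_nonneg_left h2 (inv_nonneg.2 ht.le)
  have e1 : t⁻¹ * -(μ * t) = -μ := by field_simp
  unfold Qh
  linarith

theorem MSol.Qh_le (h : MSol M L μ Λ u) {e : EN N} (he : ‖e‖ = 1) {t : ℝ} (ht : 0 < t)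
    (w : EN N) : Qh u μ e t w ≤ L + μ := by
  have h1 := (abs_le.1 (h.lip w (w + t • e) e)).2
  rw [add_sub_cancel_left, norm_smul, he, Real.norm_eq_abs, abs_of_pos ht, mul_one, mul_one] at h1
  have h3 := mul_le_mul_of_nonneg_left h1 (inv_nonneg.2 ht.le)
  have e1 : t⁻¹ * (L * t) = L := by field_simp
  unfold Qh
  linarith

theorem MSol.continuous_Qh (h : MSol M L μ Λ u) (e : EN N) (t : ℝ) : Continuous (Qh u μ e t) := by
  have := continuous_fderiv_of_contDiff h.smooth e
  unfold Qh
  fun_prop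

theorem MSol.QG_Qh (h : MSol M L μ Λ u) {e : EN N} (he : ‖e‖ = 1) {t : ℝ} (ht : 0 < t) :
    QG (L + μ) (Qh u μ e t) := fun x => by
  rw [abs_of_nonneg (h.Qh_nonneg he ht x)]
  have := h.L_nonneg
  have := h.pos
  exact (h.Qh_le he ht x).trans (le_mul_of_one_le_right (by linarith) (by nlinarith [sq_nonneg ‖x‖]))

theorem MSol.tendsto_Qh (h : MSol M L μ Λ u) (hg : KB N g C) (x e : EN N) {r : ℝ} (hr : 0 < r) :
    Tendsto (fun t => I (Qh u μ e t) (kr g) x r) (nhdsWithin 0 (Ioi 0))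
      (nhds (Bf u μ g x r e)) := by
  have h1 := h.hasDerivAt_V_translate hg x e e hr 0
  have h2 := (h1.tendsto_slope_zero_right).add_const (μ * mass N g)
  simp only [zero_smul, add_zero, zero_add] at h2
  refine h2.congr' ?_
  filter_upwards [self_mem_nhdsWithin] with t ht
  have hD := continuous_fderiv_of_contDiff h.smooth e
  have i1 := integrable_z (h.QG_fderiv e) hD.aestronglyMeasurable
    hg.kr.continuous hg.kr.bound x hr
  have i2 := integrable_z (h.QG_fderiv e) hD.aestronglyMeasurable
    hg.kr.continuous hg.kr.bound (x + t • e) hr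
  rw [h.V_eq hg _ _ hr, h.V_eq hg _ _ hr, smul_eq_mul]
  unfold I mass
  have i3 : Integrable (fun z => fderiv ℝ u (x + t • e + r • z) e * kr g z -
      fderiv ℝ u (x + r • z) e * kr g z) := i2.sub i1
  rw [← integral_sub i2 i1, ← integral_const_mul, ← integral_const_mul, ← integral_add
    (i3.const_mul t⁻¹) (hg.kr.integrable.const_mul μ)]
  congr 1
  ext z
  unfold Qh
  rw [show x + r • z + t • e = x + t • e + r • z by abel]
  ring

theorem MSol.Bf_nonneg (h : MSol M L μ Λ u) (hg : KB N g C) (g0 : ∀ σ, 0 ≤ σ → 0 ≤ g σ)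
    (x : EN N) {e : EN N} (he : ‖e‖ = 1) {r : ℝ} (hr : 0 < r) : 0 ≤ Bf u μ g x r e := by
  refine ge_of_tendsto (h.tendsto_Qh hg x e hr) ?_
  filter_upwards [self_mem_nhdsWithin] with t ht
  exact integral_nonneg fun z => mul_nonneg (h.Qh_nonneg he ht _) (g0 _ (sq_nonneg _))

theorem MSol.harnack (h : MSol M L μ Λ u) {g1 g2 : ℝ → ℝ} {C1 C2 : ℝ} (hg1 : KB N g1 C1)
    (hg2 : KB N g2 C2) {x y e : EN N} (he : ‖e‖ = 1) {r s K K2 : ℝ} (hr : 0 < r) (hs : 0 < s)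
    (hK2 : 0 ≤ K2)
    (hk : ∀ w, kr g1 (r⁻¹ • (w - x)) ≤ K * kr g2 (s⁻¹ • (w - y)) + K2 * wt (r⁻¹ • (w - x))) :
    Bf u μ g1 x r e ≤ K * (s / r) ^ N * Bf u μ g2 y s e + K2 * (L + μ) * ∫ z : EN N, wt z := by
  have h1 := h.tendsto_Qh hg1 x e hr
  have h2 := ((h.tendsto_Qh hg2 y e hs).const_mul (K * (s / r) ^ N)).add_const
    (K2 * (L + μ) * ∫ z : EN N, wt z)
  refine le_of_tendsto_of_tendsto h1 h2 ?_
  filter_upwards [self_mem_nhdsWithin] with t ht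
  obtain ⟨Q, hQ⟩ : ∃ Q, Q = Qh u μ e t := ⟨_, rfl⟩
  have q1 : QG (L + μ) Q := hQ ▸ h.QG_Qh he ht
  have q2 : AEStronglyMeasurable Q := hQ ▸ (h.continuous_Qh e t).aestronglyMeasurable
  have q3 : ∀ w, 0 ≤ Q w := hQ ▸ h.Qh_nonneg he ht
  have q4 : ∀ w, Q w ≤ L + μ := hQ ▸ h.Qh_le he ht
  rw [← hQ]
  have i1 := integrable_w q1 q2 hg1.kr.continuous hg1.kr.bound x hr
  have i2 := integrable_w q1 q2 hg2.kr.continuous hg2.kr.bound y hs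
  have i3 := integrable_w q1 q2 (k := wt) (C := 1) continuous_wt
    (fun x => by rw [abs_of_pos (wt_pos x), one_mul]) x hr
  have step : ∫ w, Q w * kr g1 (r⁻¹ • (w - x)) ≤
      K * (∫ w, Q w * kr g2 (s⁻¹ • (w - y))) + K2 * ∫ w, Q w * wt (r⁻¹ • (w - x)) := by
    rw [← integral_const_mul, ← integral_const_mul, ← integral_add (i2.const_mul _)
      (i3.const_mul _)]
    refine integral_mono i1 ((i2.const_mul _).add (i3.const_mul _)) fun w => ?_
    have := mul_le_mul_of_nonneg_left (hk w) (q3 w)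
    linarith
  have hw : I Q wt x r ≤ (L + μ) * ∫ z : EN N, wt z := by
    unfold I
    rw [← integral_const_mul]
    refine integral_mono ?_ (integrable_wt.const_mul _) fun z =>
      mul_le_mul_of_nonneg_right (q4 _) (wt_pos z).le
    exact integrable_z q1 q2 (k := wt) (C := 1) continuous_wt
      (fun x => by rw [abs_of_pos (wt_pos x), one_mul]) x hr
  have hw2 := mul_le_mul_of_nonneg_left hw hK2
  have hrN : 0 < r ^ N := by positivity
  have hsN : 0 < s ^ N := by positivity
  calc I Q (kr g1) x r = (r ^ N)⁻¹ * ∫ w, Q w * kr g1 (r⁻¹ • (w - x)) := I_eq _ _ _ hr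
    _ ≤ (r ^ N)⁻¹ * (K * (∫ w, Q w * kr g2 (s⁻¹ • (w - y))) +
          K2 * ∫ w, Q w * wt (r⁻¹ • (w - x))) := by gcongr
    _ = K * (s / r) ^ N * I Q (kr g2) y s + K2 * I Q wt x r := by
        rw [I_eq _ _ _ hs, I_eq _ wt _ hr, div_pow]
        generalize (∫ w, Q w * kr g2 (s⁻¹ • (w - y))) = a
        generalize (∫ w, Q w * wt (r⁻¹ • (w - x))) = b
        field_simp
    _ ≤ _ := by linarith

theorem Dp.tendsto_Qh (h : MSol M L μ Λ u) {y e : EN N} (he : ‖e‖ = 1) (hy : y ∈ Λ) (hD : Dp Λ y) :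
    Tendsto (fun t => Qh u μ e t y) (nhdsWithin 0 (Ioi 0)) (nhds μ) := by
  rw [Metric.tendsto_nhds]
  intro ε hε
  have hL := h.L_nonneg
  obtain ⟨h0, h0p, hh⟩ := hD (ε / (L + 1)) (by positivity)
  filter_upwards [Ioo_mem_nhdsGT h0p] with t ht
  obtain ⟨z, hz, hzp⟩ := hh t ht.1 ht.2 (y + t • e) (by
    rw [add_sub_cancel_left, norm_smul, he, Real.norm_eq_abs, abs_of_pos ht.1, mul_one])
  have h1 := h.lip z (y + t • e) e
  rw [(h.zero z hz).2, he, mul_one, zero_apply, sub_zero, ← norm_neg, neg_sub] at h1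
  rw [Real.dist_eq, Qh, (h.zero y hy).2, zero_apply, sub_zero, add_sub_cancel_right, abs_mul,
    abs_of_pos (inv_pos.2 ht.1), inv_mul_lt_iff₀ ht.1]
  calc |fderiv ℝ u (y + t • e) e| ≤ L * ‖z - (y + t • e)‖ := h1
    _ ≤ L * (ε / (L + 1) * t) := by gcongr
    _ = (L / (L + 1)) * (t * ε) := by ring
    _ < 1 * (t * ε) := by
        have := ht.1
        refine mul_lt_mul_of_pos_right ?_ (by positivity)
        rw [div_lt_one (by linarith)]; linarith
    _ = _ := one_mul _

theorem MSol.Bf_ge_la (h : MSol M L μ Λ u) (hg : KB N g C) (g0 : ∀ σ, 0 ≤ σ → 0 ≤ g σ)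
    (x : EN N) {e : EN N} (he : ‖e‖ = 1) {r : ℝ} (hr : 0 < r) :
    μ * I (la Λ) (kr g) x r ≤ Bf u μ g x r e := by
  have hk0 : ∀ z : EN N, 0 ≤ kr g z := fun z => g0 _ (sq_nonneg _)
  have hL := h.L_nonneg
  have hμ := h.pos
  have hkw : Integrable (fun w => kr g (r⁻¹ • (w - x))) := by
    simpa using integrable_w QG_one aestronglyMeasurable_const hg.kr.continuous hg.kr.bound x hr
  have h1 := h.tendsto_Qh hg x e hr
  have h2 : Tendsto (fun t => (r ^ N)⁻¹ * ∫ w, la Λ w * Qh u μ e t w * kr g (r⁻¹ • (w - x)))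
      (nhdsWithin 0 (Ioi 0)) (nhds ((r ^ N)⁻¹ * ∫ w, la Λ w * μ * kr g (r⁻¹ • (w - x)))) := by
    refine Tendsto.const_mul _ ?_
    refine tendsto_integral_filter_of_dominated_convergence
      (fun w => (L + μ) * kr g (r⁻¹ • (w - x))) ?_ ?_ (hkw.const_mul _) ?_
    · refine Eventually.of_forall fun t => ?_
      exact ((aesm_la h.closed).mul (h.continuous_Qh e t).aestronglyMeasurable).mul
        hkw.aestronglyMeasurable
    · filter_upwards [self_mem_nhdsWithin] with t ht
      refine Eventually.of_forall fun w => ?_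
      have q1 := h.Qh_nonneg he ht w
      have q2 := h.Qh_le he ht w
      rw [Real.norm_eq_abs, abs_of_nonneg (mul_nonneg (mul_nonneg (la_nonneg _ _) q1) (hk0 _))]
      refine mul_le_mul_of_nonneg_right ?_ (hk0 _)
      exact (mul_le_of_le_one_left q1 (la_le_one _ _)).trans q2
    · filter_upwards [(ae_restrict_iff' h.closed.measurableSet).1 (ae_Dp Λ)] with w hw
      by_cases hwΛ : w ∈ Λ
      · exact ((Dp.tendsto_Qh h he hwΛ (hw hwΛ)).const_mul _).mul_const _
      · simp only [la_of_notMem hwΛ, zero_mul]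
        exact tendsto_const_nhds
  have e1 : μ * I (la Λ) (kr g) x r = (r ^ N)⁻¹ * ∫ w, la Λ w * μ * kr g (r⁻¹ • (w - x)) := by
    rw [I_eq _ _ _ hr, mul_left_comm, ← integral_const_mul]
    congr 2; ext w; ring
  rw [e1]
  refine le_of_tendsto_of_tendsto h2 h1 ?_
  filter_upwards [self_mem_nhdsWithin] with t ht
  rw [I_eq _ _ _ hr]
  refine mul_le_mul_of_nonneg_left ?_ (by positivity)
  refine integral_mono_of_nonneg (Eventually.of_forall fun w => ?_)
    (integrable_w (h.QG_Qh he ht) (h.continuous_Qh e t).aestronglyMeasurable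
      hg.kr.continuous hg.kr.bound x hr) (Eventually.of_forall fun w => ?_)
  · exact mul_nonneg (mul_nonneg (la_nonneg _ _) (h.Qh_nonneg he ht w)) (hk0 _)
  · exact mul_le_mul_of_nonneg_right
      (mul_le_of_le_one_left (h.Qh_nonneg he ht w) (la_le_one _ _)) (hk0 _)

theorem kr_phi_le {x y w : EN N} {r s c : ℝ}
    (h : 1 + ‖s⁻¹ • (w - y)‖ ^ 2 ≤ c * (1 + ‖r⁻¹ • (w - x)‖ ^ 2)) :
    kr (phi N) (r⁻¹ • (w - x)) ≤ c ^ (N + 8) * kr (phi N) (s⁻¹ • (w - y)) := by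
  have h1 := one_add_pos (s⁻¹ • (w - y))
  have h2 := one_add_pos (r⁻¹ • (w - x))
  unfold kr phi
  rw [← div_eq_mul_inv, le_div_iff₀ (by positivity), inv_mul_le_iff₀ (by positivity), mul_comm,
    ← mul_pow]
  gcongr

theorem MSol.harnack_phi (h : MSol M L μ Λ u) {x y e : EN N} (he : ‖e‖ = 1) {r s c : ℝ}
    (hr : 0 < r) (hs : 0 < s)
    (hk : ∀ w, 1 + ‖s⁻¹ • (w - y)‖ ^ 2 ≤ c * (1 + ‖r⁻¹ • (w - x)‖ ^ 2)) :
    Bf u μ (phi N) x r e ≤ c ^ (N + 8) * (s / r) ^ N * Bf u μ (phi N) y s e := by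
  have := h.harnack (KBφ N) (KBφ N) he (K := c ^ (N + 8)) (K2 := 0) hr hs le_rfl
    (x := x) (y := y) (fun w => by rw [zero_mul, add_zero]; exact kr_phi_le (hk w))
  simpa using this

end GlobalSol

namespace GlobalSol
variable {N : ℕ}
variable {M L μ : ℝ} {Λ : Set (EN N)} {u : EN N → ℝ} {g : ℝ → ℝ} {C : ℝ}

theorem MSol.harnack_phi_near (h : MSol M L μ Λ u) {x y e : EN N} (he : ‖e‖ = 1) {r s : ℝ}
    (hr : 0 < r) (hrs : r ≤ s) (hxy : ‖x - y‖ ≤ 2 * s) :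
    Bf u μ (phi N) x r e ≤ 9 ^ (N + 8) * (s / r) ^ N * Bf u μ (phi N) y s e := by
  have hs : 0 < s := hr.trans_le hrs
  refine h.harnack_phi he hr hs fun w => ?_
  have h1 : ‖s⁻¹ • (w - y)‖ ≤ ‖r⁻¹ • (w - x)‖ + 2 := by
    have e1 : w - y = (w - x) + (x - y) := by abel
    rw [e1, smul_add]
    refine (norm_add_le _ _).trans (add_le_add ?_ ?_)
    · rw [norm_smul, norm_smul, norm_inv, norm_inv, Real.norm_eq_abs, Real.norm_eq_abs,
        abs_of_pos hs, abs_of_pos hr]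
      gcongr
    · rw [norm_smul, norm_inv, Real.norm_eq_abs, abs_of_pos hs, inv_mul_le_iff₀ hs]
      linarith
  nlinarith [norm_nonneg (s⁻¹ • (w - y)), norm_nonneg (r⁻¹ • (w - x)),
    sq_nonneg (‖r⁻¹ • (w - x)‖ - 1 / 4)]

theorem MSol.neg_le_A (h : MSol M L μ Λ u) (x : EN N) {r : ℝ} (hr : 0 < r) (v : EN N)
    (hv : ‖v‖ = 1) : -(μ * c0 N) ≤ A u (phi N) x r v v := by
  have := h.Bf_nonneg (KBφ N) (fun σ hσ => (phi_pos N hσ).le) x hv hr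
  unfold Bf at this
  linarith

theorem MSol.thin_of_small (h : MSol M L μ Λ u) : ∃ ε > 0, ∀ y ∈ Λ, ∀ r, 0 < r → ∀ e : EN N,
    ‖e‖ = 1 → Bf u μ (phi N) y r e ≤ ε → Thin Λ y r e := by
  have hμ := h.pos
  have hc := c0_pos N
  have hd := dz_pos N
  obtain ⟨c, hcc⟩ : ∃ c, c = c0 N := ⟨_, rfl⟩
  obtain ⟨a, ha⟩ : ∃ a, a = μ * c * dz N / 2 := ⟨_, rfl⟩
  have ha0 : 0 < a := by rw [ha, hcc]; positivity
  obtain ⟨D, hD⟩ : ∃ D, D = Cφ N * W1 N := ⟨_, rfl⟩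
  have hD0 : 0 ≤ D := hD ▸ mul_nonneg (KBφ N).nonneg (W1_nonneg N)
  obtain ⟨η, hη⟩ : ∃ η, η = min 1 (a / (2 * (D + 1))) := ⟨_, rfl⟩
  have hη0 : 0 < η := by rw [hη]; positivity
  have hη1 : η ≤ 1 := hη ▸ min_le_left _ _
  have hη2 : 2 * D * η ≤ a := by
    have : η ≤ a / (2 * (D + 1)) := hη ▸ min_le_right _ _
    rw [le_div_iff₀ (by positivity)] at this
    nlinarith
  obtain ⟨T, hT⟩ : ∃ T, T = c + N * (μ * c) := ⟨_, rfl⟩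
  have hT0 : 0 < T := by rw [hT, hcc]; positivity
  refine ⟨a ^ 2 * η ^ N / (9 ^ (N + 8) * T), by positivity, fun y hy r hr e he hB z hz hzr => ?_⟩
  have hs : 0 < η * r := by positivity
  have hsr : η * r ≤ r := mul_le_of_le_one_left hr.le hη1
  obtain ⟨t, ht, hA⟩ := h.abs_A_contact (KBφ N) hy hz he hs
  obtain ⟨ξ, hξ⟩ : ∃ ξ, ξ = y + t • (z - y) := ⟨_, rfl⟩
  rw [← hξ, ← hD] at hA
  have hP := h.psd (KBφ N) ξ hs (h.neg_le_A ξ hs)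
  have hff := h.psd_trace (KBφ N) (fun σ hσ => (phi_pos N hσ).le) ξ hs (h.neg_le_A ξ hs) (z - y)
  have hcs := hP.cauchy e (z - y)
  have hH := h.harnack_phi_near he hs hsr (x := ξ) (y := y) (by
    rw [hξ, add_sub_cancel_left, norm_smul, Real.norm_eq_abs, abs_of_pos ht.1]
    nlinarith [ht.2, ht.1, norm_nonneg (z - y)])
  have hee : A u (phi N) ξ (η * r) e e + μ * c0 N * ⟪e, e⟫ ≤ a ^ 2 / T := by
    rw [real_inner_self_eq_norm_sq, he]
    have e1 : r / (η * r) = η⁻¹ := by field_simp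
    rw [e1] at hH
    have h2 : 9 ^ (N + 8) * η⁻¹ ^ N * Bf u μ (phi N) y r e ≤
        9 ^ (N + 8) * η⁻¹ ^ N * (a ^ 2 * η ^ N / (9 ^ (N + 8) * T)) := by gcongr
    have e2 : 9 ^ (N + 8) * η⁻¹ ^ N * (a ^ 2 * η ^ N / (9 ^ (N + 8) * T)) = a ^ 2 / T := by
      rw [inv_pow]; field_simp
    unfold Bf at hH h2
    linarith
  have hff2 : A u (phi N) ξ (η * r) (z - y) (z - y) + μ * c0 N * ⟪z - y, z - y⟫ ≤ T * r ^ 2 := by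
    refine hff.trans ?_
    rw [hT, hcc]
    gcongr
  have h3 : (A u (phi N) ξ (η * r) e (z - y) + μ * c0 N * ⟪e, z - y⟫) ^ 2 ≤ (a * r) ^ 2 :=
    calc _ ≤ _ := hcs
      _ ≤ (a ^ 2 / T) * (T * r ^ 2) := mul_le_mul hee hff2 (hP.nonneg _) (by positivity)
      _ = (a * r) ^ 2 := by field_simp
  have h4 := abs_le.1 (abs_le_of_sq_le_sq h3 (by positivity))
  have h5 : 2 * D * (η * r) ≤ a * r := by
    rw [← mul_assoc]; exact mul_le_mul_of_nonneg_right hη2 hr.le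
  have h6 : |μ * c0 N * ⟪e, z - y⟫| ≤ 2 * (a * r) := by
    have := abs_le.1 hA
    rw [abs_le]
    obtain ⟨h7, h8⟩ := h4
    obtain ⟨h9, h10⟩ := this
    constructor <;> linarith
  rw [abs_mul, abs_of_pos (by positivity : 0 < μ * c0 N), real_inner_comm] at h6
  rw [ha, hcc] at h6
  refine le_of_mul_le_mul_left (h6.trans_eq (by ring) : μ * c0 N * _ ≤ μ * c0 N * _) (by positivity)

theorem MSol.Bf_dense (h : MSol M L μ Λ u) : ∃ ε > 0, ∀ y ∈ Λ, Dp Λ y → ∀ r, 0 < r →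
    ∀ e : EN N, ‖e‖ = 1 → ε ≤ Bf u μ (phi N) y r e := by
  obtain ⟨ε, hε, hth⟩ := h.thin_of_small
  have hC := Cω_pos N
  obtain ⟨η, hη⟩ : ∃ η, η = min 1 (ε / (2 * Cω N)) := ⟨_, rfl⟩
  have hη0 : 0 < η := by rw [hη]; positivity
  have hη1 : η ≤ 1 := hη ▸ min_le_left _ _
  have hη2 : Cω N * η ^ 2 ≤ ε / 2 := by
    have h1 : η ≤ ε / (2 * Cω N) := hη ▸ min_le_right _ _
    rw [le_div_iff₀ (by positivity)] at h1
    nlinarith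
  refine ⟨ε / 2 * η ^ N / 9 ^ (N + 8), by positivity, fun y hy hD r hr e he => ?_⟩
  by_contra! hlt
  have ht0 : 0 < η * r := by positivity
  have htr : η * r ≤ r := mul_le_of_le_one_left hr.le hη1
  have key : ∀ s, η * r ≤ s → s ≤ r → Bf u μ (phi N) y s e ≤ ε / 2 := fun s h1 h2 => by
    have hs : 0 < s := ht0.trans_le h1
    have h3 := h.harnack_phi_near he hs h2 (x := y) (y := y) (by rw [sub_self, norm_zero]; positivity)
    have h4 : r / s ≤ η⁻¹ := by
      rw [div_le_iff₀ hs, inv_mul_eq_div, le_div_iff₀ hη0]; linarith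
    have h5 := h.Bf_nonneg (KBφ N) (fun σ hσ => (phi_pos N hσ).le) y he hr
    calc _ ≤ _ := h3
      _ ≤ 9 ^ (N + 8) * (η⁻¹) ^ N * (ε / 2 * η ^ N / 9 ^ (N + 8)) := by gcongr
      _ = ε / 2 := by rw [inv_pow]; field_simp
  have hp := h.persist he (l := ε - μ * c0 N) ht0 htr
    (fun s h1 _ h3 => hth y hy s h1 e he (by unfold Bf; linarith))
    (fun s h1 h2 => by have := key s h1 h2; unfold Bf at this; linarith)
    (by
      have := key _ le_rfl htr
      have e1 : η * r / r = η := by field_simp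
      rw [e1]
      unfold Bf at this
      linarith)
  obtain ⟨h0, h0p, hnt⟩ := hD.not_thin
  have hq : 0 < min (h0 / 2) (η * r) := by positivity
  have hq1 : min (h0 / 2) (η * r) ≤ h0 / 2 := min_le_left _ _
  refine hnt _ hq (by linarith) e he (hth y hy _ hq e he ?_)
  have := hp _ hq (min_le_right _ _)
  unfold Bf
  linarith

theorem kr_bet_antitone {x w : EN N} {r s : ℝ} (hr : 0 < r) (hrs : r ≤ s) :
    kr bet (r⁻¹ • (w - x)) ≤ kr bet (s⁻¹ • (w - x)) := by
  refine bet_antitone ?_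
  have hs := hr.trans_le hrs
  rw [norm_smul, norm_smul, norm_inv, norm_inv, Real.norm_eq_abs, Real.norm_eq_abs,
    abs_of_pos hs, abs_of_pos hr]
  gcongr

theorem GSol.A_bet_sub_le (h : GSol M Λ u) {x e : EN N} (he : ‖e‖ = 1) {a b : ℝ} (ha : 0 < a)
    (hab : a ≤ b) : A u bet x b e e - A u bet x a e e ≤
      (b / a) ^ N * I (la Λ) (kr bet) x b / a * (b - a) := by
  have hb := ha.trans_le hab
  have hder : ∀ t, 0 < t → HasDerivAt (fun r => A u bet x r e e)
      (-(t⁻¹ * I (la Λ) (kq bet e e) x t)) t := fun t ht => h.hasDerivAt_A' (KBβ N) x e e ht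
  have hI0 : 0 ≤ ∫ w, la Λ w * kr bet (b⁻¹ • (w - x)) :=
    integral_nonneg fun w => mul_nonneg (la_nonneg _ _) (bet_nonneg _)
  refine (convex_Icc a b).image_sub_le_mul_sub_of_deriv_le
    (fun t ht => (hder t (ha.trans_le ht.1)).continuousAt.continuousWithinAt)
    (fun t ht => by
      rw [interior_Icc] at ht
      exact (hder t (ha.trans ht.1)).differentiableAt.differentiableWithinAt) (fun t ht => ?_)
    a (left_mem_Icc.2 hab) b (right_mem_Icc.2 hab) hab
  rw [interior_Icc] at ht
  have ht0 := ha.trans ht.1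
  rw [(hder t ht0).deriv, ← mul_neg, ← I_neg_kernel]
  have h1 : I (la Λ) (fun z => -kq bet e e z) x t ≤ I (la Λ) (kr bet) x t := by
    refine integral_mono ?_ (integrable_z (QG_la Λ) (aesm_la h.closed) (KBβ N).kr.continuous
      (KBβ N).kr.bound x ht0) fun z => mul_le_mul_of_nonneg_left ?_ (la_nonneg _ _)
    · have := (integrable_z (QG_la Λ) (aesm_la h.closed) ((KBβ N).kq e e).continuous
        ((KBβ N).kq e e).bound x ht0).neg
      refine this.congr (Eventually.of_forall fun z => ?_)
      simp
    · have h2 := deriv_bet_nonpos (‖z‖ ^ 2)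
      unfold kq kr
      rw [real_inner_self_eq_norm_sq, he]
      nlinarith [mul_self_nonneg ⟪z, e⟫]
  have h3 : I (la Λ) (kr bet) x t ≤ (b / a) ^ N * I (la Λ) (kr bet) x b := by
    rw [I_eq _ _ _ ht0, I_eq _ _ _ hb]
    have h4 : ∫ w, la Λ w * kr bet (t⁻¹ • (w - x)) ≤ ∫ w, la Λ w * kr bet (b⁻¹ • (w - x)) := by
      refine integral_mono (integrable_w (QG_la Λ) (aesm_la h.closed) (KBβ N).kr.continuous
        (KBβ N).kr.bound x ht0) (integrable_w (QG_la Λ) (aesm_la h.closed) (KBβ N).kr.continuous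
        (KBβ N).kr.bound x hb) fun w => mul_le_mul_of_nonneg_left ?_ (la_nonneg _ _)
      exact kr_bet_antitone ht0 ht.2.le
    have e1 : (b / a) ^ N * ((b ^ N)⁻¹ * ∫ w, la Λ w * kr bet (b⁻¹ • (w - x))) =
        (a ^ N)⁻¹ * ∫ w, la Λ w * kr bet (b⁻¹ • (w - x)) := by
      rw [div_pow]; field_simp
    rw [e1]
    have := ht.1.le
    refine mul_le_mul (by gcongr) h4 (integral_nonneg fun w => mul_nonneg (la_nonneg _ _)
      (bet_nonneg _)) (by positivity)
  have h5 : 0 ≤ (b / a) ^ N * I (la Λ) (kr bet) x b := by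
    rw [I_eq _ _ _ hb]; positivity
  calc t⁻¹ * I (la Λ) (fun z => -kq bet e e z) x t
      ≤ t⁻¹ * ((b / a) ^ N * I (la Λ) (kr bet) x b) := by gcongr; exact h1.trans h3
    _ ≤ a⁻¹ * ((b / a) ^ N * I (la Λ) (kr bet) x b) := by have := ht.1.le; gcongr
    _ = _ := by rw [inv_mul_eq_div]

theorem phi_le_one {σ : ℝ} (hσ : 0 ≤ σ) : phi N σ ≤ 1 := by
  unfold phi
  exact inv_le_one_of_one_le₀ (one_le_pow₀ (by linarith))

theorem I_la_bet_eq_zero {x : EN N} {d : ℝ} (hd0 : 0 < d) (hd : d ≤ infDist x Λ) :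
    I (la Λ) (kr bet) x d = 0 := by
  unfold I
  rw [integral_eq_zero_of_ae]
  refine Eventually.of_forall fun z => ?_
  by_cases hz : x + d • z ∈ Λ
  · have h1 := infDist_le_norm (x := x) _ hz
    rw [add_sub_cancel_left, norm_smul, Real.norm_eq_abs, abs_of_pos hd0] at h1
    have h2 : 1 ≤ ‖z‖ := by
      by_contra! hh; nlinarith
    simp only [kr, Pi.zero_apply]
    rw [bet_eq_zero (one_le_pow₀ h2), mul_zero]
  · simp [la_of_notMem hz]

theorem MSol.Bf_bet_lower (h : MSol M L μ Λ u) {ε : ℝ} (hε : 0 < ε)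
    (hq : ∀ y ∈ Λ, Dp Λ y → ∀ r, 0 < r → ∀ e : EN N, ‖e‖ = 1 → ε ≤ Bf u μ (phi N) y r e)
    {η : ℝ} (hη : 0 < η) : ∃ ε' > 0, ∀ x, 0 < infDist x Λ → ∀ e : EN N, ‖e‖ = 1 →
      ε' ≤ Bf u μ bet x ((1 + η) * infDist x Λ) e := by
  have hL := h.L_nonneg
  have hμ := h.pos
  obtain ⟨Y, hY⟩ : ∃ Y, Y = (L + μ) * ∫ z : EN N, wt z := ⟨_, rfl⟩
  have hY0 : 0 ≤ Y := by
    rw [hY]; exact mul_nonneg (by positivity) (integral_nonneg fun z => (wt_pos z).le)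
  obtain ⟨τ, hτ⟩ : ∃ τ, τ = min 1 (ε * η ^ 2 / (32 * (Y + 1))) := ⟨_, rfl⟩
  have hτ0 : 0 < τ := by rw [hτ]; positivity
  have hτ1 : τ ≤ 1 := hτ ▸ min_le_left _ _
  have hτ2 : 16 * τ ^ 2 / η ^ 2 * Y ≤ ε / 2 := by
    have h1 : τ ≤ ε * η ^ 2 / (32 * (Y + 1)) := hτ ▸ min_le_right _ _
    rw [le_div_iff₀ (by positivity)] at h1
    rw [div_mul_eq_mul_div, div_le_iff₀ (by positivity)]
    have h2 : τ ^ 2 * Y ≤ τ * (Y + 1) := by nlinarith [mul_nonneg hτ0.le hY0]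
    nlinarith
  obtain ⟨ρ, hρ⟩ : ∃ ρ, ρ = (1 + η / 2) / (1 + η) := ⟨_, rfl⟩
  have hρ0 : 0 < ρ := by rw [hρ]; positivity
  have hρ1 : ρ < 1 := by rw [hρ, div_lt_one (by positivity)]; linarith
  obtain ⟨b, hb⟩ : ∃ b, b = bet (ρ ^ 2) := ⟨_, rfl⟩
  have hb0 : 0 < b := hb ▸ bet_pos (by nlinarith)
  refine ⟨ε / 2 * b * (τ / (1 + η)) ^ N, by positivity, fun x hx e he => ?_⟩
  obtain ⟨d, hd⟩ : ∃ d, d = infDist x Λ := ⟨_, rfl⟩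
  rw [← hd] at hx ⊢
  obtain ⟨y, hy, hyD, hxy⟩ := h.exists_near (x := x) (d := (1 + η / 4) * d) (by
    rw [← hd]; nlinarith)
  have hτd : 0 < τ * d := by positivity
  have hs : 0 < (1 + η) * d := by positivity
  have hH := h.harnack (KBφ N) (KBβ N) (x := y) (y := x) he (K := b⁻¹) (K2 := 16 * τ ^ 2 / η ^ 2)
    hτd hs (by positivity) (fun w => ?_)
  · have h1 := hq y hy hyD _ hτd e he
    have e1 : (1 + η) * d / (τ * d) = (1 + η) / τ := by field_simp
    rw [e1, mul_assoc (16 * τ ^ 2 / η ^ 2), ← hY] at hH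
    have h2 : ε / 2 ≤ b⁻¹ * ((1 + η) / τ) ^ N * Bf u μ bet x ((1 + η) * d) e := by linarith
    calc ε / 2 * b * (τ / (1 + η)) ^ N ≤
        b⁻¹ * ((1 + η) / τ) ^ N * Bf u μ bet x ((1 + η) * d) e * b * (τ / (1 + η)) ^ N := by gcongr
      _ = Bf u μ bet x ((1 + η) * d) e := by rw [div_pow, div_pow]; field_simp
  · obtain ⟨z, hz⟩ : ∃ z, z = (τ * d)⁻¹ • (w - y) := ⟨_, rfl⟩
    rw [← hz]
    have hwz := wt_pos z
    have hphi1 : kr (phi N) z ≤ 1 := phi_le_one (sq_nonneg _)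
    have hK2 : 0 ≤ 16 * τ ^ 2 / η ^ 2 := by positivity
    rcases le_or_gt ‖w - x‖ ((1 + η / 2) * d) with hwx | hwx
    · have h1 : b ≤ kr bet (((1 + η) * d)⁻¹ • (w - x)) := by
        rw [hb]
        refine bet_antitone ?_
        rw [norm_smul, norm_inv, Real.norm_eq_abs, abs_of_pos hs]
        refine pow_le_pow_left₀ (by positivity) ?_ 2
        rw [inv_mul_le_iff₀ hs, hρ]
        exact hwx.trans_eq (by field_simp)
      have h2 : 1 ≤ b⁻¹ * kr bet (((1 + η) * d)⁻¹ • (w - x)) := by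
        rw [inv_mul_eq_div, one_le_div hb0]; exact h1
      have := mul_nonneg hK2 hwz.le
      linarith
    · have h1 : η / 4 * d ≤ ‖w - y‖ := by
        have e1 : w - x = (w - y) - (x - y) := by abel
        have := norm_sub_le (w - y) (x - y)
        rw [← e1] at this
        nlinarith
      have h2 : η / (4 * τ) ≤ ‖z‖ := by
        rw [hz, norm_smul, norm_inv, Real.norm_eq_abs, abs_of_pos hτd, inv_mul_eq_div,
          div_le_div_iff₀ (by positivity) hτd]
        nlinarith
      have h3 : 1 ≤ 16 * τ ^ 2 / η ^ 2 * (1 + ‖z‖ ^ 2) ^ 2 := by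
        have h4 : (η / (4 * τ)) ^ 2 ≤ (1 + ‖z‖ ^ 2) ^ 2 := by
          calc (η / (4 * τ)) ^ 2 ≤ ‖z‖ ^ 2 := by gcongr
            _ ≤ _ := by nlinarith [sq_nonneg ‖z‖]
        calc (1 : ℝ) = 16 * τ ^ 2 / η ^ 2 * (η / (4 * τ)) ^ 2 := by field_simp; norm_num
          _ ≤ _ := by gcongr
      have h5 : kr (phi N) z * (1 + ‖z‖ ^ 2) ^ 2 = wt z := by
        have := one_add_pos z
        unfold kr phi wt
        rw [show N + 8 = (N + 6) + 2 by ring, pow_add]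
        field_simp
      have h6 : 0 ≤ kr (phi N) z := (phi_pos N (sq_nonneg _)).le
      have h7 : 0 ≤ b⁻¹ * kr bet (((1 + η) * d)⁻¹ • (w - x)) :=
        mul_nonneg (by positivity) (bet_nonneg _)
      have h8 := mul_le_mul_of_nonneg_left h3 h6
      rw [← h5]
      nlinarith

theorem MSol.Bf_lower (h : MSol M L μ Λ u) : ∃ ε > 0, ∀ x r, 0 < r → ∀ e : EN N, ‖e‖ = 1 →
    ε ≤ Bf u μ (phi N) x r e := by
  have hμ := h.pos
  obtain ⟨ε1, hε1, hq⟩ := h.Bf_dense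
  obtain ⟨η, hη⟩ : ∃ η, η = min 1 (μ / 2 ^ (N + 1)) := ⟨_, rfl⟩
  have hη0 : 0 < η := by rw [hη]; positivity
  have hη1 : η ≤ 1 := hη ▸ min_le_left _ _
  have hη2 : 2 ^ N * η ≤ μ / 2 := by
    have h1 : η ≤ μ / 2 ^ (N + 1) := hη ▸ min_le_right _ _
    rw [le_div_iff₀ (by positivity), pow_succ] at h1
    linarith
  obtain ⟨ε3, hε3, hb⟩ := h.Bf_bet_lower hε1 hq hη0
  refine ⟨min (ε1 / 9 ^ (N + 8)) (ε3 / 2 / 2 ^ (N + 8)), by positivity, fun x r hr e he => ?_⟩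
  rcases lt_or_ge (infDist x Λ) (2 * r) with hd | hd
  · refine (min_le_left _ _).trans ?_
    obtain ⟨y, hy, hyD, hxy⟩ := h.exists_near hd
    have h1 := h.harnack_phi_near he hr le_rfl (x := y) (y := x) (by
      rw [norm_sub_rev]; exact hxy.le)
    rw [div_self hr.ne', one_pow, mul_one] at h1
    rw [div_le_iff₀ (by positivity), mul_comm]
    exact (hq y hy hyD r hr e he).trans h1
  · refine (min_le_right _ _).trans ?_
    obtain ⟨d, hdd⟩ : ∃ d, d = infDist x Λ := ⟨_, rfl⟩
    rw [← hdd] at hd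
    have hd0 : 0 < d := by linarith
    have h1 := hb x (hdd ▸ hd0) e he
    rw [← hdd] at h1
    have hs : 0 < (1 + η) * d := by positivity
    have h2 := h.A_bet_sub_le (x := x) he hd0 (b := (1 + η) * d) (by nlinarith)
    have h3 := h.A_bet_sub_le (x := x) he hr (b := d) (by linarith)
    rw [I_la_bet_eq_zero hd0 hdd.le] at h3
    have h4 := h.Bf_ge_la (KBβ N) (fun σ _ => bet_nonneg σ) x he hs
    have hG : 0 ≤ I (la Λ) (kr bet) x ((1 + η) * d) :=
      integral_nonneg fun z => mul_nonneg (la_nonneg _ _) (bet_nonneg _)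
    have e1 : (1 + η) * d / d = 1 + η := by field_simp
    have e2 : (1 + η) * d - d = η * d := by ring
    rw [e1, e2] at h2
    have h5 : (1 + η) ^ N * I (la Λ) (kr bet) x ((1 + η) * d) / d * (η * d) ≤
        μ / 2 * I (la Λ) (kr bet) x ((1 + η) * d) := by
      calc _ = ((1 + η) ^ N * η) * I (la Λ) (kr bet) x ((1 + η) * d) := by field_simp
        _ ≤ (2 ^ N * η) * I (la Λ) (kr bet) x ((1 + η) * d) := by gcongr; linarith
        _ ≤ _ := by gcongr
    have h6 : ε3 / 2 ≤ Bf u μ bet x r e := by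
      unfold Bf at h1 h4 ⊢
      have e3 : (d / r) ^ N * 0 / r * (d - r) = 0 := by ring
      rw [e3] at h3
      linarith
    have h7 := h.harnack (KBβ N) (KBφ N) (x := x) (y := x) he (K := 2 ^ (N + 8)) (K2 := 0) hr hr
      le_rfl (fun w => by
        rw [zero_mul, add_zero]
        obtain ⟨z, hz⟩ : ∃ z, z = r⁻¹ • (w - x) := ⟨_, rfl⟩
        rw [← hz]
        have hp : 0 < phi N (‖z‖ ^ 2) := phi_pos N (sq_nonneg _)
        unfold kr
        rcases le_or_gt 1 (‖z‖ ^ 2) with h8 | h8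
        · rw [bet_eq_zero h8]; positivity
        · refine (bet_le_one _).trans ?_
          unfold phi
          rw [← div_eq_mul_inv, one_le_div (by positivity)]
          gcongr; linarith)
    rw [div_self hr.ne', one_pow, mul_one, zero_mul, zero_mul, add_zero] at h7
    rw [div_le_iff₀ (by positivity), mul_comm]
    exact h6.trans h7

theorem Mono.mono {a b : ℝ} (h : Mono u a) (hab : a ≤ b) : Mono u b := fun y z => by
  have := h y z
  nlinarith [sq_nonneg ‖z - y‖]

theorem FSol.mono_zero (h : FSol M Λ u) : Mono u 0 := by
  obtain ⟨K, K0, hK⟩ := h.A_lower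
  obtain ⟨L, L0, hL⟩ := h.lipschitz_of_lower K0 hK
  have hM := h.mono_of_lower hK
  have hc := c0_pos N
  obtain ⟨S, hS⟩ : ∃ S, S = {m : ℝ | 0 ≤ m ∧ Mono u m} := ⟨_, rfl⟩
  have hSne : S.Nonempty := ⟨K / c0 N, by rw [hS]; exact ⟨by positivity, hM⟩⟩
  have hSb : BddBelow S := ⟨0, fun m hm => by rw [hS] at hm; exact hm.1⟩
  have hScl : IsClosed S := by
    have : S = Ici 0 ∩ ⋂ y : EN N, ⋂ z : EN N,
        {m : ℝ | -(m * ‖z - y‖ ^ 2) ≤ fderiv ℝ u z (z - y) - fderiv ℝ u y (z - y)} := by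
      rw [hS]; ext m; simp [Mono]
    rw [this]
    exact isClosed_Ici.inter (isClosed_iInter fun y => isClosed_iInter fun z =>
      isClosed_le (by fun_prop) continuous_const)
  have hm := hScl.csInf_mem hSne hSb
  obtain ⟨m, hmm⟩ : ∃ m, m = sInf S := ⟨_, rfl⟩
  rw [← hmm, hS] at hm
  rcases hm.1.eq_or_lt with h0 | h0
  · rw [h0]; exact hm.2
  · exfalso
    have hms : MSol M L m Λ u := ⟨h, L0, h0, hL, hm.2⟩
    obtain ⟨ε, hε, hB⟩ := hms.Bf_lower
    have h1 := h.mono_of_lower (K := m * c0 N - ε) (fun x r hr e he => by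
      have := hB x r hr e he
      unfold Bf at this
      linarith)
    have h2 : (m * c0 N - ε) / c0 N < m := by
      rw [div_lt_iff₀ hc]; linarith
    have h3 : max ((m * c0 N - ε) / c0 N) 0 ∈ S := by
      rw [hS]; exact ⟨le_max_right _ _, h1.mono (le_max_left _ _)⟩
    have h4 := csInf_le hSb h3
    rw [← hmm] at h4
    exact absurd (max_lt h2 h0) (not_lt.2 h4)

end GlobalSol

namespace GlobalSol
variable {N : ℕ}
variable {M : ℝ} {Λ : Set (EN N)} {u : EN N → ℝ}

theorem hasDerivAt_line (h : ContDiff ℝ 1 u) (y v : EN N) (t : ℝ) :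
    HasDerivAt (fun t : ℝ => u (y + t • v)) (fderiv ℝ u (y + t • v) v) t := by
  have h1 : HasDerivAt (fun t : ℝ => y + t • v) v t := by
    simpa using ((hasDerivAt_id t).smul_const v).const_add y
  exact ((h.differentiable one_ne_zero _).hasFDerivAt).comp_hasDerivAt t h1

theorem Mono.le_sub (hm : Mono u 0) (h : ContDiff ℝ 1 u) (y z : EN N) :
    fderiv ℝ u y (z - y) ≤ u z - u y := by
  have hd := hasDerivAt_line h y (z - y)
  obtain ⟨t, ht, he⟩ := exists_hasDerivAt_eq_slope (fun t : ℝ => u (y + t • (z - y))) _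
    one_pos (fun t _ => (hd t).continuousAt.continuousWithinAt) (fun t _ => hd t)
  simp only [one_smul, zero_smul, add_zero, add_sub_cancel, sub_zero, div_one] at he
  rw [← he]
  have h1 := hm y (y + t • (z - y))
  rw [add_sub_cancel_left, map_smul, map_smul, smul_eq_mul, smul_eq_mul, zero_mul, neg_zero,
    ← mul_sub] at h1
  have := nonneg_of_mul_nonneg_right h1 ht.1
  linarith

theorem Mono.convexOn (hm : Mono u 0) (h : ContDiff ℝ 1 u) : ConvexOn ℝ univ u := by
  refine ⟨convex_univ, fun y _ z _ a b ha hb hab => ?_⟩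
  obtain ⟨p, hp⟩ : ∃ p, p = a • y + b • z := ⟨_, rfl⟩
  rw [← hp]
  have h1 := mul_le_mul_of_nonneg_left (hm.le_sub h p y) ha
  have h2 := mul_le_mul_of_nonneg_left (hm.le_sub h p z) hb
  have h3 : a * fderiv ℝ u p (y - p) + b * fderiv ℝ u p (z - p) = 0 := by
    rw [← smul_eq_mul, ← smul_eq_mul, ← map_smul, ← map_smul, ← map_add]
    have : a • (y - p) + b • (z - p) = 0 := by
      have e1 : a • (y - p) + b • (z - p) = a • y + b • z - (a + b) • p := by module
      rw [e1, hab, one_smul, hp, sub_self]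
    rw [this, map_zero]
  simp only [smul_eq_mul]
  have h4 : u p = a * u p + b * u p := by rw [← add_mul, hab, one_mul]
  linarith

theorem GSol.disjoint_interior_zero (h : GSol M Λ u) :
    interior {x | u x = 0} ⊆ Λ := by
  intro p hp
  by_contra hpΛ
  have hU : IsOpen (interior {x | u x = 0} ∩ Λᶜ) := isOpen_interior.inter h.closed.isOpen_compl
  obtain ⟨φ, hφt, hφc, hφs, hφr, hφp⟩ := exists_contDiff_tsupport_subset (n := (⊤ : ℕ∞))
    (hU.mem_nhds ⟨hp, hpΛ⟩)
  have h1 := h.weak φ hφs hφc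
  have h2 : ∀ x, u x * lap N φ x = 0 := fun x => by
    by_cases hx : x ∈ tsupport φ
    · have h3 : x ∈ {x | u x = 0} := interior_subset (hφt hx).1
      rw [show u x = 0 from h3, zero_mul]
    · have : lap N φ x = 0 := by
        have e1 : φ =ᶠ[nhds x] fun _ => 0 := notMem_tsupport_iff_eventuallyEq.1 hx
        unfold lap
        refine Finset.sum_eq_zero fun i _ => ?_
        have e2 : (fun y => fderiv ℝ φ y (EuclideanSpace.single i 1)) =ᶠ[nhds x] fun _ => 0 := by
          filter_upwards [e1.eventuallyEq_nhds] with y hy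
          rw [hy.fderiv_eq]; simp
        rw [e2.fderiv_eq]; simp
      rw [this, mul_zero]
  have h0 : ∀ x, 0 ≤ φ x := fun x => (hφr (mem_range_self x)).1
  rw [integral_congr_ae (Eventually.of_forall h2), integral_zero,
    setIntegral_eq_integral_of_forall_compl_eq_zero (fun x hx => by
      by_contra hne
      exact hx (hφt (subset_tsupport φ hne)).2)] at h1
  have h3 := hφs.continuous.integral_pos_of_hasCompactSupport_nonneg_nonzero (μ := volume) hφc h0
    (x := p) (by rw [hφp]; exact one_ne_zero)
  linarith

theorem GSol.convex_zero (h : GSol M Λ u) (hm : Mono u 0) (h0 : (0 : EN N) ∈ Λ)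
    (hv : volume Λ ≠ 0) : (∀ x, 0 ≤ u x) ∧ Λ = {x | u x = 0} ∧ Convex ℝ Λ ∧
      (interior Λ).Nonempty := by
  have hnn : ∀ x, 0 ≤ u x := fun x => by
    have := hm.le_sub h.smooth 0 x
    rw [(h.zero 0 h0).1, (h.zero 0 h0).2] at this
    simpa using this
  have hsub : Λ ⊆ {x | u x = 0} := fun x hx => (h.zero x hx).1
  have hZ : Convex ℝ {x | u x = 0} := by
    have := (hm.convexOn h.smooth).convex_le 0
    convert this using 1
    ext x
    simp only [mem_ofPred_eq, mem_univ, true_and]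
    exact ⟨fun hx => hx.le, fun hx => le_antisymm hx (hnn x)⟩
  have hZc : IsClosed {x | u x = 0} := isClosed_eq h.continuous continuous_const
  have hint : (interior {x | u x = 0}).Nonempty := by
    by_contra hne
    rw [not_nonempty_iff_eq_empty] at hne
    have h1 := hZ.addHaar_frontier volume
    rw [hZc.frontier_eq, hne, sdiff_empty] at h1
    exact hv (measure_mono_null hsub h1)
  have heq : Λ = {x | u x = 0} := by
    refine hsub.antisymm fun x hx => ?_
    have h1 := hZ.closure_interior_eq_closure_of_nonempty_interior hint
    rw [hZc.closure_eq] at h1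
    have h2 := closure_mono h.disjoint_interior_zero
    rw [h1, h.closed.closure_eq] at h2
    exact h2 hx
  exact ⟨hnn, heq, heq ▸ hZ, heq ▸ hint⟩

theorem MD_le {D : Set (EN N)} (hD : D.Nonempty) {e : EN N} (he : ‖e‖ = 1) {c : ℝ}
    (h : ∀ x ∈ D, |⟪x, e⟫| ≤ c) : MD N D ≤ 2 * c := by
  have := hD.to_subtype
  obtain ⟨x0, hx0⟩ := hD
  have hc : 0 ≤ c := (abs_nonneg _).trans (h x0 hx0)
  unfold MD
  by_cases hb : BddBelow (range fun e : {e : EN N // ‖e‖ = 1} =>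
      ((⨆ x : D, ⟪(x : EN N), (e : EN N)⟫) - ⨅ x : D, ⟪(x : EN N), (e : EN N)⟫))
  · refine (ciInf_le hb ⟨e, he⟩).trans ?_
    have h1 : (⨆ x : D, ⟪(x : EN N), e⟫) ≤ c := ciSup_le fun x => (abs_le.1 (h x x.2)).2
    have h2 : -c ≤ ⨅ x : D, ⟪(x : EN N), e⟫ := le_ciInf fun x => (abs_le.1 (h x x.2)).1
    show (⨆ x : D, ⟪(x : EN N), e⟫) - (⨅ x : D, ⟪(x : EN N), e⟫) ≤ 2 * c
    linarith
  · rw [Real.iInf_of_not_bddBelow hb]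
    positivity

/-- The recession cone at the origin. -/
def recCone (Λ : Set (EN N)) : Set (EN N) := {x | ∀ t : ℝ, 0 ≤ t → t • x ∈ Λ}

theorem isClosed_rec (h : IsClosed Λ) : IsClosed (recCone Λ) := by
  have : recCone Λ = ⋂ t : ℝ, ⋂ _ : 0 ≤ t, (fun x : EN N => t • x) ⁻¹' Λ := by
    ext x; simp [recCone]
  rw [this]
  exact isClosed_iInter fun t => isClosed_iInter fun _ => h.preimage (continuous_const_smul t)

theorem rec_subset : recCone Λ ⊆ Λ := fun x hx => by simpa using hx 1 zero_le_one

theorem zero_mem_rec (h : (0 : EN N) ∈ Λ) : (0 : EN N) ∈ recCone Λ := fun t _ => by simpa using h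

theorem convex_rec (h : Convex ℝ Λ) : Convex ℝ (recCone Λ) := by
  intro x hx y hy a b ha hb hab t ht
  have := h (hx t ht) (hy t ht) ha hb hab
  rw [smul_add, smul_comm t a, smul_comm t b]
  exact this

theorem smul_mem_rec {x : EN N} (hx : x ∈ recCone Λ) {s : ℝ} (hs : 0 ≤ s) : s • x ∈ recCone Λ :=
  fun t ht => by rw [smul_smul]; exact hx _ (mul_nonneg ht hs)

theorem add_mem_rec (h : Convex ℝ Λ) {x y : EN N} (hx : x ∈ recCone Λ) (hy : y ∈ recCone Λ) :
    x + y ∈ recCone Λ := by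
  have := convex_rec h (smul_mem_rec hx zero_le_two) (smul_mem_rec hy zero_le_two)
    (by norm_num : (0 : ℝ) ≤ 1 / 2) (by norm_num : (0 : ℝ) ≤ 1 / 2) (by norm_num)
  rw [smul_smul, smul_smul] at this
  norm_num at this
  exact this

theorem exists_normal_of_interior_empty {K : Set (EN N)} (hK : Convex ℝ K) (h0 : (0 : EN N) ∈ K)
    (he : ¬(interior K).Nonempty) : ∃ e : EN N, ‖e‖ = 1 ∧ ∀ x ∈ K, ⟪x, e⟫ = 0 := by
  have h1 : Submodule.span ℝ K ≠ ⊤ := fun hs => by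
    refine he (hK.interior_nonempty_iff_affineSpan_eq_top.2 ?_)
    rw [AffineSubspace.affineSpan_eq_top_iff_vectorSpan_eq_top_of_nonempty ℝ _ _ ⟨0, h0⟩,
      vectorSpan_eq_span_vsub_set_right ℝ h0]
    simpa using hs
  have h2 : (Submodule.span ℝ K)ᗮ ≠ ⊥ := fun hb => h1 ((Submodule.orthogonal_eq_bot_iff).1 hb)
  obtain ⟨w, hw, hw0⟩ := Submodule.exists_mem_ne_zero_of_ne_bot h2
  obtain ⟨v, hv, hwv⟩ := exists_unit w hw0
  refine ⟨v, hv, fun x hx => ?_⟩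
  have h3 := (Submodule.mem_orthogonal _ w).1 hw x (Submodule.subset_span hx)
  rw [hwv, real_inner_smul_right] at h3
  exact (mul_eq_zero.1 h3).resolve_left (norm_ne_zero_iff.2 hw0)

theorem smul_mem_of_le (hconv : Convex ℝ Λ) (h0 : (0 : EN N) ∈ Λ) {z : EN N} {s t : ℝ}
    (hs : 0 ≤ s) (hst : s ≤ t) (ht : t • z ∈ Λ) : s • z ∈ Λ := by
  rcases hs.eq_or_lt with hs0 | hs0
  · rw [← hs0, zero_smul]; exact h0
  have := hconv.smul_mem_of_zero_mem h0 ht (t := s / t)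
    ⟨div_nonneg hs (hs.trans hst), div_le_one_of_le₀ hst (hs.trans hst)⟩
  rwa [smul_smul, div_mul_cancel₀ _ (hs0.trans_le hst).ne'] at this

theorem eventually_thin (hcl : IsClosed Λ) (hconv : Convex ℝ Λ) (h0 : (0 : EN N) ∈ Λ) {e : EN N}
    (hC : ∀ x ∈ recCone Λ, ⟪x, e⟫ = 0) {c : ℝ} (hc : 0 < c) :
    ∀ᶠ R : ℝ in atTop, ∀ z ∈ Λ, ‖z‖ ≤ R → |⟪z, e⟫| ≤ c * R := by
  obtain ⟨K, hK⟩ : ∃ K : ℕ → Set (EN N), K = fun n : ℕ => closedBall 0 1 ∩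
    ((fun x : EN N => ((n : ℝ) + 1) • x) ⁻¹' Λ ∩ {x | c ≤ |⟪x, e⟫|}) := ⟨_, rfl⟩
  have hKc : ∀ n, IsClosed (K n) := fun n => by
    rw [hK]
    exact isClosed_closedBall.inter ((hcl.preimage (continuous_const_smul _)).inter
      (isClosed_le continuous_const (by fun_prop)))
  have hK0 : IsCompact (K 0) :=
    (isCompact_closedBall (0 : EN N) 1).of_isClosed_subset (hKc 0) (by rw [hK]; exact inter_subset_left)
  have hempty : ∃ n, K n = ∅ := by
    by_contra! hne
    obtain ⟨x, hx⟩ := IsCompact.nonempty_iInter_of_sequence_nonempty_isCompact_isClosed K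
      (fun n => by
        rw [hK]
        rintro x ⟨h1, h2, h3⟩
        exact ⟨h1, smul_mem_of_le hconv h0 (by positivity) (by push_cast; linarith) h2, h3⟩)
      hne hK0 hKc
    rw [mem_iInter] at hx
    have hxr : x ∈ recCone Λ := fun t ht => by
      obtain ⟨n, hn⟩ := exists_nat_ge t
      have := hx n
      rw [hK] at this
      exact smul_mem_of_le hconv h0 ht (by linarith) this.2.1
    have := hx 0
    rw [hK] at this
    have h3 : c ≤ |⟪x, e⟫| := this.2.2
    rw [hC x hxr, abs_zero] at h3
    linarith
  obtain ⟨n, hn⟩ := hempty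
  filter_upwards [eventually_ge_atTop ((n : ℝ) + 1)] with R hR z hz hzR
  have hn0 : (0 : ℝ) < (n : ℝ) + 1 := by positivity
  have hR0 : 0 < R := hn0.trans_le hR
  by_contra! hlt
  have hx : R⁻¹ • z ∈ K n := by
    rw [hK]
    refine ⟨?_, ?_, ?_⟩
    · rw [mem_closedBall_zero_iff, norm_smul, norm_inv, Real.norm_eq_abs, abs_of_pos hR0,
        inv_mul_le_iff₀ hR0]
      linarith
    · refine smul_mem_of_le hconv h0 (t := R) hn0.le hR ?_
      rwa [smul_smul, mul_inv_cancel₀ hR0.ne', one_smul]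
    · show c ≤ |⟪R⁻¹ • z, e⟫|
      rw [real_inner_smul_left, abs_mul, abs_of_pos (inv_pos.2 hR0), inv_mul_eq_div,
        le_div_iff₀ hR0]
      exact hlt.le
  rw [hn] at hx
  exact hx

theorem limsup_le_zero {f : ℝ → ℝ} (h : ∀ c > 0, ∀ᶠ R in atTop, f R ≤ c) :
    limsup f atTop ≤ 0 := by
  rw [limsup_eq]
  by_cases hb : BddBelow {a | ∀ᶠ n in atTop, f n ≤ a}
  · exact le_of_forall_gt_imp_ge_of_dense fun c hc => csInf_le hb (h c hc)
  · rw [Real.sInf_of_not_bddBelow hb]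

theorem interior_rec_nonempty (hcl : IsClosed Λ) (hconv : Convex ℝ Λ) (h0 : (0 : EN N) ∈ Λ)
    (hΛ : {x | u x = 0 ∧ gradient u x = 0} = Λ)
    (hd : 0 < limsup (fun R => deltaFn N u R) atTop) : (interior (recCone Λ)).Nonempty := by
  by_contra hne
  obtain ⟨e, he, hC⟩ := exists_normal_of_interior_empty (convex_rec hconv) (zero_mem_rec h0) hne
  refine absurd hd (not_lt.2 (limsup_le_zero fun c hc => ?_))
  filter_upwards [eventually_thin hcl hconv h0 hC (half_pos hc), eventually_gt_atTop 0] with R hR hR0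
  unfold deltaFn
  rw [hΛ, div_le_iff₀ hR0]
  refine (MD_le (D := Λ ∩ ball 0 R) ⟨0, h0, mem_ball_self hR0⟩ he (c := c / 2 * R) fun x hx => ?_).trans_eq (by ring)
  exact hR x hx.1 (mem_ball_zero_iff.1 hx.2).le

end GlobalSol

namespace GlobalSol
variable {N : ℕ}
variable {M : ℝ} {Λ : Set (EN N)} {u : EN N → ℝ}

theorem exists_supporting_normal (hcl : IsClosed Λ) (hconv : Convex ℝ Λ)
    (hint : (interior Λ).Nonempty) (h0 : (0 : EN N) ∉ interior Λ) :
    ∃ ν : EN N, ‖ν‖ = 1 ∧ ∀ x ∈ Λ, ⟪x, ν⟫ ≤ 0 := by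
  obtain ⟨f, hf⟩ := geometric_hahn_banach_open_point hconv.interior isOpen_interior h0
  rw [map_zero] at hf
  obtain ⟨w, hw⟩ : ∃ w, w = (InnerProductSpace.toDual ℝ (EN N)).symm f := ⟨_, rfl⟩
  have hfw : ∀ x, f x = ⟪x, w⟫ := fun x => by
    rw [real_inner_comm, hw, InnerProductSpace.toDual_symm_apply]
  have hw0 : w ≠ 0 := fun h => by
    obtain ⟨p, hp⟩ := hint
    have := hf p hp
    rw [hfw, h, inner_zero_right] at this
    exact lt_irrefl _ this
  obtain ⟨v, hv, hwv⟩ := exists_unit w hw0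
  refine ⟨v, hv, fun x hx => ?_⟩
  have h1 : closure (interior Λ) ⊆ {x | f x ≤ 0} :=
    closure_minimal (fun x hx => (hf x hx).le) (isClosed_le f.continuous continuous_const)
  rw [hconv.closure_interior_eq_closure_of_nonempty_interior hint, hcl.closure_eq] at h1
  have h2 : f x ≤ 0 := h1 hx
  rw [hfw, hwv, real_inner_smul_right] at h2
  exact nonpos_of_mul_nonpos_right h2 (norm_pos_iff.2 hw0)

theorem limit_nonpos {F J : ℝ → ℝ} {B c : ℝ}
    (hF : ∀ r, 0 < r → HasDerivAt F (-(r⁻¹ * J r)) r) (hB : ∀ r, 1 ≤ r → |F r| ≤ B)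
    (hJ : Tendsto J atTop (nhds c)) : c ≤ 0 := by
  by_contra! hc
  obtain ⟨R0, hR0⟩ := eventually_atTop.1 (hJ.eventually (eventually_ge_nhds (half_lt_self hc)))
  obtain ⟨R, hR⟩ : ∃ R, R = max R0 1 := ⟨_, rfl⟩
  have hR1 : 1 ≤ R := hR ▸ le_max_right _ _
  have hpos : ∀ x ∈ Ici R, 0 < x := fun x hx => one_pos.trans_le (hR1.trans hx)
  have hd : ∀ x ∈ Ici R, HasDerivAt (fun r => F r + c / 2 * Real.log r)
      (-(x⁻¹ * J x) + c / 2 * x⁻¹) x := fun x hx =>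
    (hF x (hpos x hx)).add ((Real.hasDerivAt_log (hpos x hx).ne').const_mul _)
  have hanti : AntitoneOn (fun r => F r + c / 2 * Real.log r) (Ici R) := by
    refine antitoneOn_of_deriv_nonpos (convex_Ici R)
      (fun x hx => (hd x hx).continuousAt.continuousWithinAt)
      (fun x hx => (hd x (interior_subset hx)).differentiableAt.differentiableWithinAt)
      fun x hx => ?_
    have hx' := interior_subset hx
    rw [(hd x hx').deriv]
    have h1 := hR0 x ((hR ▸ le_max_left R0 1).trans hx')
    have h2 := mul_le_mul_of_nonneg_left h1 (inv_pos.2 (hpos x hx')).le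
    linarith
  have hlog := (Real.tendsto_log_atTop.const_mul_atTop (half_pos hc)).eventually
    (eventually_gt_atTop (2 * B + c / 2 * Real.log R))
  obtain ⟨r, hr, hrR⟩ := (hlog.and (eventually_ge_atTop R)).exists
  have h1 := hanti (mem_Ici.2 le_rfl) (mem_Ici.2 hrR) hrR
  have h2 := abs_le.1 (hB R hR1)
  have h3 := abs_le.1 (hB r (hR1.trans hrR))
  simp only at h1
  linarith

theorem tendsto_I_rec (hcl : IsClosed Λ) (hconv : Convex ℝ Λ) (h0 : (0 : EN N) ∈ Λ)
    {k : EN N → ℝ} {C : ℝ} (hk : Ker k C) :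
    Tendsto (fun r => I (la Λ) k 0 r) atTop (nhds (I (la (recCone Λ)) k 0 1)) := by
  refine tendsto_integral_filter_of_dominated_convergence (fun z => |k z|) ?_ ?_
    hk.integrable.abs ?_
  · filter_upwards [eventually_gt_atTop 0] with r hr
    exact (integrable_z (QG_la Λ) (aesm_la hcl) hk.continuous hk.bound 0 hr).aestronglyMeasurable
  · refine Eventually.of_forall fun r => Eventually.of_forall fun z => ?_
    rw [Real.norm_eq_abs, abs_mul, abs_of_nonneg (la_nonneg _ _)]
    exact mul_le_of_le_one_left (abs_nonneg _) (la_le_one _ _)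
  · refine Eventually.of_forall fun z => tendsto_const_nhds.congr' ?_
    by_cases hz : z ∈ recCone Λ
    · filter_upwards [eventually_ge_atTop 0] with r hr
      rw [la_of_mem (by simpa using hz), la_of_mem (by simpa using hz r hr)]
    · have : ∃ t : ℝ, 0 ≤ t ∧ t • z ∉ Λ := by
        by_contra! hcon
        exact hz hcon
      obtain ⟨t, ht, htz⟩ := this
      filter_upwards [eventually_ge_atTop t] with r hr
      rw [la_of_notMem (by simpa using hz), la_of_notMem (x := 0 + r • z)]
      rw [zero_add]
      exact fun hrz => htz (smul_mem_of_le hconv h0 ht hr hrz)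

theorem GSol.I_rec_eq_zero (h : GSol M Λ u) (hconv : Convex ℝ Λ) (h0 : (0 : EN N) ∈ Λ)
    (e f : EN N) : I (la (recCone Λ)) (kq (phi N) e f) 0 1 = 0 := by
  have hT := tendsto_I_rec h.closed hconv h0 ((KBφ N).kq e f)
  have hd := fun r hr => h.hasDerivAt_A' (KBφ N) 0 e f (r := r) hr
  have hb := fun r hr => h.abs_A_le (KBφ N) 0 e f one_pos (r := r) hr
  refine le_antisymm (limit_nonpos hd hb hT) ?_
  have := limit_nonpos (F := fun r => -A u (phi N) 0 r e f)
    (J := fun r => -I (la Λ) (kq (phi N) e f) 0 r)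
    (fun r hr => by rw [mul_neg]; exact (hd r hr).neg)
    (fun r hr => by rw [abs_neg]; exact hb r hr) hT.neg
  linarith

theorem half_space_subset_rec (hcl : IsClosed Λ) (hconv : Convex ℝ Λ) {ν e : EN N}
    (hν : ∀ x ∈ recCone Λ, ⟪x, ν⟫ ≤ 0) (he : e ∈ interior (recCone Λ))
    (hI : I (la (recCone Λ)) (kq (phi N) ν e) 0 1 = 0) {q : EN N} (hq : ⟪q, ν⟫ < 0) :
    q ∈ recCone Λ := by
  by_contra hqC
  have hcC := isClosed_rec hcl
  have heC := interior_subset he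
  have hkl := (KBφ N).kl ν
  obtain ⟨G, hG⟩ : ∃ G : ℝ → ℝ,
      G = fun τ => I (la (recCone Λ)) (kl (phi N) ν) (0 + τ • e) 1 := ⟨_, rfl⟩
  have hGd : HasDerivAt G 0 0 := by
    have h1 := hasDerivAt_I_translate (QG_la (recCone Λ)) (aesm_la hcC) hkl 0 e one_pos 0
    simp only [fderiv_kl (prof_phi N), I_neg_kernel, zero_smul, add_zero, hI, neg_zero,
      mul_zero] at h1
    rwa [hG]
  obtain ⟨Ψ, hΨ⟩ : ∃ Ψ : ℝ → EN N → ℝ, Ψ = fun s x =>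
      (la (recCone Λ) x - la (recCone Λ) (x - s • e)) * -kl (phi N) ν x := ⟨_, rfl⟩
  have hint1 : ∀ s : ℝ, Integrable fun z => la (recCone Λ) (0 + s • e + (1 : ℝ) • z) * kl (phi N) ν z :=
    fun s => integrable_z (QG_la _) (aesm_la hcC) hkl.continuous hkl.bound _ one_pos
  have hΨeq : ∀ s, Ψ s = fun z => la (recCone Λ) (0 + (-s) • e + (1 : ℝ) • z) * kl (phi N) ν z -
      la (recCone Λ) (0 + (0 : ℝ) • e + (1 : ℝ) • z) * kl (phi N) ν z := fun s => by
    ext z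
    rw [hΨ]
    have e1 : 0 + (-s) • e + (1 : ℝ) • z = z - s • e := by module
    have e2 : 0 + (0 : ℝ) • e + (1 : ℝ) • z = z := by module
    rw [e1, e2]; ring
  have hΨi : ∀ s, Integrable (Ψ s) := fun s => by
    rw [hΨeq]; exact (hint1 _).sub (hint1 _)
  have hΨE : ∀ s, ∫ x, Ψ s x = G (-s) - G 0 := fun s => by
    rw [hΨeq, integral_sub (hint1 _) (hint1 _), hG]; rfl
  have hψ0 : ∀ s : ℝ, 0 ≤ s → ∀ x, 0 ≤ la (recCone Λ) x - la (recCone Λ) (x - s • e) := fun s hs x => by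
    by_cases hx : x - s • e ∈ recCone Λ
    · have := add_mem_rec hconv hx (smul_mem_rec heC hs)
      rw [sub_add_cancel] at this
      rw [la_of_mem this, la_of_mem hx, sub_self]
    · rw [la_of_notMem hx, sub_zero]; exact la_nonneg _ _
  have hΨ0 : ∀ s : ℝ, 0 ≤ s → ∀ x, 0 ≤ Ψ s x := fun s hs x => by
    rw [hΨ]
    by_cases hx : x ∈ recCone Λ
    · refine mul_nonneg (hψ0 s hs x) ?_
      have := mul_nonneg (neg_nonneg.2 (hν x hx)) (phi_pos N (sq_nonneg ‖x‖)).le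
      show 0 ≤ -(⟪x, ν⟫ * phi N (‖x‖ ^ 2))
      linarith
    · have h1 := hψ0 s hs x
      rw [la_of_notMem hx] at h1
      have h2 := la_nonneg (recCone Λ) (x - s • e)
      have h3 : la (recCone Λ) x - la (recCone Λ) (x - s • e) = 0 := by rw [la_of_notMem hx]; linarith
      show 0 ≤ (la (recCone Λ) x - la (recCone Λ) (x - s • e)) * -kl (phi N) ν x
      rw [h3, zero_mul]
  obtain ⟨a, ha⟩ : ∃ a, a = -⟪q, ν⟫ / 2 := ⟨_, rfl⟩
  have ha0 : 0 < a := by rw [ha]; linarith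
  obtain ⟨ρ, hρ, hρ1⟩ : ∃ ρ > 0, ∀ x ∈ ball q ρ, x ∉ recCone Λ ∧ ⟪x, ν⟫ < -a := by
    have h1 : ∀ᶠ x in nhds q, x ∉ recCone Λ := hcC.isOpen_compl.mem_nhds hqC
    have h2 : ∀ᶠ x in nhds q, ⟪x, ν⟫ < -a := by
      have hc : Continuous fun x : EN N => ⟪x, ν⟫ := by fun_prop
      exact hc.continuousAt.eventually_lt continuousAt_const (by rw [ha]; linarith)
    exact Metric.eventually_nhds_iff_ball.1 (h1.and h2)
  obtain ⟨η, hη, hηC⟩ := Metric.isOpen_iff.1 isOpen_interior e he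
  obtain ⟨K, hK, hKC⟩ : ∃ K : ℝ, 0 < K ∧ ∀ x ∈ ball q ρ, x + K • e ∈ recCone Λ := by
    refine ⟨(‖q‖ + ρ) / η, by positivity, fun x hx => ?_⟩
    have hK : 0 < (‖q‖ + ρ) / η := by positivity
    have h1 : e + ((‖q‖ + ρ) / η)⁻¹ • x ∈ recCone Λ := by
      refine interior_subset (hηC ?_)
      rw [mem_ball_iff_norm, add_sub_cancel_left, norm_smul, norm_inv, Real.norm_eq_abs,
        abs_of_pos hK, inv_mul_lt_iff₀ hK, div_mul_cancel₀ _ hη.ne']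
      have h2 := mem_ball_iff_norm.1 hx
      have h3 := norm_add_le (x - q) q
      rw [sub_add_cancel] at h3
      linarith
    have h2 := smul_mem_rec h1 hK.le
    rwa [smul_add, smul_smul, mul_inv_cancel₀ hK.ne', one_smul, add_comm] at h2
  obtain ⟨m, hm⟩ : ∃ m, m = a * phi N ((‖q‖ + ρ + K * ‖e‖) ^ 2) := ⟨_, rfl⟩
  have hm0 : 0 < m := hm ▸ mul_pos ha0 (phi_pos N (sq_nonneg _))
  have hlow : ∀ x ∈ ball q ρ, ∀ t : ℝ, 0 ≤ t → t ≤ K → m ≤ -kl (phi N) ν (x + t • e) := by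
    intro x hx t ht htK
    have h1 := (hρ1 x hx).2
    have h2 : ‖x + t • e‖ ≤ ‖q‖ + ρ + K * ‖e‖ := by
      have h2 := mem_ball_iff_norm.1 hx
      have h3 := norm_add_le (x - q) q
      rw [sub_add_cancel] at h3
      have h4 := norm_add_le x (t • e)
      rw [norm_smul, Real.norm_eq_abs, abs_of_nonneg ht] at h4
      have h5 := mul_le_mul_of_nonneg_right htK (norm_nonneg e)
      linarith
    have h3 : phi N ((‖q‖ + ρ + K * ‖e‖) ^ 2) ≤ phi N (‖x + t • e‖ ^ 2) := by
      unfold phi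
      gcongr
    have h4 : a ≤ -⟪x + t • e, ν⟫ := by
      rw [inner_add_left, real_inner_smul_left]
      have := mul_nonneg ht (neg_nonneg.2 (hν e heC))
      linarith
    have h5 := mul_le_mul h4 h3 (phi_pos N (sq_nonneg _)).le (ha0.le.trans h4)
    show m ≤ -(⟪x + t • e, ν⟫ * phi N (‖x + t • e‖ ^ 2))
    rw [hm]; linarith
  have key : ∀ n : ℕ, 0 < n →
      volume.real (ball q ρ) * m ≤ n * (G (-(K / n)) - G 0) := by
    intro n hn
    have hn0 : (0 : ℝ) < n := Nat.cast_pos.2 hn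
    obtain ⟨s, hs⟩ : ∃ s, s = K / n := ⟨_, rfl⟩
    have hs0 : 0 ≤ s := hs ▸ (div_pos hK hn0).le
    have hns : n * s = K := by rw [hs]; field_simp
    have hpt : ∀ x, (ball q ρ).indicator (fun _ => m) x ≤
        ∑ j ∈ Finset.range n, Ψ s (x + ((j + 1 : ℕ) * s) • e) := by
      intro x
      by_cases hx : x ∈ ball q ρ
      · rw [indicator_of_mem hx]
        have h1 : ∑ j ∈ Finset.range n, (la (recCone Λ) (x + ((j + 1 : ℕ) * s) • e) -
            la (recCone Λ) (x + ((j : ℕ) * s) • e)) = 1 := by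
          rw [Finset.sum_range_sub (fun j : ℕ => la (recCone Λ) (x + (j * s) • e)), hns,
            la_of_mem (hKC x hx)]
          simp [la_of_notMem (hρ1 x hx).1]
        calc m = ∑ j ∈ Finset.range n, (la (recCone Λ) (x + ((j + 1 : ℕ) * s) • e) -
            la (recCone Λ) (x + ((j : ℕ) * s) • e)) * m := by rw [← Finset.sum_mul, h1, one_mul]
          _ ≤ _ := Finset.sum_le_sum fun j hj => ?_
        have e1 : x + ((j + 1 : ℕ) * s) • e - s • e = x + ((j : ℕ) * s) • e := by
          push_cast; module
        rw [hΨ]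
        simp only [e1]
        have h2 := hψ0 s hs0 (x + ((j + 1 : ℕ) * s) • e)
        rw [e1] at h2
        refine mul_le_mul_of_nonneg_left (hlow x hx _ (by positivity) ?_) h2
        rw [← hns]
        have : ((j + 1 : ℕ) : ℝ) ≤ n := Nat.cast_le.2 (Finset.mem_range.1 hj)
        exact mul_le_mul_of_nonneg_right this hs0
      · rw [indicator_of_notMem hx]
        exact Finset.sum_nonneg fun j _ => hΨ0 s hs0 _
    have hi : ∀ j ∈ Finset.range n, Integrable fun x => Ψ s (x + ((j + 1 : ℕ) * s) • e) :=
      fun j _ => (hΨi s).comp_add_right _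
    have h1 := integral_mono ((integrable_indicator_iff measurableSet_ball).2
      (integrableOn_const (measure_ball_lt_top.ne))) (integrable_finsetSum _ hi) hpt
    rw [integral_indicator measurableSet_ball, setIntegral_const, integral_finsetSum _ hi] at h1
    simp only [integral_add_right_eq_self (Ψ s), hΨE, Finset.sum_const, Finset.card_range,
      nsmul_eq_mul, smul_eq_mul] at h1
    rw [hs] at h1
    exact h1
  have hvol : 0 < volume.real (ball q ρ) :=
    ENNReal.toReal_pos (measure_ball_pos _ _ hρ).ne' measure_ball_lt_top.ne
  obtain ⟨ε, hε⟩ : ∃ ε, ε = volume.real (ball q ρ) * m / (2 * K) := ⟨_, rfl⟩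
  have hε0 : 0 < ε := by rw [hε]; positivity
  have h1 := (hasDerivAt_iff_isLittleO_nhds_zero.1 hGd).def hε0
  obtain ⟨δ, hδ, hδ1⟩ := Metric.eventually_nhds_iff_ball.1 h1
  obtain ⟨n, hn⟩ := exists_nat_gt (K / δ)
  have hn0 : (0 : ℝ) < n := (div_pos hK hδ).trans hn
  have h2 := hδ1 (-(K / n)) (by
    rw [mem_ball_zero_iff, norm_neg, Real.norm_eq_abs, abs_of_pos (div_pos hK hn0),
      div_lt_iff₀ hn0]
    rw [div_lt_iff₀ hδ] at hn
    linarith)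
  simp only [zero_add, smul_zero, sub_zero, norm_neg, Real.norm_eq_abs,
    abs_of_pos (div_pos hK hn0)] at h2
  have h3 := key n (Nat.cast_pos.1 hn0)
  have h4 := mul_le_mul_of_nonneg_left ((le_abs_self _).trans h2) hn0.le
  have h5 : (n : ℝ) * (ε * (K / n)) = volume.real (ball q ρ) * m / 2 := by
    rw [hε]; field_simp
  have h6 : 0 < volume.real (ball q ρ) * m := by positivity
  linarith

theorem GSol.half_space_A_tangential {ν : EN N} (h : GSol M {x | ⟪x, ν⟫ ≤ 0} u)
    {v : EN N} (hv : ⟪v, ν⟫ = 0) (x e : EN N) {r : ℝ} (hr : 0 < r) : A u bet x r e v = 0 := by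
  obtain ⟨Λ, hΛ⟩ : ∃ Λ : Set (EN N), Λ = {x | ⟪x, ν⟫ ≤ 0} := ⟨_, rfl⟩
  rw [← hΛ] at h
  have hmem : ∀ x, x ∈ Λ ↔ ⟪x, ν⟫ ≤ 0 := fun x => by rw [hΛ]; rfl
  have hg := KBβ N
  have hI : ∀ y s, 0 < s → I (la Λ) (kq bet e v) y s = 0 := fun y s hs => by
    have h1 := hasDerivAt_I_translate (QG_la Λ) (aesm_la h.closed) (hg.kl e) y v hs 0
    have h2 : (fun τ : ℝ => I (la Λ) (kl bet e) (y + τ • v) s) =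
        fun _ => I (la Λ) (kl bet e) y s := by
      ext τ
      refine integral_congr_ae (Eventually.of_forall fun z => ?_)
      have : la Λ (y + τ • v + s • z) = la Λ (y + s • z) := by
        have hiff : y + τ • v + s • z ∈ Λ ↔ y + s • z ∈ Λ := by
          rw [hmem, hmem]
          simp [inner_add_left, real_inner_smul_left, hv]
        by_cases hz : y + s • z ∈ Λ
        · rw [la_of_mem hz, la_of_mem (hiff.2 hz)]
        · rw [la_of_notMem hz, la_of_notMem (fun hc => hz (hiff.1 hc))]
      simp only [this]
    rw [h2] at h1
    have h3 := h1.unique (hasDerivAt_const _ _)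
    simp only [fderiv_kl (prof_bet N), I_neg_kernel, zero_smul, add_zero, mul_neg, neg_neg] at h3
    exact (mul_eq_zero.1 h3).resolve_left (inv_pos.2 hs).ne'
  have hconst : ∀ y r, 0 < r → A u bet y r e v = A u bet y 1 e v := by
    intro y r hr
    have hd : ∀ s ∈ Ioi (0 : ℝ), HasDerivWithinAt (fun r => A u bet y r e v) 0 (Ioi 0) s :=
      fun s hs => by
        have := h.hasDerivAt_A' hg y e v hs
        rw [hI _ _ hs, mul_zero, neg_zero] at this
        exact this.hasDerivWithinAt
    have := (convex_Ioi (0 : ℝ)).norm_image_sub_le_of_norm_hasDerivWithin_le (C := 0) hd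
      (fun s _ => by simp) (mem_Ioi.2 one_pos) (mem_Ioi.2 hr)
    rw [zero_mul, norm_le_zero_iff, sub_eq_zero] at this
    exact this
  have hconst' : ∀ y r, 0 < r → A u bet y r e v = A u bet 0 1 e v := by
    intro y r hr
    rw [hconst y r hr]
    have h1 := h.tendsto_A_sub hg y 0 e v
    have h2 : (fun R => A u bet y R e v - A u bet 0 R e v) =ᶠ[atTop]
        fun _ => A u bet y 1 e v - A u bet 0 1 e v := by
      filter_upwards [eventually_gt_atTop 0] with R hR
      rw [hconst y R hR, hconst 0 R hR]
    have := tendsto_nhds_unique (h1.congr' h2) tendsto_const_nhds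
    linarith
  rw [hconst' x r hr]
  have h1 := (h.tendsto_V hg v e).sub (h.tendsto_V hg 0 e)
  have h2 : (fun r => V u bet v r e - V u bet 0 r e) =ᶠ[nhdsWithin 0 (Ioi 0)]
      fun _ => A u bet 0 1 e v := by
    filter_upwards [self_mem_nhdsWithin] with r hr
    obtain ⟨t, -, ht⟩ := h.V_sub hg 0 v e hr
    rw [ht, sub_zero, hconst' _ r hr]
  have := tendsto_nhds_unique (h1.congr' h2) tendsto_const_nhds
  rw [(h.zero 0 ((hmem 0).2 (by simp))).2, (h.zero v ((hmem v).2 hv.le)).2] at this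
  simpa using this.symm

theorem GSol.half_space_A_normal {ν : EN N} (hν : ‖ν‖ = 1) (h : GSol M {x | ⟪x, ν⟫ ≤ 0} u)
    {x : EN N} {r : ℝ} (hr : 0 < r) (hx : r ≤ ⟪x, ν⟫) : A u bet x r ν ν = mass N bet := by
  have hg := KBβ N
  have hνν : ⟪ν, ν⟫ = 1 := by rw [real_inner_self_eq_norm_sq, hν, one_pow]
  have hd : ∀ e f, A u bet x r e f = ⟪f, ν⟫ * A u bet x r e ν := fun e f => by
    have h1 := h.A_right hg x hr ⟪f, ν⟫ 1 ν (f - ⟪f, ν⟫ • ν) e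
    have h2 : ⟪f - ⟪f, ν⟫ • ν, ν⟫ = 0 := by
      rw [inner_sub_left, real_inner_smul_left, hνν, mul_one, sub_self]
    rw [one_smul, add_sub_cancel, h.half_space_A_tangential h2 x e hr] at h1
    linarith
  have h1 := h.sum_A hg x hr
  have h2 : ∀ i : Fin N, A u bet x r (EuclideanSpace.single i 1) (EuclideanSpace.single i 1) =
      (⟪ν, EuclideanSpace.single i (1 : ℝ)⟫ * ⟪EuclideanSpace.single i (1 : ℝ), ν⟫) *
        A u bet x r ν ν := fun i => by
    rw [hd, A_symm, hd ν, real_inner_comm ν (EuclideanSpace.single i (1 : ℝ))]; ring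
  simp only [h2] at h1
  rw [← Finset.sum_mul, sum_inner_mul, hνν, one_mul] at h1
  rw [h1]
  refine integral_congr_ae (Eventually.of_forall fun z => ?_)
  simp only [kr]
  rcases lt_or_ge ‖z‖ 1 with hz | hz
  · have hnm : x + r • z ∉ {x | ⟪x, ν⟫ ≤ 0} := by
      show ¬(⟪x + r • z, ν⟫ ≤ 0)
      rw [inner_add_left, real_inner_smul_left, not_le]
      have h3 := abs_le.1 (abs_real_inner_le_norm z ν)
      rw [hν, mul_one] at h3
      have h4 : -1 < ⟪z, ν⟫ := by linarith
      nlinarith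
    have := om_add_la {x : EN N | ⟪x, ν⟫ ≤ 0} (x + r • z)
    rw [la_of_notMem hnm, add_zero] at this
    rw [this, one_mul]
  · rw [bet_eq_zero (one_le_pow₀ hz), mul_zero]

theorem GSol.half_space_sol {ν : EN N} (hν : ‖ν‖ = 1) (h : GSol M {x | ⟪x, ν⟫ ≤ 0} u) (x : EN N) :
    u x = (max ⟪x, ν⟫ 0) ^ 2 / 2 := by
  have hg := KBβ N
  have hm := massβ_pos N
  have hνν : ⟪ν, ν⟫ = 1 := by rw [real_inner_self_eq_norm_sq, hν, one_pow]
  rcases le_or_gt ⟪x, ν⟫ 0 with hx | hx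
  · rw [(h.zero x hx).1, max_eq_right hx]; simp
  rw [max_eq_left hx.le]
  have hstep : ∀ y : EN N, 0 < ⟪y, ν⟫ → ∀ t, 0 < t →
      fderiv ℝ u (y + t • ν) ν - fderiv ℝ u y ν = t := by
    intro y hy t ht
    have h1 := (h.tendsto_V hg (y + t • ν) ν).sub (h.tendsto_V hg y ν)
    have h2 : (fun r => V u bet (y + t • ν) r ν - V u bet y r ν) =ᶠ[nhdsWithin 0 (Ioi 0)]
        fun _ => t * mass N bet := by
      filter_upwards [Ioo_mem_nhdsGT hy] with r hr
      obtain ⟨s, hs, hsV⟩ := h.V_sub hg y (y + t • ν) ν hr.1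
      rw [hsV, add_sub_cancel_left]
      have h3 := h.A_smul hg (y + s • t • ν) hr.1 1 t ν ν
      rw [one_smul, one_mul] at h3
      rw [h3, h.half_space_A_normal hν hr.1]
      rw [inner_add_left, real_inner_smul_left, real_inner_smul_left, hνν, mul_one]
      have := mul_pos hs.1 ht
      linarith [hr.2]
    have := tendsto_nhds_unique (h1.congr' h2) tendsto_const_nhds
    rw [← mul_sub, mul_comm t] at this
    exact mul_left_cancel₀ hm.ne' this
  obtain ⟨p, hp⟩ : ∃ p, p = x - ⟪x, ν⟫ • ν := ⟨_, rfl⟩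
  have hpν : ⟪p, ν⟫ = 0 := by rw [hp, inner_sub_left, real_inner_smul_left, hνν, mul_one, sub_self]
  have hD0 : fderiv ℝ u p ν = 0 := by rw [(h.zero p hpν.le).2]; simp
  have hD : ∀ s, 0 < s → fderiv ℝ u (p + s • ν) ν = s := by
    intro s hs
    have hc : Continuous fun ε : ℝ => fderiv ℝ u (p + ε • ν) ν :=
      ((h.smooth.continuous_fderiv one_ne_zero).comp (by fun_prop)).clm_apply continuous_const
    have h1 : Tendsto (fun ε : ℝ => fderiv ℝ u (p + ε • ν) ν) (nhdsWithin 0 (Ioi 0)) (nhds 0) := by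
      have := hc.tendsto 0
      rw [zero_smul, add_zero, hD0] at this
      exact this.mono_left nhdsWithin_le_nhds
    have h2 : (fun ε : ℝ => fderiv ℝ u (p + ε • ν) ν) =ᶠ[nhdsWithin 0 (Ioi 0)]
        fun ε => fderiv ℝ u (p + s • ν) ν - (s - ε) := by
      filter_upwards [Ioo_mem_nhdsGT hs] with ε hε
      have := hstep (p + ε • ν) (by
        rw [inner_add_left, hpν, real_inner_smul_left, hνν]; linarith [hε.1]) (s - ε)
        (sub_pos.2 hε.2)
      have e1 : p + ε • ν + (s - ε) • ν = p + s • ν := by module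
      rw [e1] at this
      linarith
    have h3 : Tendsto (fun ε : ℝ => fderiv ℝ u (p + s • ν) ν - (s - ε)) (nhdsWithin 0 (Ioi 0))
        (nhds (fderiv ℝ u (p + s • ν) ν - (s - 0))) :=
      Tendsto.mono_left (Continuous.tendsto (by fun_prop) 0) nhdsWithin_le_nhds
    have := tendsto_nhds_unique (h1.congr' h2) h3
    linarith
  have hd : ∀ t : ℝ, HasDerivAt (fun t : ℝ => u (p + t • ν) - t ^ 2 / 2)
      (fderiv ℝ u (p + t • ν) ν - t) t := fun t => by
    have h2 : HasDerivAt (fun t : ℝ => t ^ 2 / 2) t t := by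
      have := (hasDerivAt_pow 2 t).div_const 2
      simpa using this
    exact (hasDerivAt_line h.smooth p ν t).sub h2
  obtain ⟨t, ht, he⟩ := exists_hasDerivAt_eq_slope (fun t : ℝ => u (p + t • ν) - t ^ 2 / 2) _
    hx (fun t _ => (hd t).continuousAt.continuousWithinAt) (fun t _ => hd t)
  rw [hD t ht.1, sub_self] at he
  have h3 := (div_eq_zero_iff.1 he.symm).resolve_right (by linarith)
  simp only [zero_smul, add_zero, (h.zero p hpν.le).1] at h3
  rw [show p + ⟪x, ν⟫ • ν = x by rw [hp]; module] at h3
  linarith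

theorem GSol.isHalfSpaceSol (h : GSol M Λ u) (hconv : Convex ℝ Λ) (h0 : (0 : EN N) ∈ Λ)
    (h0' : (0 : EN N) ∉ interior Λ) (hrec : (interior (recCone Λ)).Nonempty) :
    IsHalfSpaceSol N u := by
  obtain ⟨ν, hν, hνΛ⟩ := exists_supporting_normal h.closed hconv
    (hrec.mono (interior_mono rec_subset)) h0'
  obtain ⟨e, he⟩ := hrec
  have hlt : {x : EN N | ⟪x, ν⟫ < 0} ⊆ Λ := fun q hq =>
    rec_subset (half_space_subset_rec h.closed hconv (fun x hx => hνΛ x (rec_subset hx)) he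
      (h.I_rec_eq_zero hconv h0 ν e) hq)
  have heq : Λ = {x | ⟪x, ν⟫ ≤ 0} := by
    refine Subset.antisymm hνΛ fun x hx => ?_
    have hx' : ⟪x, ν⟫ ≤ 0 := hx
    have h1 : Tendsto (fun ε : ℝ => x - ε • ν) (nhdsWithin 0 (Ioi 0)) (nhds x) := by
      have : Continuous fun ε : ℝ => x - ε • ν := by fun_prop
      have h2 := this.tendsto 0
      rw [zero_smul, sub_zero] at h2
      exact h2.mono_left nhdsWithin_le_nhds
    refine h.closed.mem_of_tendsto h1 ?_
    filter_upwards [self_mem_nhdsWithin] with ε hε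
    refine hlt ?_
    show ⟪x - ε • ν, ν⟫ < 0
    rw [inner_sub_left, real_inner_smul_left, real_inner_self_eq_norm_sq, hν]
    have : 0 < ε := hε
    linarith
  rw [heq] at h
  exact ⟨ν, hν, h.half_space_sol hν⟩

end GlobalSol

namespace GlobalSol
variable {N : ℕ}
variable {M : ℝ} {Λ : Set (EN N)} {u : EN N → ℝ}

theorem gradient_eq_zero_iff {x : EN N} : gradient u x = 0 ↔ fderiv ℝ u x = 0 :=
  LinearIsometryEquiv.map_eq_zero_iff _

theorem volume_ne_zero_of_thick (h : GSol M Λ u) (h0 : (0 : EN N) ∈ Λ)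
    (hthick : (interior {x | u x = 0}).Nonempty ∨ ∃ r > 0, 0 < deltaFn N u r) :
    volume Λ ≠ 0 := by
  intro hv
  obtain ⟨w, hw0, hw⟩ := h.zero_set_subset_hyperplane h0 hv
  rcases hthick with ⟨p, hp⟩ | ⟨r, hr, hd⟩
  · have hz : ∀ᶠ z in nhds p, ⟪z, w⟫ = 0 := by
      filter_upwards [isOpen_interior.mem_nhds hp] with z hz
      refine hw z ?_
      have : u =ᶠ[nhds z] fun _ => 0 := mem_interior_iff_mem_nhds.1 hz
      rw [this.fderiv_eq]; simp
    have hc : Continuous fun ε : ℝ => p + ε • w := by fun_prop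
    have h1 := hc.tendsto 0
    rw [zero_smul, add_zero] at h1
    obtain ⟨ε, hε, hε0⟩ := (((h1.mono_left nhdsWithin_le_nhds).eventually hz).and
      (self_mem_nhdsWithin : Ioi (0 : ℝ) ∈ nhdsWithin 0 (Ioi 0))).exists
    have hε0' : 0 < ε := hε0
    rw [inner_add_left, hz.self_of_nhds, zero_add, real_inner_smul_left,
      real_inner_self_eq_norm_sq] at hε
    have := norm_pos_iff.2 hw0
    exact absurd hε (by positivity)
  · obtain ⟨v, hv, hwv⟩ := exists_unit w hw0
    have h1 := MD_le (D := {x | u x = 0 ∧ gradient u x = 0} ∩ ball 0 r)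
      ⟨0, ⟨(h.zero 0 h0).1, gradient_eq_zero_iff.2 (h.zero 0 h0).2⟩, mem_ball_self hr⟩ hv (c := 0)
      fun x hx => by
        have := hw x (gradient_eq_zero_iff.1 hx.1.2)
        rw [hwv, real_inner_smul_right] at this
        rw [(mul_eq_zero.1 this).resolve_left (norm_ne_zero_iff.2 hw0), abs_zero]
    unfold deltaFn at hd
    have h2 := (div_pos_iff_of_pos_right hr).1 hd
    linarith

theorem GSol.of_memPinf {Ω : Set (EN N)} (hu : MemPinf N M Ω u) : GSol M Ωᶜ u where
  closed := hu.1.isClosed_compl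
  smooth := hu.2.1
  weak φ hs hc := by rw [compl_compl]; exact hu.2.2.1 φ hs hc
  zero x hx := (hu.2.2.2.1 x hx).imp_right gradient_eq_zero_iff.1
  growth x := by rw [add_comm]; exact hu.2.2.2.2.2 x

end GlobalSol

/-- global solutions with thick zero set are nonnegative, have convex
complement, and are half-space solutions if the complement is thick at infinity. -/
theorem global_solution_structure (N : ℕ) (hN : 2 ≤ N) (M : ℝ) (hM : 0 < M)
    (Ω : Set (EuclideanSpace ℝ (Fin N))) (u : EuclideanSpace ℝ (Fin N) → ℝ)
    (hu : MemPinf N M Ω u)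
    (hthick : (interior {x | u x = 0}).Nonempty ∨ ∃ r > 0, 0 < deltaFn N u r) :
    (∀ x, 0 ≤ u x) ∧ Convex ℝ Ωᶜ ∧
      (0 < Filter.limsup (fun R => deltaFn N u R) Filter.atTop → IsHalfSpaceSol N u) := by
  have h := GlobalSol.GSol.of_memPinf hu
  have hfr := hu.2.2.2.2.1
  have h0 : (0 : EuclideanSpace ℝ (Fin N)) ∈ Ωᶜ := by
    rw [hu.1.frontier_eq] at hfr
    exact hfr.2
  have h0' : (0 : EuclideanSpace ℝ (Fin N)) ∉ interior Ωᶜ := by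
    rw [interior_compl]
    exact not_not.2 hfr.1
  have hv := GlobalSol.volume_ne_zero_of_thick h h0 hthick
  obtain ⟨S, -, hS, -⟩ := h.exists_full hv
  obtain ⟨hnn, heq, hconv, -⟩ := h.convex_zero hS.mono_zero h0 hv
  refine ⟨hnn, hconv, fun hd => ?_⟩
  have hΛ : {x | u x = 0 ∧ gradient u x = 0} = Ωᶜ :=
    Subset.antisymm (fun x hx => by rw [heq]; exact hx.1) hu.2.2.2.1
  exact h.isHalfSpaceSol hconv h0 h0'
    (GlobalSol.interior_rec_nonempty h.closed hconv h0 hΛ hd)
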